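/- For every integer d ≥ 3 there is a constant C = C(d) with the following property (Partition Theorem for shallow points). Let P be a set of n points in ℝ^d in general position, all of whose points are k-shallow in P, where k is an integer with 2 ≤ k ≤ n/2. Then there exist a partition of P into classes P₁, …, P_m with k ≤ |P_i| ≤ 2k for every i, and open d-simplices Δ₁, …, Δ_m with P_i ⊆ Δ_i for every i, such that every hyperplane in ℝ^d intersects at most C · (n/k)^{1−1/(d−1)} · (log₂(n/k))^{2/(d−1)} of the simplices Δ₁, …, Δ_m. -/

import Mathlib

open scoped RealInnerProductSpace
open scoped Classical

noncomputable section

/-- A closed halfspace in `ℝ^d`. -/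
def halfspace {d : ℕ} (a : EuclideanSpace ℝ (Fin d)) (b : ℝ) : Set (EuclideanSpace ℝ (Fin d)) :=
  {x | ⟪x, a⟫ ≤ b}

/-- A hyperplane in `ℝ^d`. -/
def hyperplane {d : ℕ} (a : EuclideanSpace ℝ (Fin d)) (b : ℝ) : Set (EuclideanSpace ℝ (Fin d)) :=
  {x | ⟪x, a⟫ = b}

/-- A point `p` of a finite set `P` is `k`-shallow if some closed halfspace contains `p`
and at most `k` points of `P` (including `p`). -/
def IsShallowPt {d : ℕ} (P : Finset (EuclideanSpace ℝ (Fin d))) (k : ℕ)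
    (p : EuclideanSpace ℝ (Fin d)) : Prop :=
  ∃ a b, a ≠ 0 ∧ p ∈ halfspace a b ∧
    ((P : Set (EuclideanSpace ℝ (Fin d))) ∩ halfspace a b).ncard ≤ k

/-- `P` is in general position: no `d+1` points of `P` lie on a common hyperplane. -/
def GenPos {d : ℕ} (P : Finset (EuclideanSpace ℝ (Fin d))) : Prop :=
  ∀ (a : EuclideanSpace ℝ (Fin d)) (b : ℝ), a ≠ 0 →
    ((P : Set (EuclideanSpace ℝ (Fin d))) ∩ hyperplane a b).ncard ≤ d

/-- An open `d`-simplex: the interior of the convex hull of `d+1` affinely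
independent points. -/
def IsOpenSimplex {d : ℕ} (Δ : Set (EuclideanSpace ℝ (Fin d))) : Prop :=
  ∃ v : Fin (d + 1) → EuclideanSpace ℝ (Fin d),
    AffineIndependent ℝ v ∧ Δ = interior (convexHull ℝ (Set.range v))

namespace ShallowPartition

/-- The value at `x` of the affine functional with linear part `u.1` and constant term `u.2`. -/
def ev {d : ℕ} (u : EuclideanSpace ℝ (Fin d) × ℝ) (x : EuclideanSpace ℝ (Fin d)) : ℝ :=
  ⟪u.1, x⟫ + u.2

section Basic

variable {d : ℕ}

lemma ev_add_smul (u : EuclideanSpace ℝ (Fin d) × ℝ) (x w : EuclideanSpace ℝ (Fin d)) (t : ℝ) :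
    ev u (x + t • w) = ev u x + t * ⟪u.1, w⟫ := by
  simp only [ev, inner_add_right, real_inner_smul_right]; ring

lemma ev_combo (u : EuclideanSpace ℝ (Fin d) × ℝ) (x z : EuclideanSpace ℝ (Fin d)) {a b : ℝ}
    (hab : a + b = 1) : ev u (a • x + b • z) = a * ev u x + b * ev u z := by
  simp only [ev, inner_add_right, real_inner_smul_right]
  linear_combination (-u.2) * hab

lemma ev_sub (u : EuclideanSpace ℝ (Fin d) × ℝ) (x z : EuclideanSpace ℝ (Fin d)) :
    ev u x - ev u z = ⟪u.1, x - z⟫ := by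
  simp only [ev, inner_sub_right]; ring

lemma continuous_ev (u : EuclideanSpace ℝ (Fin d) × ℝ) : Continuous (ev u) := by
  unfold ev; fun_prop

/-- General position of a family of affine functionals, and genericity of the direction `φ`
with respect to it. -/
structure GP {ι : Type*} [Fintype ι] (y : ι → EuclideanSpace ℝ (Fin d) × ℝ)
    (φ : EuclideanSpace ℝ (Fin d)) : Prop where
  indep : ∀ A : Finset ι, A.card ≤ d → LinearIndependent ℝ (fun h : A => (y h).1)
  card_zero : ∀ x, (Finset.univ.filter fun h => ev (y h) x = 0).card ≤ d
  generic : ∀ J : Finset ι, J.card < d → φ ∉ Submodule.span ℝ ((fun h => (y h).1) '' (J : Set ι))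

variable {ι : Type*} {y : ι → EuclideanSpace ℝ (Fin d) × ℝ}
  {φ : EuclideanSpace ℝ (Fin d)}

lemma GP.card_le [Fintype ι] (hy : GP y φ) {A : Finset ι} {x : EuclideanSpace ℝ (Fin d)}
    (h : ∀ i ∈ A, ev (y i) x = 0) : A.card ≤ d :=
  (Finset.card_le_card fun i hi => by simp [h i hi]).trans (hy.card_zero x)

lemma GP.span_eq_top [Fintype ι] (hy : GP y φ) {A : Finset ι} (hA : A.card = d) :
    Submodule.span ℝ ((fun h => (y h).1) '' (A : Set ι)) = ⊤ := by
  have h := (hy.indep A hA.le).span_eq_top_of_card_eq_finrank' (by simp [hA])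
  rw [← h]
  congr 1
  ext x; simp

lemma GP.decomp [Fintype ι] (hy : GP y φ) {A : Finset ι} (hA : A.card = d)
    (ψ : EuclideanSpace ℝ (Fin d)) :
    ∃ c : ι → ℝ, ψ = ∑ h ∈ A, c h • (y h).1 := by
  have h : ψ ∈ Submodule.span ℝ ((fun h => (y h).1) '' (A : Set ι)) := by
    rw [hy.span_eq_top hA]; trivial
  obtain ⟨c, hc⟩ := (Submodule.mem_span_image_finset_iff_exists_fun ℝ).1 h
  refine ⟨fun i => if hi : i ∈ A then c ⟨i, hi⟩ else 0, ?_⟩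
  rw [← hc, ← Finset.sum_coe_sort A]
  exact Finset.sum_congr rfl fun i _ => by simp

lemma inner_sub_of_decomp {A : Finset ι} {ψ : EuclideanSpace ℝ (Fin d)} {c : ι → ℝ}
    (hc : ψ = ∑ h ∈ A, c h • (y h).1) (x v : EuclideanSpace ℝ (Fin d)) :
    ⟪ψ, x⟫ - ⟪ψ, v⟫ = ∑ h ∈ A, c h * (ev (y h) x - ev (y h) v) := by
  rw [← inner_sub_right, hc, sum_inner]
  refine Finset.sum_congr rfl fun h _ => ?_
  rw [ev_sub, real_inner_smul_left]

lemma GP.coeff_ne_zero [Fintype ι] (hy : GP y φ) {A : Finset ι} (hA : A.card = d) {c : ι → ℝ}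
    (hc : φ = ∑ h ∈ A, c h • (y h).1) {h : ι} (hh : h ∈ A) : c h ≠ 0 := by
  intro h0
  refine hy.generic (A.erase h) ?_ ?_
  · rw [Finset.card_erase_of_mem hh, hA]
    have := Finset.card_pos.2 ⟨h, hh⟩
    omega
  · rw [hc, ← Finset.add_sum_erase _ _ hh, h0, zero_smul, zero_add]
    exact Submodule.sum_mem _ fun i hi =>
      Submodule.smul_mem _ _ (Submodule.subset_span ⟨i, hi, rfl⟩)

lemma GP.eq_of_ev_eq [Fintype ι] (hy : GP y φ) {A : Finset ι} (hA : A.card = d)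
    {x x' : EuclideanSpace ℝ (Fin d)} (h : ∀ i ∈ A, ev (y i) x = ev (y i) x') : x = x' := by
  obtain ⟨c, hc⟩ := hy.decomp hA (x - x')
  have h1 := inner_sub_of_decomp hc x x'
  rw [Finset.sum_eq_zero fun i hi => by rw [h i hi, sub_self, mul_zero], ← inner_sub_right] at h1
  exact sub_eq_zero.1 (inner_self_eq_zero.1 h1)

lemma GP.exists_ev_eq [Fintype ι] (hy : GP y φ) {A : Finset ι} (hA : A.card = d) (t : ι → ℝ) :
    ∃ x, ∀ h ∈ A, ev (y h) x = t h := by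
  let L : EuclideanSpace ℝ (Fin d) →ₗ[ℝ] (A → ℝ) :=
    LinearMap.pi fun h : A => (innerₛₗ ℝ (y h).1)
  have hinj : Function.Injective L := by
    intro x x' hx
    refine hy.eq_of_ev_eq hA fun i hi => ?_
    have := congrFun hx ⟨i, hi⟩
    simp only [L, LinearMap.pi_apply, innerₛₗ_apply_apply] at this
    simp [ev, this]
  have hsurj : Function.Surjective L :=
    (LinearMap.injective_iff_surjective_of_finrank_eq_finrank (by simp [hA])).1 hinj
  obtain ⟨x, hx⟩ := hsurj fun h => t h - (y h).2
  refine ⟨x, fun h hh => ?_⟩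
  have := congrFun hx ⟨h, hh⟩
  simp only [L, LinearMap.pi_apply, innerₛₗ_apply_apply] at this
  simp [ev, this]

lemma GP.exists_dir [Fintype ι] (hy : GP y φ) {J : Finset ι} (hJ : J.card < d) :
    ∃ u, (∀ h ∈ J, ⟪(y h).1, u⟫ = 0) ∧ ⟪φ, u⟫ < 0 := by
  set W := Submodule.span ℝ ((fun h => (y h).1) '' (J : Set ι)) with hW
  have hφ := hy.generic J hJ
  set p : EuclideanSpace ℝ (Fin d) := W.starProjection φ with hp
  have hmem : φ - p ∈ Wᗮ := W.sub_starProjection_mem_orthogonal φ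
  have hpW : p ∈ W := W.starProjection_apply_mem φ
  have hne : φ - p ≠ 0 := fun h => hφ (by rw [sub_eq_zero.1 h]; exact hpW)
  refine ⟨-(φ - p), fun h hh => ?_, ?_⟩
  · rw [inner_neg_right, (Submodule.mem_orthogonal _ _).1 hmem _
      (Submodule.subset_span ⟨h, hh, rfl⟩), neg_zero]
  · have h1 : ⟪p, φ - p⟫ = 0 := (Submodule.mem_orthogonal _ _).1 hmem _ hpW
    have h2 : ⟪φ, φ - p⟫ = ⟪φ - p, φ - p⟫ := by
      rw [inner_sub_left (φ) p (φ - p), h1, sub_zero]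
    rw [inner_neg_right, h2, neg_lt_zero]
    exact real_inner_self_pos.2 hne

lemma GP.eq_on_line [Fintype ι] (hy : GP y φ) {J : Finset ι} (hJ : J.card + 1 = d)
    {x x' : EuclideanSpace ℝ (Fin d)} (h : ∀ i ∈ J, ev (y i) x = ev (y i) x')
    (hφ : ⟪φ, x⟫ = ⟪φ, x'⟫) : x = x' := by
  by_contra hne
  have hw : x - x' ≠ 0 := sub_ne_zero.2 hne
  set W := Submodule.span ℝ ((fun h => (y h).1) '' (J : Set ι)) with hW
  have hfr : Module.finrank ℝ W = J.card := by
    have := finrank_span_eq_card (hy.indep J (by omega))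
    rw [Fintype.card_coe] at this
    have h2 : (fun h => (y h).1) '' (J : Set ι) = Set.range fun h : J => (y (h : ι)).1 := by
      ext z; simp
    rw [hW, h2, this]
  have hw' : x - x' ∈ Wᗮ := by
    rw [Submodule.mem_orthogonal]
    intro z hz
    induction hz using Submodule.span_induction with
    | mem z hz =>
      obtain ⟨i, hi, rfl⟩ := hz
      rw [← ev_sub, h i hi, sub_self]
    | zero => simp
    | add a b _ _ ha hb => rw [inner_add_left, ha, hb, add_zero]
    | smul a b _ hb => rw [real_inner_smul_left, hb, mul_zero]
  obtain ⟨u, hu, hu'⟩ := hy.exists_dir (J := J) (by omega)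
  have hu'' : u ∈ Wᗮ := by
    rw [Submodule.mem_orthogonal]
    intro z hz
    induction hz using Submodule.span_induction with
    | mem z hz =>
      obtain ⟨i, hi, rfl⟩ := hz
      exact hu i hi
    | zero => simp
    | add a b _ _ ha hb => rw [inner_add_left, ha, hb, add_zero]
    | smul a b _ hb => rw [real_inner_smul_left, hb, mul_zero]
  have h1 : Module.finrank ℝ Wᗮ = 1 := by
    have := W.finrank_add_finrank_orthogonal
    rw [finrank_euclideanSpace_fin] at this
    omega
  obtain ⟨c, hc⟩ := (finrank_eq_one_iff_of_nonzero' (⟨x - x', hw'⟩ : Wᗮ)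
    (fun h => hw (congrArg Subtype.val h))).1 h1 ⟨u, hu''⟩
  have hc' : c • (x - x') = u := congrArg Subtype.val hc
  rw [← hc', real_inner_smul_right, inner_sub_right, hφ, sub_self, mul_zero] at hu'
  exact lt_irrefl _ hu'

/-- Strict inequalities at `x` persist along a short segment. -/
lemma eventually_pos (q x w : EuclideanSpace ℝ (Fin d)) (y : ι → EuclideanSpace ℝ (Fin d) × ℝ)
    (R : Finset ι) : ∀ᶠ t in nhdsWithin (0 : ℝ) (Set.Ioi 0), ∀ h ∈ R,
      0 < ev (y h) q * ev (y h) x → 0 < ev (y h) q * ev (y h) (x + t • w) := by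
  rw [Filter.eventually_all_finset]
  intro h _
  by_cases h0 : 0 < ev (y h) q * ev (y h) x
  · have hc : Continuous fun t : ℝ => ev (y h) q * ev (y h) (x + t • w) :=
      continuous_const.mul ((continuous_ev _).comp (by fun_prop))
    have h2 : ∀ᶠ t in nhds (0 : ℝ), 0 < ev (y h) q * ev (y h) (x + t • w) :=
      (hc.tendsto 0).eventually_const_lt (by simpa using h0)
    exact (h2.filter_mono nhdsWithin_le_nhds).mono fun t ht _ => ht
  · exact Filter.Eventually.of_forall fun t h1 => absurd h1 h0

end Basic

/-- The face cut out by `I` of the closed cell of the point `q` in the arrangement `R`. -/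
def poly {d : ℕ} {ι : Type*} (y : ι → EuclideanSpace ℝ (Fin d) × ℝ) (R : Finset ι)
    (q : EuclideanSpace ℝ (Fin d)) (I : Finset ι) : Set (EuclideanSpace ℝ (Fin d)) :=
  {x | (∀ h ∈ R, 0 ≤ ev (y h) q * ev (y h) x) ∧ ∀ h ∈ I, ev (y h) x = 0}

/-- The members of `R` vanishing at `x`. -/
def act {d : ℕ} {ι : Type*} (y : ι → EuclideanSpace ℝ (Fin d) × ℝ) (R : Finset ι)
    (x : EuclideanSpace ℝ (Fin d)) : Finset ι :=
  R.filter fun h => ev (y h) x = 0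

/-- `b` is a lowest point, in direction `φ`, of the face `poly y R q I`. -/
def IsBot {d : ℕ} {ι : Type*} (y : ι → EuclideanSpace ℝ (Fin d) × ℝ)
    (φ : EuclideanSpace ℝ (Fin d)) (R : Finset ι)
    (q : EuclideanSpace ℝ (Fin d)) (I : Finset ι) (b : EuclideanSpace ℝ (Fin d)) : Prop :=
  b ∈ poly y R q I ∧ ∀ x ∈ poly y R q I, ⟪φ, b⟫ ≤ ⟪φ, x⟫

section Faces

variable {d : ℕ} {ι : Type*} {y : ι → EuclideanSpace ℝ (Fin d) × ℝ}
  {φ : EuclideanSpace ℝ (Fin d)} {B R I : Finset ι} {q b b' : EuclideanSpace ℝ (Fin d)}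

lemma mem_act {x : EuclideanSpace ℝ (Fin d)} {h : ι} :
    h ∈ act y R x ↔ h ∈ R ∧ ev (y h) x = 0 := by simp [act]

lemma convex_poly : Convex ℝ (poly y R q I) := by
  intro x hx z hz s t hs ht hst
  refine ⟨fun h hh => ?_, fun h hh => ?_⟩
  · rw [ev_combo _ _ _ hst]
    have := mul_nonneg hs (hx.1 h hh)
    have := mul_nonneg ht (hz.1 h hh)
    nlinarith
  · rw [ev_combo _ _ _ hst, hx.2 h hh, hz.2 h hh]; simp

lemma isClosed_poly : IsClosed (poly y R q I) := by
  have : poly y R q I = (⋂ h ∈ R, {x | 0 ≤ ev (y h) q * ev (y h) x}) ∩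
      ⋂ h ∈ I, {x | ev (y h) x = 0} := by
    ext x; simp [poly]
  rw [this]
  refine IsClosed.inter ?_ ?_
  · exact isClosed_biInter fun h _ => isClosed_le continuous_const
      (continuous_const.mul (continuous_ev _))
  · exact isClosed_biInter fun h _ => isClosed_eq (continuous_ev _) continuous_const

lemma isBounded_poly (hB : Bornology.IsBounded {x | ∀ h ∈ B, 0 ≤ ev (y h) x}) (hBR : B ⊆ R)
    (hq : ∀ h ∈ B, 0 < ev (y h) q) : Bornology.IsBounded (poly y R q I) := by
  refine hB.subset fun x hx h hh => ?_
  exact nonneg_of_mul_nonneg_right (hx.1 h (hBR hh)) (hq h hh)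

lemma exists_isBot (hbd : Bornology.IsBounded (poly y R q I)) (hne : (poly y R q I).Nonempty) :
    ∃ b, IsBot y φ R q I b := by
  have hc : IsCompact (poly y R q I) :=
    Metric.isCompact_of_isClosed_isBounded isClosed_poly hbd
  obtain ⟨b, hb, hb'⟩ := hc.exists_isMinOn hne
    (f := fun x => ⟪φ, x⟫) (by fun_prop)
  exact ⟨b, hb, fun x hx => hb' hx⟩

lemma poly_mono {R' I' : Finset ι} (hR : R ⊆ R') (hI : I ⊆ I') :
    poly y R' q I' ⊆ poly y R q I :=
  fun _ hx => ⟨fun h hh => hx.1 h (hR hh), fun h hh => hx.2 h (hI hh)⟩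

lemma IsBot.card_act [Fintype ι] (hy : GP y φ) (hIR : I ⊆ R) (hb : IsBot y φ R q I b) :
    (act y R b).card = d := by
  refine le_antisymm (hy.card_le fun i hi => (mem_act.1 hi).2) ?_
  by_contra! hlt
  obtain ⟨u, hu, hu'⟩ := hy.exists_dir hlt
  obtain ⟨t, ht, ht0⟩ := ((eventually_pos q b u y R).and self_mem_nhdsWithin).exists
  have ht0 : 0 < t := ht0
  have hx : b + t • u ∈ poly y R q I := by
    refine ⟨fun h hh => ?_, fun h hh => ?_⟩
    · by_cases hz : ev (y h) b = 0
      · rw [ev_add_smul, hz, hu h (mem_act.2 ⟨hh, hz⟩)]; simp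
      · by_cases hq : ev (y h) q = 0
        · simp [hq]
        · exact (ht h hh (lt_of_le_of_ne (hb.1.1 h hh) (mul_ne_zero hq hz).symm)).le
    · have hz := hb.1.2 h hh
      rw [ev_add_smul, hz, hu h (mem_act.2 ⟨hIR hh, hz⟩)]; simp
  have := hb.2 _ hx
  rw [inner_add_right, real_inner_smul_right] at this
  nlinarith

lemma IsBot.unique [Fintype ι] (hy : GP y φ) (hIR : I ⊆ R) (hq : ∀ h ∈ R, ev (y h) q ≠ 0)
    (hb : IsBot y φ R q I b) (hb' : IsBot y φ R q I b') : b = b' := by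
  have h12 : (1 / 2 : ℝ) + 1 / 2 = 1 := by norm_num
  have hm : IsBot y φ R q I ((1 / 2 : ℝ) • b + (1 / 2 : ℝ) • b') := by
    refine ⟨convex_poly hb.1 hb'.1 (by norm_num) (by norm_num) h12, fun x hx => ?_⟩
    rw [inner_add_right, real_inner_smul_right, real_inner_smul_right]
    have := hb.2 x hx
    have := hb'.2 x hx
    linarith
  have hA : (act y R ((1 / 2 : ℝ) • b + (1 / 2 : ℝ) • b')).card = d := hm.card_act hy hIR
  refine hy.eq_of_ev_eq hA fun h hh => ?_
  obtain ⟨hR, h0⟩ := mem_act.1 hh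
  rw [ev_combo _ _ _ h12] at h0
  have h1 := hb.1.1 h hR
  have h2 := hb'.1.1 h hR
  have h3 : ev (y h) q * ev (y h) b = 0 := by
    have : ev (y h) q * ev (y h) b + ev (y h) q * ev (y h) b' = 0 := by
      linear_combination 2 * ev (y h) q * h0
    linarith
  have h4 := (mul_eq_zero.1 h3).resolve_left (hq h hR)
  rw [h4] at h0 ⊢
  linarith

lemma IsBot.of_insert {g : ι} (hb : IsBot y φ (insert g R) q I b) (hg : ev (y g) b ≠ 0) :
    IsBot y φ R q I b := by
  refine ⟨poly_mono (Finset.subset_insert _ _) subset_rfl hb.1, fun x hx => ?_⟩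
  by_contra! hlt
  have hbR := poly_mono (Finset.subset_insert g R) (subset_refl I) hb.1
  have hev := eventually_pos q b (x - b) y {g}
  have hev2 : ∀ᶠ t in nhdsWithin (0 : ℝ) (Set.Ioi 0), t < 1 :=
    (gt_mem_nhds one_pos).filter_mono nhdsWithin_le_nhds
  obtain ⟨t, ⟨ht, ht1⟩, ht0⟩ := ((hev.and hev2).and self_mem_nhdsWithin).exists
  have ht0 : 0 < t := ht0
  have hz : b + t • (x - b) = (1 - t) • b + t • x := by
    rw [smul_sub, sub_smul, one_smul]; abel
  have hz' : b + t • (x - b) ∈ poly y R q I := by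
    rw [hz]; exact convex_poly hbR hx (by linarith) ht0.le (by ring)
  have hmem : b + t • (x - b) ∈ poly y (insert g R) q I := by
    refine ⟨fun h hh => ?_, hz'.2⟩
    rcases Finset.mem_insert.1 hh with rfl | hh
    · by_cases hq : ev (y h) q = 0
      · simp [hq]
      · exact (ht h (by simp) (lt_of_le_of_ne (hb.1.1 h (by simp)) (mul_ne_zero hq hg).symm)).le
    · exact hz'.1 h hh
  have := hb.2 _ hmem
  rw [inner_add_right, real_inner_smul_right, inner_sub_right] at this
  nlinarith

end Faces

/-- The members of `R` positive at `q`. -/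
def sg {d : ℕ} {ι : Type*} (y : ι → EuclideanSpace ℝ (Fin d) × ℝ) (R : Finset ι)
    (q : EuclideanSpace ℝ (Fin d)) : Finset ι :=
  R.filter fun h => 0 < ev (y h) q

/-- The cells of the arrangement `R` containing a point of `X`, as sign vectors. -/
def cells {d : ℕ} {ι : Type*} (y : ι → EuclideanSpace ℝ (Fin d) × ℝ) (R : Finset ι)
    (X : Finset (EuclideanSpace ℝ (Fin d))) : Finset (Finset ι) :=
  X.image (sg y R)

section Cells

variable {d : ℕ} {ι : Type*} {y : ι → EuclideanSpace ℝ (Fin d) × ℝ}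
  {φ : EuclideanSpace ℝ (Fin d)} {B R I : Finset ι} {q : EuclideanSpace ℝ (Fin d)}

lemma mem_sg {h : ι} : h ∈ sg y R q ↔ h ∈ R ∧ 0 < ev (y h) q := by simp [sg]

lemma GP.neg [Fintype ι] (hy : GP y φ) : GP y (-φ) :=
  ⟨hy.indep, hy.card_zero, fun J hJ h => hy.generic J hJ (by simpa using Submodule.neg_mem _ h)⟩

/-- A ray leaving a bounded cell through a point of it has a last point in the cell. -/
lemma ray_exit (hbd : Bornology.IsBounded (poly y R q ∅))
    {v u : EuclideanSpace ℝ (Fin d)} (hv : v ∈ poly y R q ∅) (hu : u ≠ 0) :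
    ∃ t : ℝ, 0 ≤ t ∧ v + t • u ∈ poly y R q ∅ ∧
      (∃ g ∈ R, ev (y g) q * ⟪(y g).1, u⟫ < 0 ∧ ev (y g) (v + t • u) = 0) ∧
      ∀ s, s < t → ∀ h ∈ R, ev (y h) q * ⟪(y h).1, u⟫ < 0 →
        0 < ev (y h) q * ev (y h) (v + s • u) := by
  set N := R.filter fun h => ev (y h) q * ⟪(y h).1, u⟫ < 0 with hN
  have hne : N.Nonempty := by
    by_contra hemp
    rw [Finset.not_nonempty_iff_eq_empty, Finset.filter_eq_empty_iff] at hemp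
    have hray : ∀ t : ℝ, 0 ≤ t → v + t • u ∈ poly y R q ∅ := fun t ht =>
      ⟨fun h hh => by
        rw [ev_add_smul]
        have h1 := hv.1 h hh
        have h2 := mul_nonneg ht (not_lt.1 (hemp hh))
        nlinarith, by simp⟩
    obtain ⟨C, hC⟩ := hbd.exists_norm_le
    have hu' : 0 < ‖u‖ := norm_pos_iff.2 hu
    have hC0 : 0 ≤ C := (norm_nonneg v).trans (hC v hv)
    have h1 := hC _ (hray ((2 * C + 1) / ‖u‖) (by positivity))
    have h2 : ‖((2 * C + 1) / ‖u‖) • u‖ = 2 * C + 1 := by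
      rw [norm_smul, Real.norm_of_nonneg (by positivity)]; field_simp
    have h3 : ‖((2 * C + 1) / ‖u‖) • u‖ ≤ ‖v + ((2 * C + 1) / ‖u‖) • u‖ + ‖v‖ := by
      simpa using norm_sub_le (v + ((2 * C + 1) / ‖u‖) • u) v
    have h4 := hC v hv
    linarith
  obtain ⟨g, hg, hmin⟩ := N.exists_min_image (fun h => ev (y h) v / (-⟪(y h).1, u⟫)) hne
  obtain ⟨hgR, hgu⟩ := Finset.mem_filter.1 hg
  have key : ∀ h ∈ R, ev (y h) q * ⟪(y h).1, u⟫ < 0 → ∀ s,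
      ev (y h) q * ev (y h) (v + s • u) =
        (ev (y h) q * -⟪(y h).1, u⟫) * (ev (y h) v / (-⟪(y h).1, u⟫) - s) := by
    intro h _ hneg s
    have hne : ⟪(y h).1, u⟫ ≠ 0 := fun h0 => by rw [h0, mul_zero] at hneg; exact lt_irrefl _ hneg
    rw [ev_add_smul]
    field_simp
    ring
  have ht0 : 0 ≤ ev (y g) v / (-⟪(y g).1, u⟫) := by
    have h1 := hv.1 g hgR
    rw [div_eq_mul_inv, ← mul_inv_cancel_right₀ (show ev (y g) q ≠ 0 by
      rintro h0; rw [h0, zero_mul] at hgu; exact lt_irrefl _ hgu) (ev (y g) v), mul_assoc,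
      ← mul_inv]
    exact mul_nonneg (by linarith) (inv_nonneg.2 (by linarith))
  refine ⟨ev (y g) v / (-⟪(y g).1, u⟫), ht0, ⟨fun h hh => ?_, by simp⟩, ⟨g, hgR, hgu, ?_⟩, ?_⟩
  · by_cases hneg : ev (y h) q * ⟪(y h).1, u⟫ < 0
    · rw [key h hh hneg]
      have := hmin h (Finset.mem_filter.2 ⟨hh, hneg⟩)
      exact mul_nonneg (by linarith) (by linarith)
    · rw [ev_add_smul]
      have h1 := hv.1 h hh
      have h3 := mul_nonneg ht0 (not_lt.1 hneg)
      nlinarith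
  · rw [ev_add_smul]
    have : ⟪(y g).1, u⟫ ≠ 0 := fun h0 => by rw [h0, mul_zero] at hgu; exact lt_irrefl _ hgu
    field_simp
    ring
  · intro s hs h hh hneg
    rw [key h hh hneg]
    have := hmin h (Finset.mem_filter.2 ⟨hh, hneg⟩)
    exact mul_pos (by linarith) (by linarith)

/-- `K` meets the flat of `I` only inside the open face with sign vector `σ`. -/
def FaceRel (y : ι → EuclideanSpace ℝ (Fin d) × ℝ) (K : Set (EuclideanSpace ℝ (Fin d)))
    (R σ I T : Finset ι) : Prop :=
  T = σ ∩ I ∧ ∃ x ∈ K, (∀ h ∈ I, ev (y h) x = 0) ∧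
    ∀ h ∈ R \ I, ev (y h) x ≠ 0 ∧ (0 < ev (y h) x ↔ h ∈ σ) ∧
      ∀ z ∈ K, (∀ h ∈ I, ev (y h) z = 0) → (0 < ev (y h) z ↔ h ∈ σ)

/-- On the line of `J`, the cell `σ` has an edge leaving `K` in increasing direction `φ`. -/
def EdgeRel (y : ι → EuclideanSpace ℝ (Fin d) × ℝ) (φ : EuclideanSpace ℝ (Fin d))
    (K : Set (EuclideanSpace ℝ (Fin d)))
    (R σ J T : Finset ι) : Prop :=
  T = σ ∩ J ∧ J.card + 1 = d ∧ ∃ v ∈ K, ∃ w ∉ K, (∀ h ∈ J, ev (y h) v = 0) ∧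
    (∀ h ∈ J, ev (y h) w = 0) ∧ ⟪φ, v⟫ < ⟪φ, w⟫ ∧
    ∀ h ∈ R \ J, ∀ t : ℝ, 0 < t → t < 1 → (0 < ev (y h) (v + t • (w - v)) ↔ h ∈ σ)

lemma eq_of_inter_eq {σ σ' I T : Finset ι} (hσ : σ ⊆ R) (hσ' : σ' ⊆ R) (h : T = σ ∩ I)
    (h' : T = σ' ∩ I) (hR : ∀ g ∈ R \ I, (g ∈ σ ↔ g ∈ σ')) : σ = σ' := by
  ext g
  by_cases hI : g ∈ I
  · have : g ∈ σ ∩ I ↔ g ∈ σ' ∩ I := by rw [← h, ← h']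
    simpa [hI] using this
  · by_cases hg : g ∈ R
    · exact hR g (Finset.mem_sdiff.2 ⟨hg, hI⟩)
    · exact ⟨fun h => absurd (hσ h) hg, fun h => absurd (hσ' h) hg⟩

lemma FaceRel.eq {K : Set (EuclideanSpace ℝ (Fin d))} {σ σ' I T : Finset ι} (hσ : σ ⊆ R)
    (hσ' : σ' ⊆ R) (h : FaceRel y K R σ I T) (h' : FaceRel y K R σ' I T) : σ = σ' := by
  obtain ⟨hT, x, hx, hx0, hxs⟩ := h
  obtain ⟨hT', x', hx', hx0', hxs'⟩ := h'
  refine eq_of_inter_eq hσ hσ' hT hT' fun g hg => ?_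
  rw [← (hxs g hg).2.1, ← (hxs' g hg).2.2 x hx hx0]

lemma EdgeRel.eq [Fintype ι] (hy : GP y φ) {K : Set (EuclideanSpace ℝ (Fin d))}
    (hK : Convex ℝ K) {σ σ' J T : Finset ι} (hσ : σ ⊆ R)
    (hσ' : σ' ⊆ R) (h : EdgeRel y φ K R σ J T) (h' : EdgeRel y φ K R σ' J T) : σ = σ' := by
  obtain ⟨hT, hJ, v, hv, w, hw, hv0, hw0, hvw, hs⟩ := h
  obtain ⟨hT', -, v', hv', w', hw', hv0', hw0', hvw', hs'⟩ := h'
  have hlin : ∀ {v w : EuclideanSpace ℝ (Fin d)}, (∀ h ∈ J, ev (y h) v = 0) →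
      (∀ h ∈ J, ev (y h) w = 0) → ∀ t : ℝ, ∀ h ∈ J, ev (y h) (v + t • (w - v)) = 0 := by
    intro v w hv hw t h hh
    rw [ev_add_smul, ← ev_sub, hv h hh, hw h hh]; simp
  have hval : ∀ (v w : EuclideanSpace ℝ (Fin d)) (t : ℝ),
      ⟪φ, v + t • (w - v)⟫ = ⟪φ, v⟫ + t * (⟪φ, w⟫ - ⟪φ, v⟫) := by
    intro v w t
    rw [inner_add_right, real_inner_smul_right, inner_sub_right]
  have hord : ∀ {v w v' : EuclideanSpace ℝ (Fin d)}, v ∈ K → w ∉ K → v' ∈ K →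
      (∀ h ∈ J, ev (y h) v = 0) → (∀ h ∈ J, ev (y h) w = 0) → (∀ h ∈ J, ev (y h) v' = 0) →
      ⟪φ, v⟫ < ⟪φ, w⟫ → ⟪φ, v'⟫ < ⟪φ, w⟫ := by
    intro v w v' hv hw hv' hv0 hw0 hv0' hvw
    by_contra! hle
    have hpos : 0 < ⟪φ, v'⟫ - ⟪φ, v⟫ := by linarith
    set t := (⟪φ, w⟫ - ⟪φ, v⟫) / (⟪φ, v'⟫ - ⟪φ, v⟫) with ht
    have ht0 : 0 ≤ t := div_nonneg (by linarith) hpos.le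
    have ht1 : t ≤ 1 := (div_le_one hpos).2 (by linarith)
    have hmem : v + t • (v' - v) ∈ K := hK.add_smul_sub_mem hv hv' ⟨ht0, ht1⟩
    have : v + t • (v' - v) = w := by
      refine hy.eq_on_line hJ (fun i hi => by rw [hlin hv0 hv0' t i hi, hw0 i hi]) ?_
      rw [hval, ht, div_mul_cancel₀ _ hpos.ne']; ring
    exact hw (this ▸ hmem)
  have h1 := hord hv hw hv' hv0 hw0 hv0' hvw
  have h2 := hord hv' hw' hv hv0' hw0' hv0 hvw'
  obtain ⟨c, hc1, hc2⟩ := exists_between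
    (show max ⟪φ, v⟫ ⟪φ, v'⟫ < min ⟪φ, w⟫ ⟪φ, w'⟫ by
      rw [max_lt_iff, lt_min_iff, lt_min_iff]; exact ⟨⟨hvw, h2⟩, h1, hvw'⟩)
  rw [max_lt_iff] at hc1
  rw [lt_min_iff] at hc2
  have hp : 0 < ⟪φ, w⟫ - ⟪φ, v⟫ := by linarith
  have hp' : 0 < ⟪φ, w'⟫ - ⟪φ, v'⟫ := by linarith
  have heq : v + ((c - ⟪φ, v⟫) / (⟪φ, w⟫ - ⟪φ, v⟫)) • (w - v) =
      v' + ((c - ⟪φ, v'⟫) / (⟪φ, w'⟫ - ⟪φ, v'⟫)) • (w' - v') := by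
    refine hy.eq_on_line hJ (fun i hi => by rw [hlin hv0 hw0 _ i hi, hlin hv0' hw0' _ i hi]) ?_
    rw [hval, hval, div_mul_cancel₀ _ hp.ne', div_mul_cancel₀ _ hp'.ne']; ring
  refine eq_of_inter_eq hσ hσ' hT hT' fun g hg => ?_
  rw [← hs g hg ((c - ⟪φ, v⟫) / (⟪φ, w⟫ - ⟪φ, v⟫)) (div_pos (by linarith) hp)
      ((div_lt_one hp).2 (by linarith)), heq,
    hs' g hg _ (div_pos (by linarith) hp') ((div_lt_one hp').2 (by linarith))]

lemma pos_iff_of_mul_pos {a b : ℝ} (h : 0 < a * b) : 0 < b ↔ 0 < a := by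
  rcases mul_pos_iff.1 h with ⟨ha, hb⟩ | ⟨ha, hb⟩
  · exact ⟨fun _ => ha, fun _ => hb⟩
  · exact ⟨fun h => absurd h (not_lt.2 hb.le), fun h => absurd h (not_lt.2 ha.le)⟩

lemma exists_edgeRel [Fintype ι] (hy : GP y φ) {K : Set (EuclideanSpace ℝ (Fin d))}
    (hK : Convex ℝ K) (hKc : IsCompact K) (hbd : Bornology.IsBounded (poly y R q ∅))
    (hq : ∀ h ∈ R, ev (y h) q ≠ 0) (hqi : q ∉ interior K)
    (hv : ∃ v ∈ K, v ∈ poly y R q ∅ ∧ (act y R v).card = d) :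
    ∃ J T, J ⊆ R ∧ T ⊆ J ∧ J.card ≤ d - 1 ∧
      (EdgeRel y φ K R (sg y R q) J T ∨ EdgeRel y (-φ) K R (sg y R q) J T) := by
  obtain ⟨y0, hy0, hy0K⟩ : ∃ y0, (∀ h ∈ R, 0 < ev (y h) q * ev (y h) y0) ∧ y0 ∉ K := by
    by_contra! hcon
    refine hqi ?_
    rw [mem_interior_iff_mem_nhds]
    have : ∀ᶠ z in nhds q, ∀ h ∈ R, 0 < ev (y h) q * ev (y h) z := by
      rw [Filter.eventually_all_finset]
      intro h hh
      exact (((continuous_ev (y h)).tendsto q).const_mul (ev (y h) q)).eventually_const_lt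
        (mul_self_pos.2 (hq h hh))
    exact this.mono fun z hz => hcon z hz
  obtain ⟨f, u, hfK, hfy⟩ := geometric_hahn_banach_closed_point hK hKc.isClosed hy0K
  set ψ := (InnerProductSpace.toDual ℝ (EuclideanSpace ℝ (Fin d))).symm f with hψ
  have hψf : ∀ x, ⟪ψ, x⟫ = f x := fun x => by
    rw [hψ, InnerProductSpace.toDual_symm_apply]
  set S : Set (EuclideanSpace ℝ (Fin d)) :=
    {v | v ∈ K ∧ v ∈ poly y R q ∅ ∧ (act y R v).card = d} with hS
  have hfin : S.Finite := by
    refine Set.Finite.of_injOn (f := act y R) (t := Set.univ) (fun _ _ => trivial) ?_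
      Set.finite_univ
    intro a ha b hb hab
    refine hy.eq_of_ev_eq ha.2.2 fun i hi => ?_
    rw [(mem_act.1 hi).2, (mem_act.1 (hab ▸ hi : i ∈ act y R b)).2]
  obtain ⟨v, ⟨hvK, hvp, hvA⟩, hmax⟩ := Set.exists_max_image S (fun x => ⟪ψ, x⟫) hfin hv
  obtain ⟨c, hc⟩ := hy.decomp hvA ψ
  have hsum := inner_sub_of_decomp hc y0 v
  have hlt : 0 < ⟪ψ, y0⟫ - ⟪ψ, v⟫ := by
    rw [hψf, hψf]; have := hfK v hvK; linarith
  rw [hsum] at hlt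
  obtain ⟨h, hh, hpos⟩ := Finset.exists_lt_of_sum_lt (s := act y R v) (f := fun _ => (0 : ℝ))
    (by simpa using hlt)
  obtain ⟨hhR, hhv⟩ := mem_act.1 hh
  simp only [hhv, sub_zero] at hpos
  obtain ⟨x1, hx1⟩ := hy.exists_ev_eq hvA fun i => if i = h then ev (y h) y0 else 0
  set w := x1 - v with hw
  have hwh : ⟪(y h).1, w⟫ = ev (y h) y0 := by
    rw [hw, ← ev_sub, hx1 h hh, hhv]; simp
  have hwi : ∀ i ∈ (act y R v).erase h, ⟪(y i).1, w⟫ = 0 := by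
    intro i hi
    rw [Finset.mem_erase] at hi
    rw [hw, ← ev_sub, hx1 i hi.2, (mem_act.1 hi.2).2, if_neg hi.1, sub_zero]
  have hψw : ⟪ψ, w⟫ = c h * ev (y h) y0 := by
    rw [hc, sum_inner, ← Finset.add_sum_erase _ _ hh, real_inner_smul_left, hwh,
      Finset.sum_eq_zero, add_zero]
    intro i hi
    rw [real_inner_smul_left, hwi i hi, mul_zero]
  have hw0 : w ≠ 0 := by
    intro h0
    rw [h0, inner_zero_right] at hψw
    rw [← hψw] at hpos
    exact lt_irrefl _ hpos
  obtain ⟨t, ht0, htp, ⟨g, hgR, hgneg, hg0⟩, hstrict⟩ := ray_exit hbd hvp hw0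
  have hgA : g ∉ act y R v := by
    intro hg
    by_cases hgh : g = h
    · subst hgh
      rw [hwh] at hgneg
      exact absurd hgneg (not_lt.2 (hy0 g hgR).le)
    · rw [hwi g (Finset.mem_erase.2 ⟨hgh, hg⟩), mul_zero] at hgneg
      exact lt_irrefl _ hgneg
  have htpos : 0 < t := by
    refine lt_of_le_of_ne ht0 fun h0 => hgA (mem_act.2 ⟨hgR, ?_⟩)
    rw [← h0] at hg0; simpa using hg0
  set J := (act y R v).erase h with hJdef
  have hJR : J ⊆ R := (Finset.erase_subset _ _).trans (Finset.filter_subset _ _)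
  have hd : 0 < d := hvA ▸ Finset.card_pos.2 ⟨h, hh⟩
  have hJc : J.card + 1 = d := by
    rw [hJdef, Finset.card_erase_of_mem hh, hvA]; omega
  have hJv : ∀ i ∈ J, ev (y i) v = 0 := fun i hi => (mem_act.1 (Finset.mem_of_mem_erase hi)).2
  have hJw : ∀ i ∈ J, ev (y i) (v + t • w) = 0 := fun i hi => by
    rw [ev_add_smul, hwi i hi, hJv i hi]; simp
  have hnotK : v + t • w ∉ K := by
    intro hK'
    have hcard : (act y R (v + t • w)).card = d := by
      refine le_antisymm (hy.card_le fun i hi => (mem_act.1 hi).2) ?_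
      have hgJ : g ∉ J := fun hg => hgA (Finset.mem_of_mem_erase hg)
      refine hJc.symm.le.trans ?_
      rw [← Finset.card_insert_of_notMem hgJ]
      refine Finset.card_le_card fun i hi => ?_
      rcases Finset.mem_insert.1 hi with rfl | hi
      · exact mem_act.2 ⟨hgR, hg0⟩
      · exact mem_act.2 ⟨hJR hi, hJw i hi⟩
    have := hmax _ ⟨hK', htp, hcard⟩
    simp only [inner_add_right, real_inner_smul_right, hψw] at this
    have := mul_pos htpos hpos
    linarith
  have hedge : ∀ i ∈ R \ J, ∀ s : ℝ, 0 < s → s < 1 →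
      (0 < ev (y i) (v + s • (v + t • w - v)) ↔ i ∈ sg y R q) := by
    intro i hi s hs0 hs1
    rw [Finset.mem_sdiff] at hi
    have heq : v + s • (v + t • w - v) = v + (s * t) • w := by
      rw [add_sub_cancel_left, smul_smul]
    have hpos : 0 < ev (y i) q * ev (y i) (v + (s * t) • w) := by
      by_cases hneg : ev (y i) q * ⟪(y i).1, w⟫ < 0
      · exact hstrict _ (by nlinarith) i hi.1 hneg
      · rw [ev_add_smul]
        have hst := mul_pos hs0 htpos
        by_cases hih : i = h
        · subst hih
          rw [hhv, hwh, zero_add]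
          have := mul_pos hst (hy0 i hi.1)
          nlinarith
        · have hiv : ev (y i) v ≠ 0 := fun h0 => hi.2 (Finset.mem_erase.2
            ⟨hih, mem_act.2 ⟨hi.1, h0⟩⟩)
          have h1 := lt_of_le_of_ne (hvp.1 i hi.1) (mul_ne_zero (hq i hi.1) hiv).symm
          have h2 := mul_nonneg hst.le (not_lt.1 hneg)
          nlinarith
    rw [heq, pos_iff_of_mul_pos hpos, mem_sg]
    exact ⟨fun h => ⟨hi.1, h⟩, fun h => h.2⟩
  have hφ : ⟪φ, v⟫ ≠ ⟪φ, v + t • w⟫ := by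
    intro h0
    have h1 := hy.eq_on_line hJc (fun i hi => by rw [hJv i hi, hJw i hi]) h0
    exact hnotK (h1 ▸ hvK)
  refine ⟨J, sg y R q ∩ J, hJR, Finset.inter_subset_right, by omega, ?_⟩
  rcases lt_or_gt_of_ne hφ with hlt | hgt
  · exact Or.inl ⟨rfl, hJc, v, hvK, _, hnotK, hJv, hJw, hlt, hedge⟩
  · exact Or.inr ⟨rfl, hJc, v, hvK, _, hnotK, hJv, hJw, by
      rw [inner_neg_left, inner_neg_left]; exact neg_lt_neg hgt, hedge⟩

lemma exists_faceRel [Fintype ι] (hy : GP y φ) {K : Set (EuclideanSpace ℝ (Fin d))}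
    (hK : Convex ℝ K) (hq : ∀ h ∈ R, ev (y h) q ≠ 0) (hqK : q ∈ K)
    (hv : ¬ ∃ v ∈ K, v ∈ poly y R q ∅ ∧ (act y R v).card = d) :
    ∃ J T, J ⊆ R ∧ T ⊆ J ∧ J.card ≤ d - 1 ∧ FaceRel y K R (sg y R q) J T := by
  have hex : ∃ x ∈ K ∩ poly y R q ∅, ∀ z ∈ K ∩ poly y R q ∅,
      (act y R z).card ≤ (act y R x).card := by
    have hfin : ((fun x => (act y R x).card) '' (K ∩ poly y R q ∅)).Finite := by
      refine (Set.finite_Iic d).subset ?_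
      rintro _ ⟨x, -, rfl⟩
      exact hy.card_le fun i hi => (mem_act.1 hi).2
    obtain ⟨_, ⟨x, hx, rfl⟩, hmax⟩ := Set.exists_max_image _ id hfin
      ⟨_, q, ⟨hqK, fun h _ => mul_self_nonneg _, by simp⟩, rfl⟩
    exact ⟨x, hx, fun z hz => hmax _ ⟨z, hz, rfl⟩⟩
  obtain ⟨x, ⟨hxK, hxp⟩, hmax⟩ := hex
  have hIc : (act y R x).card ≤ d - 1 := by
    have h1 : (act y R x).card ≤ d := hy.card_le fun i hi => (mem_act.1 hi).2
    have h2 : (act y R x).card ≠ d := fun h => hv ⟨x, hxK, hxp, h⟩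
    omega
  have hx0 : ∀ h ∈ act y R x, ev (y h) x = 0 := fun h hh => (mem_act.1 hh).2
  have hxs : ∀ h ∈ R \ act y R x, 0 < ev (y h) q * ev (y h) x := by
    intro h hh
    rw [Finset.mem_sdiff] at hh
    exact lt_of_le_of_ne (hxp.1 h hh.1) (mul_ne_zero (hq h hh.1)
      fun h0 => hh.2 (mem_act.2 ⟨hh.1, h0⟩)).symm
  have claim : ∀ z ∈ K, (∀ h ∈ act y R x, ev (y h) z = 0) →
      ∀ h ∈ R \ act y R x, 0 < ev (y h) q * ev (y h) z := by
    intro z hzK hz0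
    by_contra! hcon
    obtain ⟨h0, hh0, hneg0⟩ := hcon
    set N := (R \ act y R x).filter fun h => ev (y h) q * ev (y h) z ≤ 0 with hN
    set ρ : ι → ℝ := fun h => ev (y h) q * ev (y h) x /
      (ev (y h) q * ev (y h) x - ev (y h) q * ev (y h) z) with hρ
    obtain ⟨g, hg, hmin⟩ := N.exists_min_image ρ ⟨h0, Finset.mem_filter.2 ⟨hh0, hneg0⟩⟩
    obtain ⟨hgR, hgz⟩ := Finset.mem_filter.1 hg
    have hg1 := hxs g hgR
    have hρ0 : 0 ≤ ρ g := div_nonneg hg1.le (by linarith)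
    have hρ1 : ρ g ≤ 1 := (div_le_one (by linarith)).2 (by linarith)
    have hval : ∀ h, ev (y h) q * ev (y h) (x + ρ g • (z - x)) = ev (y h) q * ev (y h) x -
        ρ g * (ev (y h) q * ev (y h) x - ev (y h) q * ev (y h) z) := by
      intro h
      rw [ev_add_smul, ← ev_sub]; ring
    have hmem : x + ρ g • (z - x) ∈ K ∩ poly y R q ∅ := by
      refine ⟨hK.add_smul_sub_mem hxK hzK ⟨hρ0, hρ1⟩, fun h hh => ?_, by simp⟩
      rw [hval]
      by_cases hhI : h ∈ act y R x
      · rw [hx0 h hhI, hz0 h hhI]; simp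
      · have h1 := hxs h (Finset.mem_sdiff.2 ⟨hh, hhI⟩)
        by_cases hhz : ev (y h) q * ev (y h) z ≤ 0
        · have h2 := hmin h (Finset.mem_filter.2 ⟨Finset.mem_sdiff.2 ⟨hh, hhI⟩, hhz⟩)
          have h3 : ρ g * (ev (y h) q * ev (y h) x - ev (y h) q * ev (y h) z) ≤
              ρ h * (ev (y h) q * ev (y h) x - ev (y h) q * ev (y h) z) :=
            mul_le_mul_of_nonneg_right h2 (by linarith)
          have h4 : ρ h * (ev (y h) q * ev (y h) x - ev (y h) q * ev (y h) z) =
              ev (y h) q * ev (y h) x := div_mul_cancel₀ _ (by linarith)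
          linarith
        · push Not at hhz
          have h2 := mul_le_mul_of_nonneg_right hρ1 h1.le
          have h3 := mul_nonneg hρ0 hhz.le
          linarith
    have hlt := hmax _ hmem
    refine absurd hlt (not_le.2 (Finset.card_lt_card ?_))
    rw [Finset.ssubset_iff]
    refine ⟨g, (Finset.mem_sdiff.1 hgR).2, fun i hi => ?_⟩
    rcases Finset.mem_insert.1 hi with rfl | hi
    · refine mem_act.2 ⟨(Finset.mem_sdiff.1 hgR).1, ?_⟩
      have h1 := hval i
      rw [show ρ i * (ev (y i) q * ev (y i) x - ev (y i) q * ev (y i) z) =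
              ev (y i) q * ev (y i) x from div_mul_cancel₀ _ (by linarith), sub_self] at h1
      exact (mul_eq_zero.1 h1).resolve_left (hq i (Finset.mem_sdiff.1 hgR).1)
    · refine mem_act.2 ⟨(mem_act.1 hi).1, ?_⟩
      rw [ev_add_smul, ← ev_sub, hx0 i hi, hz0 i hi]; simp
  have hiff : ∀ z ∈ K, (∀ h ∈ act y R x, ev (y h) z = 0) → ∀ h ∈ R \ act y R x,
      (0 < ev (y h) z ↔ h ∈ sg y R q) := by
    intro z hz hz0 h hh
    rw [pos_iff_of_mul_pos (claim z hz hz0 h hh), mem_sg]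
    exact ⟨fun h1 => ⟨(Finset.mem_sdiff.1 hh).1, h1⟩, fun h => h.2⟩
  refine ⟨act y R x, sg y R q ∩ act y R x, Finset.filter_subset _ _, Finset.inter_subset_right,
    hIc, rfl, x, hxK, hx0, fun h hh => ⟨fun h0 => ?_, hiff x hxK hx0 h hh, ?_⟩⟩
  · have := hxs h hh
    rw [h0, mul_zero] at this
    exact lt_irrefl _ this
  · exact fun z hz hz0 => hiff z hz hz0 h hh

lemma card_small_subsets (R : Finset ι) (m : ℕ) :
    (R.powerset.filter fun I => I.card ≤ m).card ≤ (R.card + 1) ^ m := by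
  induction m with
  | zero =>
    rw [pow_zero]
    refine Finset.card_le_one.2 fun a ha b hb => ?_
    simp only [Finset.mem_filter, Nat.le_zero, Finset.card_eq_zero] at ha hb
    rw [ha.2, hb.2]
  | succ m ih =>
    have hsub : (R.powerset.filter fun I => I.card ≤ m + 1) ⊆
        ((Finset.insertNone R) ×ˢ (R.powerset.filter fun I => I.card ≤ m)).image
          fun p => p.1.elim p.2 fun h => insert h p.2 := by
      intro I hI
      simp only [Finset.mem_filter, Finset.mem_powerset] at hI
      rw [Finset.mem_image]
      rcases I.eq_empty_or_nonempty with rfl | ⟨h, hh⟩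
      · exact ⟨(none, ∅), by simp, rfl⟩
      · refine ⟨(some h, I.erase h), ?_, by simp [Finset.insert_erase hh]⟩
        simp only [Finset.mem_product, Finset.some_mem_insertNone, Finset.mem_filter,
          Finset.mem_powerset]
        refine ⟨hI.1 hh, (Finset.erase_subset _ _).trans hI.1, ?_⟩
        rw [Finset.card_erase_of_mem hh]; omega
    refine (Finset.card_le_card hsub).trans (Finset.card_image_le.trans ?_)
    rw [Finset.card_product, Finset.card_insertNone, pow_succ, mul_comm]
    exact Nat.mul_le_mul_right _ ih

/-- The number of cells meeting a set of points outside the interior of a convex body. -/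
lemma card_cells_le [Fintype ι] (hy : GP y φ) {K : Set (EuclideanSpace ℝ (Fin d))}
    {X : Finset (EuclideanSpace ℝ (Fin d))}
    (hK : Convex ℝ K) (hKc : IsCompact K)
    (hB : Bornology.IsBounded {x | ∀ h ∈ B, 0 ≤ ev (y h) x}) (hBR : B ⊆ R)
    (hXB : ∀ q ∈ X, ∀ h ∈ B, 0 < ev (y h) q)
    (hX0 : ∀ q ∈ X, ∀ h ∈ R, ev (y h) q ≠ 0) (hXK : ∀ q ∈ X, q ∈ K)
    (hXi : ∀ q ∈ X, q ∉ interior K) :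
    (cells y R X).card ≤ 3 * 2 ^ (d - 1) * (R.card + 1) ^ (d - 1) := by
  set pairs := (R.powerset.filter fun I => I.card ≤ d - 1).sigma fun I => I.powerset with hpairs
  have hcard : pairs.card ≤ 2 ^ (d - 1) * (R.card + 1) ^ (d - 1) := by
    rw [hpairs, Finset.card_sigma]
    calc _ ≤ ∑ _I ∈ R.powerset.filter fun I => I.card ≤ d - 1, 2 ^ (d - 1) := by
          refine Finset.sum_le_sum fun I hI => ?_
          rw [Finset.card_powerset]
          exact Nat.pow_le_pow_right (by norm_num) (Finset.mem_filter.1 hI).2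
      _ ≤ _ := by
          rw [Finset.sum_const, smul_eq_mul, mul_comm]
          exact Nat.mul_le_mul_left _ (card_small_subsets R _)
  have h3 : (cells y R X).card ≤ ((Finset.univ : Finset (Fin 3)) ×ˢ pairs).card := by
    refine Finset.card_le_card_of_forall_subsingleton
      (fun σ b => (b.1 = 0 ∧ FaceRel y K R σ b.2.1 b.2.2) ∨
        (b.1 = 1 ∧ EdgeRel y φ K R σ b.2.1 b.2.2) ∨
        (b.1 = 2 ∧ EdgeRel y (-φ) K R σ b.2.1 b.2.2)) ?_ ?_
    · intro σ hσ
      obtain ⟨q, hq, rfl⟩ := Finset.mem_image.1 hσ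
      by_cases hv : ∃ v ∈ K, v ∈ poly y R q ∅ ∧ (act y R v).card = d
      · obtain ⟨J, T, hJR, hTJ, hJc, hE⟩ := exists_edgeRel hy hK hKc
          (isBounded_poly hB hBR (hXB q hq)) (hX0 q hq) (hXi q hq) hv
        have hm : (⟨J, T⟩ : Σ _ : Finset ι, Finset ι) ∈ pairs := by
          simp [hpairs, hJR, hTJ, hJc]
        rcases hE with hE | hE
        · exact ⟨(1, ⟨J, T⟩), by simp [hm], by simp [hE]⟩
        · exact ⟨(2, ⟨J, T⟩), by simp [hm], by simp [hE]⟩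
      · obtain ⟨J, T, hJR, hTJ, hJc, hE⟩ := exists_faceRel hy hK (hX0 q hq) (hXK q hq) hv
        have hm : (⟨J, T⟩ : Σ _ : Finset ι, Finset ι) ∈ pairs := by
          simp [hpairs, hJR, hTJ, hJc]
        exact ⟨(0, ⟨J, T⟩), by simp [hm], by simp [hE]⟩
    · rintro ⟨k, J, T⟩ -
      rintro σ ⟨hσ, h⟩ σ' ⟨hσ', h'⟩
      obtain ⟨q, -, rfl⟩ := Finset.mem_image.1 hσ
      obtain ⟨q', -, rfl⟩ := Finset.mem_image.1 hσ'
      have hs : sg y R q ⊆ R := Finset.filter_subset _ _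
      have hs' : sg y R q' ⊆ R := Finset.filter_subset _ _
      rcases h with ⟨rfl, h⟩ | ⟨rfl, h⟩ | ⟨rfl, h⟩
      · simp only [true_and, Fin.isValue, zero_ne_one, false_and, or_false,
          show (0 : Fin 3) ≠ 2 by decide] at h'
        exact h.eq hs hs' h'
      · simp only [true_and, Fin.isValue, one_ne_zero, false_and, false_or, or_false,
          show (1 : Fin 3) ≠ 2 by decide] at h'
        exact h.eq hy hK hs hs' h'
      · simp only [true_and, Fin.isValue, false_and, false_or,
          show (2 : Fin 3) ≠ 0 by decide, show (2 : Fin 3) ≠ 1 by decide] at h'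
        exact h.eq hy.neg hK hs hs' h'
  rw [Finset.card_product, Finset.card_univ, Fintype.card_fin] at h3
  calc _ ≤ 3 * pairs.card := h3
    _ ≤ 3 * (2 ^ (d - 1) * (R.card + 1) ^ (d - 1)) := Nat.mul_le_mul_left _ hcard
    _ = _ := by ring

end Cells

/-- Triples `(I, J, τ)`: the set `I` of size `i` supports a face with signs `τ` off `I`, and all
`2 ^ j` ways of resolving the signs on `J ⊆ I` yield cells meeting `X`. -/
def Zs {d : ℕ} {ι : Type*} (y : ι → EuclideanSpace ℝ (Fin d) × ℝ)
    (X : Finset (EuclideanSpace ℝ (Fin d))) (R : Finset ι) (i j : ℕ) :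
    Finset (Finset ι × Finset ι × Finset ι) :=
  (R.powerset ×ˢ R.powerset ×ˢ R.powerset).filter fun z =>
    z.1.card = i ∧ z.2.1 ⊆ z.1 ∧ z.2.1.card = j ∧ Disjoint z.2.2 z.2.1 ∧
    (∃ x, (∀ h ∈ z.1, ev (y h) x = 0) ∧
      ∀ h ∈ R, h ∉ z.1 → ev (y h) x ≠ 0 ∧ (0 < ev (y h) x ↔ h ∈ z.2.2)) ∧
    ∀ T ⊆ z.2.1, z.2.2 ∪ T ∈ cells y R X

section Zone

variable {d : ℕ} {ι : Type*} {y : ι → EuclideanSpace ℝ (Fin d) × ℝ}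
  {φ : EuclideanSpace ℝ (Fin d)} {B R Q : Finset ι} {X : Finset (EuclideanSpace ℝ (Fin d))}
  {i j : ℕ}

lemma mem_Zs {I J τ : Finset ι} : (I, J, τ) ∈ Zs y X R i j ↔
    I ⊆ R ∧ τ ⊆ R ∧ I.card = i ∧ J ⊆ I ∧ J.card = j ∧ Disjoint τ J ∧
    (∃ x, (∀ h ∈ I, ev (y h) x = 0) ∧
      ∀ h ∈ R, h ∉ I → ev (y h) x ≠ 0 ∧ (0 < ev (y h) x ↔ h ∈ τ)) ∧
    ∀ T ⊆ J, τ ∪ T ∈ cells y R X := by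
  simp only [Zs, Finset.mem_filter, Finset.mem_product, Finset.mem_powerset]
  constructor
  · rintro ⟨⟨h1, h2, h3⟩, h⟩; exact ⟨h1, h3, h⟩
  · rintro ⟨h1, h2, h3, h4, h⟩; exact ⟨⟨h1, h4.trans h1, h2⟩, h3, h4, h⟩

lemma card_Zs_le : (Zs y X R i j).card ≤ 8 ^ R.card := by
  refine (Finset.card_filter_le _ _).trans ?_
  rw [Finset.card_product, Finset.card_product, Finset.card_powerset, ← mul_pow, ← mul_pow]
  norm_num

lemma sg_erase {q : EuclideanSpace ℝ (Fin d)} {h : ι} :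
    sg y (R.erase h) q = (sg y R q).erase h := by
  ext g; simp [mem_sg, and_assoc]

lemma exists_zero_of_opposite {I : Finset ι} {τ τ' : Finset ι} {h : ι} (hI : h ∉ I)
    (hR : h ∈ R) (hτ : h ∉ τ) (hτ' : h ∈ τ') (heq : τ'.erase h = τ)
    {x x' : EuclideanSpace ℝ (Fin d)}
    (hx0 : ∀ h ∈ I, ev (y h) x = 0)
    (hx : ∀ h ∈ R, h ∉ I → ev (y h) x ≠ 0 ∧ (0 < ev (y h) x ↔ h ∈ τ))
    (hx0' : ∀ h ∈ I, ev (y h) x' = 0)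
    (hx' : ∀ h ∈ R, h ∉ I → ev (y h) x' ≠ 0 ∧ (0 < ev (y h) x' ↔ h ∈ τ')) :
    ∃ z, (∀ g ∈ insert h I, ev (y g) z = 0) ∧
      ∀ g ∈ R, g ∉ insert h I → ev (y g) z ≠ 0 ∧ (0 < ev (y g) z ↔ g ∈ τ) := by
  have h1 : 0 < ev (y h) x' := (hx' h hR hI).2.2 hτ'
  have h2 : ev (y h) x < 0 := lt_of_le_of_ne (not_lt.1 fun h0 => hτ ((hx h hR hI).2.1 h0))
    (hx h hR hI).1
  set a := ev (y h) x' / (ev (y h) x' - ev (y h) x) with ha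
  set b := -ev (y h) x / (ev (y h) x' - ev (y h) x) with hb
  have hden : 0 < ev (y h) x' - ev (y h) x := by linarith
  have ha0 : 0 < a := div_pos h1 hden
  have hb0 : 0 < b := div_pos (by linarith) hden
  have hab : a + b = 1 := by rw [ha, hb]; field_simp; ring
  refine ⟨a • x + b • x', fun g hg => ?_, fun g hg hgI => ?_⟩
  · rw [ev_combo _ _ _ hab]
    rcases Finset.mem_insert.1 hg with rfl | hg
    · rw [ha, hb]; field_simp; ring
    · rw [hx0 g hg, hx0' g hg]; simp
  · rw [ev_combo _ _ _ hab]
    rw [Finset.mem_insert, not_or] at hgI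
    have e1 := hx g hg hgI.2
    have e2 := hx' g hg hgI.2
    have e3 : g ∈ τ' ↔ g ∈ τ := by rw [← heq]; simp [hgI.1]
    rw [e3] at e2
    by_cases hgτ : g ∈ τ
    · have := mul_pos ha0 (e1.2.2 hgτ)
      have := mul_pos hb0 (e2.2.2 hgτ)
      have h3 : 0 < a * ev (y g) x + b * ev (y g) x' := by linarith
      exact ⟨h3.ne', by simp [hgτ, h3]⟩
    · have n1 := lt_of_le_of_ne (not_lt.1 fun h0 => hgτ (e1.2.1 h0)) e1.1
      have n2 := lt_of_le_of_ne (not_lt.1 fun h0 => hgτ (e2.2.1 h0)) e2.1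
      have := mul_neg_of_pos_of_neg ha0 n1
      have := mul_neg_of_pos_of_neg hb0 n2
      have h3 : a * ev (y g) x + b * ev (y g) x' < 0 := by linarith
      exact ⟨h3.ne, by simp [hgτ, h3.le]⟩

lemma card_Zs_filter_le {h : ι} (hR : h ∈ R) :
    ((Zs y X R i j).filter fun z => h ∉ z.1).card ≤
      (Zs y X (R.erase h) i j).card +
        ((Zs y X R (i + 1) (j + 1)).filter fun z => h ∈ z.2.1).card := by
  set Z0 := ((Zs y X R i j).filter fun z => h ∉ z.1).filter fun z => h ∉ z.2.2 with hZ0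
  set Z1 := ((Zs y X R i j).filter fun z => h ∉ z.1).filter fun z => ¬ h ∉ z.2.2 with hZ1
  have hsplit : Z0.card + Z1.card = ((Zs y X R i j).filter fun z => h ∉ z.1).card :=
    Finset.card_filter_add_card_filter_not _
  set e : Finset ι × Finset ι × Finset ι → Finset ι × Finset ι × Finset ι :=
    fun z => (z.1, z.2.1, z.2.2.erase h) with he
  have hinj : Set.InjOn e Z1 := by
    rintro ⟨I, J, τ⟩ hz ⟨I', J', τ'⟩ hz' heq
    simp only [hZ1, Finset.coe_filter, Finset.mem_filter, Set.mem_ofPred_eq, not_not] at hz hz'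
    simp only [he, Prod.mk.injEq] at heq ⊢
    refine ⟨heq.1, heq.2.1, ?_⟩
    rw [← Finset.insert_erase hz.2, heq.2.2, Finset.insert_erase hz'.2]
  have herase : ∀ I J τ, (I, J, τ) ∈ Zs y X R i j → h ∉ I →
      (I, J, τ.erase h) ∈ Zs y X (R.erase h) i j := by
    intro I J τ hz hI
    rw [mem_Zs] at hz ⊢
    obtain ⟨h1, h2, h3, h4, h5, h6, ⟨x, hx0, hx⟩, h8⟩ := hz
    refine ⟨?_, Finset.erase_subset_erase _ h2, h3, h4, h5,
      h6.mono_left (Finset.erase_subset _ _), ⟨x, hx0, ?_⟩, ?_⟩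
    · exact fun g hg => Finset.mem_erase.2 ⟨fun e => hI (e ▸ hg), h1 hg⟩
    · intro g hg hgI
      rw [Finset.mem_erase] at hg
      have := hx g hg.2 hgI
      simpa [hg.1] using this
    · intro T hT
      obtain ⟨q, hq, hqT⟩ := Finset.mem_image.1 (h8 T hT)
      refine Finset.mem_image.2 ⟨q, hq, ?_⟩
      rw [sg_erase, hqT]
      ext g
      simp only [Finset.mem_erase, Finset.mem_union]
      have : g ∈ T → g ≠ h := fun hg e => hI (h4 (hT (e ▸ hg)))
      tauto
  have hunion : Z0 ∪ Z1.image e ⊆ Zs y X (R.erase h) i j := by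
    rintro ⟨I, J, τ⟩ hz
    rcases Finset.mem_union.1 hz with hz | hz
    · simp only [hZ0, Finset.mem_filter] at hz
      have := herase I J τ hz.1.1 hz.1.2
      rwa [Finset.erase_eq_of_notMem hz.2] at this
    · obtain ⟨⟨I', J', τ'⟩, hz', heq⟩ := Finset.mem_image.1 hz
      simp only [hZ1, Finset.mem_filter] at hz'
      rw [← heq]
      exact herase I' J' τ' hz'.1.1 hz'.1.2
  have hinter : (Z0 ∩ Z1.image e).card ≤
      ((Zs y X R (i + 1) (j + 1)).filter fun z => h ∈ z.2.1).card := by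
    refine Finset.card_le_card_of_injOn (fun z => (insert h z.1, insert h z.2.1, z.2.2)) ?_ ?_
    · rintro ⟨I, J, τ⟩ hz
      rw [Finset.mem_coe, Finset.mem_inter] at hz
      obtain ⟨hz, hzi⟩ := hz
      obtain ⟨⟨I', J', τ'⟩, hz', heq⟩ := Finset.mem_image.1 hzi
      clear hzi
      simp only [hZ1, Finset.mem_filter, not_not] at hz'
      simp only [hZ0, Finset.mem_filter] at hz
      simp only [he, Prod.mk.injEq] at heq
      obtain ⟨rfl, rfl, heq⟩ := heq
      obtain ⟨⟨hz, hI⟩, hτ⟩ := hz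
      obtain ⟨⟨hz', -⟩, hτ'⟩ := hz'
      rw [mem_Zs] at hz hz'
      obtain ⟨h1, h2, h3, h4, h5, h6, ⟨x, hx0, hx⟩, h8⟩ := hz
      obtain ⟨-, h2', -, -, -, h6', ⟨x', hx0', hx'⟩, h8'⟩ := hz'
      have hJ : h ∉ J' := fun hh => hI (h4 hh)
      refine Finset.mem_filter.2 ⟨mem_Zs.2 ⟨?_, h2, ?_, ?_, ?_, ?_, ?_, ?_⟩, by simp⟩
      · exact Finset.insert_subset hR h1
      · rw [Finset.card_insert_of_notMem hI, h3]
      · exact Finset.insert_subset_insert _ h4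
      · rw [Finset.card_insert_of_notMem hJ, h5]
      · rw [Finset.disjoint_insert_right]; exact ⟨hτ, h6⟩
      · exact exists_zero_of_opposite hI hR hτ hτ' heq hx0 hx hx0' hx'
      · intro T hT
        by_cases hhT : h ∈ T
        · have := h8' (T.erase h) (by
            intro g hg
            rw [Finset.mem_erase] at hg
            exact (Finset.mem_insert.1 (hT hg.2)).resolve_left hg.1)
          convert this using 1
          rw [← heq]
          ext g
          simp only [Finset.mem_erase, Finset.mem_union]
          by_cases hg : g = h
          · subst hg; simp [hhT, hτ']
          · simp [hg]
        · exact h8 T fun g hg => (Finset.mem_insert.1 (hT hg)).resolve_left fun e => hhT (e ▸ hg)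
    · rintro ⟨I, J, τ⟩ hz ⟨I', J', τ'⟩ hz' heq
      have hz := (Finset.mem_inter.1 (Finset.mem_coe.1 hz)).1
      have hz' := (Finset.mem_inter.1 (Finset.mem_coe.1 hz')).1
      simp only [hZ0, Finset.mem_filter] at hz hz'
      have hJ : h ∉ J := fun hh => hz.1.2 ((mem_Zs.1 hz.1.1).2.2.2.1 hh)
      have hJ' : h ∉ J' := fun hh => hz'.1.2 ((mem_Zs.1 hz'.1.1).2.2.2.1 hh)
      simp only [Prod.mk.injEq] at heq ⊢
      refine ⟨?_, ?_, heq.2.2⟩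
      · rw [← Finset.erase_insert hz.1.2, heq.1, Finset.erase_insert hz'.1.2]
      · rw [← Finset.erase_insert hJ, heq.2.1, Finset.erase_insert hJ']
  have h1 := Finset.card_union_add_card_inter Z0 (Z1.image e)
  rw [Finset.card_image_of_injOn hinj] at h1
  have h2 := Finset.card_le_card hunion
  omega

lemma sum_card_filter_comm {α β : Type*} (s : Finset α) (t : Finset β) (r : α → β → Prop)
    [∀ a b, Decidable (r a b)] :
    ∑ a ∈ s, (t.filter (r a)).card = ∑ b ∈ t, (s.filter fun a => r a b).card := by
  simp_rw [Finset.card_filter]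
  exact Finset.sum_comm

lemma Zs_recursion (hQB : Disjoint Q B) :
    (Q.card - i) * (Zs y X (B ∪ Q) i j).card ≤
      ∑ h ∈ Q, (Zs y X (B ∪ Q.erase h) i j).card +
        (j + 1) * (Zs y X (B ∪ Q) (i + 1) (j + 1)).card := by
  have hB : ∀ h ∈ Q, (B ∪ Q).erase h = B ∪ Q.erase h := by
    intro h hh
    rw [Finset.erase_union_distrib, Finset.erase_eq_of_notMem (Finset.disjoint_left.1 hQB hh)]
  have h1 : ∑ h ∈ Q, ((Zs y X (B ∪ Q) i j).filter fun z => h ∉ z.1).card ≤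
      ∑ h ∈ Q, ((Zs y X (B ∪ Q.erase h) i j).card +
        ((Zs y X (B ∪ Q) (i + 1) (j + 1)).filter fun z => h ∈ z.2.1).card) :=
    Finset.sum_le_sum fun h hh => by
      rw [← hB h hh]; exact card_Zs_filter_le (Finset.mem_union_right _ hh)
  have h2 : (Q.card - i) * (Zs y X (B ∪ Q) i j).card ≤
      ∑ h ∈ Q, ((Zs y X (B ∪ Q) i j).filter fun z => h ∉ z.1).card := by
    rw [sum_card_filter_comm Q (Zs y X (B ∪ Q) i j) fun h z => h ∉ z.1, mul_comm, ← smul_eq_mul]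
    refine Finset.card_nsmul_le_sum _ _ _ ?_
    rintro ⟨I, J, τ⟩ hz
    rw [← (mem_Zs.1 hz).2.2.1, Finset.filter_notMem_eq_sdiff]
    exact Finset.le_card_sdiff _ _
  have h3 : ∑ h ∈ Q, ((Zs y X (B ∪ Q) (i + 1) (j + 1)).filter fun z => h ∈ z.2.1).card ≤
      (j + 1) * (Zs y X (B ∪ Q) (i + 1) (j + 1)).card := by
    rw [sum_card_filter_comm Q (Zs y X (B ∪ Q) (i + 1) (j + 1)) fun h z => h ∈ z.2.1, mul_comm,
      ← smul_eq_mul]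
    refine Finset.sum_le_card_nsmul _ _ _ ?_
    rintro ⟨I, J, τ⟩ hz
    rw [← (mem_Zs.1 hz).2.2.2.2.1]
    exact Finset.card_le_card fun h hh => (Finset.mem_filter.1 hh).2
  rw [Finset.sum_add_distrib] at h1
  omega

/-- Two vertices agree if each is extremal for the other in the direction `φ`. -/
lemma vertex_unique [Fintype ι] (hy : GP y φ) {A A' E E' : Finset ι} (hA : A.card = d)
    (hA' : A'.card = d) {v v' : EuclideanSpace ℝ (Fin d)} (hv : ∀ h ∈ A, ev (y h) v = 0)
    (hv' : ∀ h ∈ A', ev (y h) v' = 0) {c c' : ι → ℝ} (hc : φ = ∑ h ∈ A, c h • (y h).1)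
    (hc' : φ = ∑ h ∈ A', c' h • (y h).1) (hE : A \ E ⊆ A') (hE' : A' \ E' ⊆ A) (s : ℝ)
    (hs : s ≠ 0) (h1 : ∀ h ∈ A, h ∈ E → 0 ≤ s * (c h * ev (y h) v'))
    (h2 : ∀ h ∈ A', h ∈ E' → 0 ≤ s * (c' h * ev (y h) v)) : A = A' := by
  have e1 : s * (⟪φ, v'⟫ - ⟪φ, v⟫) = ∑ h ∈ A, s * (c h * ev (y h) v') := by
    rw [inner_sub_of_decomp hc, Finset.mul_sum]
    exact Finset.sum_congr rfl fun h hh => by rw [hv h hh, sub_zero]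
  have e2 : s * (⟪φ, v⟫ - ⟪φ, v'⟫) = ∑ h ∈ A', s * (c' h * ev (y h) v) := by
    rw [inner_sub_of_decomp hc', Finset.mul_sum]
    exact Finset.sum_congr rfl fun h hh => by rw [hv' h hh, sub_zero]
  have p1 : ∀ h ∈ A, 0 ≤ s * (c h * ev (y h) v') := by
    intro h hh
    by_cases hE1 : h ∈ E
    · exact h1 h hh hE1
    · rw [hv' h (hE (Finset.mem_sdiff.2 ⟨hh, hE1⟩))]; simp
  have p2 : ∀ h ∈ A', 0 ≤ s * (c' h * ev (y h) v) := by
    intro h hh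
    by_cases hE1 : h ∈ E'
    · exact h2 h hh hE1
    · rw [hv h (hE' (Finset.mem_sdiff.2 ⟨hh, hE1⟩))]; simp
  have z : ∑ h ∈ A, s * (c h * ev (y h) v') = 0 := by
    have := Finset.sum_nonneg p1
    have := Finset.sum_nonneg p2
    linarith
  rw [Finset.sum_eq_zero_iff_of_nonneg p1] at z
  have hzero : ∀ h ∈ A ∪ A', ev (y h) v' = 0 := by
    intro h hh
    rcases Finset.mem_union.1 hh with hh | hh
    · have := z h hh
      simpa [hs, hy.coeff_ne_zero hA hc hh] using this
    · exact hv' h hh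
  have hcard := hy.card_le hzero
  have s1 : A = A ∪ A' := Finset.eq_of_subset_of_card_le Finset.subset_union_left (by omega)
  have s2 : A' = A ∪ A' := Finset.eq_of_subset_of_card_le Finset.subset_union_right (by omega)
  rw [s1, ← s2]

lemma card_Zs_top [Fintype ι] (hy : GP y φ) : (Zs y X R d d).card ≤ (cells y R X).card := by
  have hdec : ∀ A : Finset ι, ∃ c : ι → ℝ, A.card = d → φ = ∑ h ∈ A, c h • (y h).1 := by
    intro A
    by_cases hA : A.card = d
    · obtain ⟨c, hc⟩ := hy.decomp hA φ
      exact ⟨c, fun _ => hc⟩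
    · exact ⟨0, fun h => absurd h hA⟩
  choose c hc using hdec
  refine Finset.card_le_card_of_injOn
    (fun z => z.2.2 ∪ z.1.filter fun h => 0 < c z.1 h) ?_ ?_
  · rintro ⟨A, J, τ⟩ hz
    obtain ⟨h1, h2, h3, h4, h5, h6, -, h8⟩ := mem_Zs.1 (Finset.mem_coe.1 hz)
    have hJ : J = A := Finset.eq_of_subset_of_card_le h4 (by omega)
    subst hJ
    exact h8 _ (Finset.filter_subset _ _)
  · rintro ⟨A, J, τ⟩ hz ⟨A', J', τ'⟩ hz' heq
    obtain ⟨h1, h2, h3, h4, h5, h6, ⟨v, hv0, hv⟩, h8⟩ := mem_Zs.1 (Finset.mem_coe.1 hz)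
    obtain ⟨h1', h2', h3', h4', h5', h6', ⟨v', hv0', hv'⟩, h8'⟩ := mem_Zs.1 (Finset.mem_coe.1 hz')
    have hJ : J = A := Finset.eq_of_subset_of_card_le h4 (by omega)
    have hJ' : J' = A' := Finset.eq_of_subset_of_card_le h4' (by omega)
    subst hJ hJ'
    simp only at heq
    have key : ∀ {A A' τ τ' : Finset ι} {v' : EuclideanSpace ℝ (Fin d)}, A.card = d → A ⊆ R →
        Disjoint τ A → (∀ h ∈ A', ev (y h) v' = 0) →
        (∀ h ∈ R, h ∉ A' → ev (y h) v' ≠ 0 ∧ (0 < ev (y h) v' ↔ h ∈ τ')) →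
        (τ ∪ A.filter fun h => 0 < c A h) = (τ' ∪ A'.filter fun h => 0 < c A' h) →
        ∀ h ∈ A, h ∈ A → 0 ≤ (1 : ℝ) * (c A h * ev (y h) v') := by
      intro A A' τ τ' v' hA hAR hτ hv0' hv' heq h hh _
      rw [one_mul]
      by_cases hh' : h ∈ A'
      · rw [hv0' h hh', mul_zero]
      · have e := Finset.ext_iff.1 heq h
        simp only [Finset.mem_union, Finset.mem_filter, hh, hh', true_and, false_and, or_false,
          Finset.disjoint_right.1 hτ hh, false_or] at e
        have e1 := hv' h (hAR hh) hh'
        rw [← e] at e1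
        by_cases hc0 : 0 < c A h
        · exact (mul_pos hc0 (e1.2.2 hc0)).le
        · exact mul_nonneg_of_nonpos_of_nonpos (not_lt.1 hc0)
            (not_lt.1 fun h0 => hc0 (e1.2.1 h0))
    have hAA : J = J' := by
      refine vertex_unique hy h3 h3' hv0 hv0' (hc J h3) (hc J' h3') (E := J) (E' := J')
        (by simp) (by simp) 1 one_ne_zero (key h3 h1 h6 hv0' hv' heq)
        (key h3' h1' h6' hv0 hv heq.symm)
    subst hAA
    have : τ = τ' := by
      ext h
      have e := Finset.ext_iff.1 heq h
      by_cases hh : h ∈ J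
      · simp [Finset.disjoint_right.1 h6 hh, Finset.disjoint_right.1 h6' hh]
      · simpa [hh] using e
    rw [this]

lemma card_Zs_vertex_le [Fintype ι] (hy : GP y φ) (e : ℕ) (hj : j + (2 * e - 1) ≤ d) :
    (Zs y X R d j).card ≤ 2 * (Zs y X R (d - e) j).card := by
  have hdec : ∀ A : Finset ι, ∃ c : ι → ℝ, A.card = d → φ = ∑ h ∈ A, c h • (y h).1 := by
    intro A
    by_cases hA : A.card = d
    · obtain ⟨c, hc⟩ := hy.decomp hA φ
      exact ⟨c, fun _ => hc⟩
    · exact ⟨0, fun h => absurd h hA⟩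
  choose c hc using hdec
  have hcard : 2 * (Zs y X R (d - e) j).card =
      ((Finset.univ : Finset Bool) ×ˢ (Zs y X R (d - e) j)).card := by
    rw [Finset.card_product]; simp
  rw [hcard]
  refine Finset.card_le_card_of_forall_subsingleton
    (fun z w => z.2.1 = w.2.2.1 ∧ z.2.2 = w.2.2.2 ∧ ∃ E ⊆ z.1 \ z.2.1, w.2.1 = z.1 \ E ∧
      ∀ h ∈ E, w.1 = decide (0 < c z.1 h ↔ h ∈ z.2.2)) ?_ ?_
  · rintro ⟨A, J, τ⟩ hz
    obtain ⟨h1, h2, h3, h4, h5, h6, ⟨v, hv0, hv⟩, h8⟩ := mem_Zs.1 hz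
    have hcardAJ : 2 * e - 1 ≤ (A \ J).card := by
      rw [Finset.card_sdiff_of_subset h4]; omega
    have hsplit := Finset.card_filter_add_card_filter_not (s := A \ J)
      (fun h => 0 < c A h ↔ h ∈ τ)
    obtain ⟨b, E, hEsub, hEc, hEb⟩ : ∃ b : Bool, ∃ E ⊆ A \ J, E.card = e ∧
        ∀ h ∈ E, b = decide (0 < c A h ↔ h ∈ τ) := by
      by_cases hle : e ≤ ((A \ J).filter fun h => 0 < c A h ↔ h ∈ τ).card
      · obtain ⟨E, hE, hEc⟩ := Finset.exists_subset_card_eq hle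
        exact ⟨true, E, hE.trans (Finset.filter_subset _ _), hEc, fun h hh => by
          have := (Finset.mem_filter.1 (hE hh)).2
          simp [this]⟩
      · have hle' : e ≤ ((A \ J).filter fun h => ¬ (0 < c A h ↔ h ∈ τ)).card := by omega
        obtain ⟨E, hE, hEc⟩ := Finset.exists_subset_card_eq hle'
        exact ⟨false, E, hE.trans (Finset.filter_subset _ _), hEc, fun h hh => by
          have := (Finset.mem_filter.1 (hE hh)).2
          simp [this]⟩
    have hEA : E ⊆ A := hEsub.trans Finset.sdiff_subset
    refine ⟨(b, A \ E, J, τ), Finset.mem_product.2 ⟨Finset.mem_univ _, mem_Zs.2 ⟨?_, h2, ?_, ?_,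
      h5, h6, ?_, h8⟩⟩, rfl, rfl, E, hEsub, rfl, hEb⟩
    · exact Finset.sdiff_subset.trans h1
    · rw [Finset.card_sdiff_of_subset hEA, h3, hEc]
    · exact fun h hh => Finset.mem_sdiff.2 ⟨h4 hh, fun hE => (Finset.mem_sdiff.1 (hEsub hE)).2 hh⟩
    · obtain ⟨x1, hx1⟩ := hy.exists_ev_eq h3 fun h => if h ∈ E then
        (if h ∈ τ then 1 else -1) else 0
      have hu : ∀ h ∈ A, ⟪(y h).1, x1 - v⟫ = if h ∈ E then (if h ∈ τ then 1 else -1) else 0 := by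
        intro h hh
        rw [← ev_sub, hx1 h hh, hv0 h hh, sub_zero]
      obtain ⟨t, ht, ht0⟩ := ((eventually_pos v v (x1 - v) y R).and self_mem_nhdsWithin).exists
      have ht0 : 0 < t := ht0
      refine ⟨v + t • (x1 - v), fun h hh => ?_, fun h hh hhA => ?_⟩
      · rw [Finset.mem_sdiff] at hh
        rw [ev_add_smul, hv0 h hh.1, hu h hh.1, if_neg hh.2]; simp
      · rw [Finset.mem_sdiff, not_and, not_not] at hhA
        by_cases hA : h ∈ A
        · rw [ev_add_smul, hv0 h hA, hu h hA, if_pos (hhA hA)]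
          split_ifs with hτ
          · simp [hτ, ht0, ht0.ne']
          · simp [hτ, ht0.le, ht0.ne']
        · have e1 := hv h hh hA
          have e2 := ht h hh (mul_self_pos.2 e1.1)
          refine ⟨fun h0 => ?_, ?_⟩
          · rw [h0, mul_zero] at e2; exact lt_irrefl _ e2
          · rw [pos_iff_of_mul_pos e2]; exact e1.2
  · rintro ⟨b, I, J0, τ0⟩ -
    rintro ⟨A, J, τ⟩ ⟨hz, rfl, rfl, E, hE, hI, hb⟩ ⟨A', J', τ'⟩ ⟨hz', h1', h2', E', hE', hI', hb'⟩
    simp only at h1' h2' hE hI hb hI' hb' hE'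
    subst h1' h2'
    obtain ⟨h1, h2, h3, h4, h5, h6, ⟨v, hv0, hv⟩, h8⟩ := mem_Zs.1 hz
    obtain ⟨h1', h2', h3', h4', h5', h6', ⟨v', hv0', hv'⟩, h8'⟩ := mem_Zs.1 hz'
    have key : ∀ {A A' E : Finset ι} {v' : EuclideanSpace ℝ (Fin d)}, A.card = d → A ⊆ R →
        (∀ h ∈ A', ev (y h) v' = 0) →
        (∀ h ∈ R, h ∉ A' → ev (y h) v' ≠ 0 ∧ (0 < ev (y h) v' ↔ h ∈ τ')) →
        (∀ h ∈ E, b = decide (0 < c A h ↔ h ∈ τ')) →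
        ∀ h ∈ A, h ∈ E → 0 ≤ (if b then (1 : ℝ) else -1) * (c A h * ev (y h) v') := by
      intro A A' E v' hA hAR hv0' hv' hb h hh hE
      by_cases hh' : h ∈ A'
      · rw [hv0' h hh', mul_zero, mul_zero]
      · have e1 := hv' h (hAR hh) hh'
        rw [hb h hE]
        by_cases hτ : h ∈ τ' <;> by_cases hc0 : 0 < c A h <;> simp only [hτ, hc0, iff_true,
          iff_false, not_true, decide_true, decide_false, if_true] at e1 ⊢
        · simpa using (mul_pos hc0 e1.2).le
        · simpa using mul_nonneg_of_nonpos_of_nonpos (neg_nonpos.2 zero_le_one)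
            (mul_nonpos_of_nonpos_of_nonneg (not_lt.1 hc0) e1.2.le)
        · simpa using mul_nonneg_of_nonpos_of_nonpos (neg_nonpos.2 zero_le_one)
            (mul_nonpos_of_nonneg_of_nonpos hc0.le (not_lt.1 e1.2))
        · simpa using mul_nonneg_of_nonpos_of_nonpos (not_lt.1 hc0) (not_lt.1 e1.2)
    have hAA : A = A' := by
      refine vertex_unique hy h3 h3' hv0 hv0' (hc A h3) (hc A' h3') (E := E) (E' := E')
        (by rw [← hI, hI']; exact Finset.sdiff_subset)
        (by rw [← hI', hI]; exact Finset.sdiff_subset) (if b then 1 else -1)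
        (by split_ifs <;> norm_num) (key h3 h1 hv0' hv' hb) (key h3' h1' hv0 hv hb')
    rw [hAA]

lemma card_Zs_edge_le [Fintype ι] (hy : GP y φ) (hd : 1 ≤ d)
    (hB : Bornology.IsBounded {x | ∀ h ∈ B, 0 ≤ ev (y h) x}) (hBR : B ⊆ R)
    (hXB : ∀ q ∈ X, ∀ h ∈ B, 0 < ev (y h) q) :
    (Zs y X R (d - 1) j).card ≤ d * (Zs y X R d j).card := by
  have hsub : Zs y X R (d - 1) j ⊆ (Zs y X R d j).biUnion fun z =>
      z.1.image fun h => (z.1.erase h, z.2.1, z.2.2) := by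
    rintro ⟨I, J, τ⟩ hz
    obtain ⟨h1, h2, h3, h4, h5, h6, ⟨x, hx0, hx⟩, h8⟩ := mem_Zs.1 hz
    have hBτ : B ⊆ τ := by
      obtain ⟨q, hq, hqτ⟩ := Finset.mem_image.1 (h8 ∅ (by simp))
      rw [Finset.union_empty] at hqτ
      intro h hh
      rw [← hqτ, mem_sg]
      exact ⟨hBR hh, hXB q hq h hh⟩
    have hbd : Bornology.IsBounded (poly y R x I) := by
      refine hB.subset fun z hz h hh => ?_
      by_cases hI : h ∈ I
      · rw [hz.2 h hI]
      · exact nonneg_of_mul_nonneg_right (hz.1 h (hBR hh)) ((hx h (hBR hh) hI).2.2 (hBτ hh))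
    obtain ⟨b, hb⟩ := exists_isBot (φ := φ) hbd
      ⟨x, fun h _ => mul_self_nonneg _, hx0⟩
    have hAc := hb.card_act hy h1
    have hIA : I ⊆ act y R b := fun h hh => mem_act.2 ⟨h1 hh, hb.1.2 h hh⟩
    obtain ⟨g, hg⟩ : ∃ g, act y R b \ I = {g} := by
      rw [← Finset.card_eq_one, Finset.card_sdiff_of_subset hIA]; omega
    have hgA : g ∈ act y R b ∧ g ∉ I := by
      rw [← Finset.mem_sdiff, hg]; simp
    rw [Finset.mem_biUnion]
    refine ⟨(act y R b, J, τ), mem_Zs.2 ⟨Finset.filter_subset _ _, h2, hAc, h4.trans hIA, h5, h6,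
      ⟨b, fun h hh => (mem_act.1 hh).2, fun h hh hhA => ?_⟩, h8⟩, ?_⟩
    · have hb0 : ev (y h) b ≠ 0 := fun h0 => hhA (mem_act.2 ⟨hh, h0⟩)
      have hhI : h ∉ I := fun hI => hhA (hIA hI)
      have hx' := hx h hh hhI
      have hpos := lt_of_le_of_ne (hb.1.1 h hh) (mul_ne_zero hx'.1 hb0).symm
      exact ⟨hb0, (pos_iff_of_mul_pos hpos).trans hx'.2⟩
    · refine Finset.mem_image.2 ⟨g, hgA.1, ?_⟩
      rw [Prod.mk.injEq]
      refine ⟨?_, rfl⟩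
      rw [Finset.erase_eq, ← hg, Finset.sdiff_sdiff_eq_self hIA]
  refine (Finset.card_le_card hsub).trans ?_
  rw [mul_comm]
  refine Finset.card_biUnion_le_card_mul _ _ _ ?_
  rintro ⟨I, J, τ⟩ hz
  refine Finset.card_image_le.trans ?_
  rw [(mem_Zs.1 hz).2.2.1]

end Zone

section Recursion

variable {ι : Type*} {B : Finset ι} {f g : Finset ι → ℕ} {d i j S : ℕ} {D G : ℝ}

lemma le_descFactorial_mul_of_recursion (w : ℕ → ℝ) (hw0 : ∀ s, 0 ≤ w s)
    (hrec : ∀ Q, Disjoint Q B →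
      (Q.card - i) * f Q ≤ ∑ h ∈ Q, f (Q.erase h) + (j + 1) * g Q)
    (hf : ∀ Q, Disjoint Q B → Q.card ≤ 2 * d → (f Q : ℝ) ≤ D)
    (hg : ∀ Q, Disjoint Q B → Q.card ≤ S → (g Q : ℝ) ≤ G * (Q.card + 1) ^ (d - 1))
    (hG : 0 ≤ G) (hi : i < d)
    (hw : ∀ s : ℕ, 2 * d < s →
      ((s : ℝ) + 1) ^ (d - 1) ≤ w s * (((s - i : ℕ) : ℝ) * s.descFactorial i))
    (s : ℕ) (hs : 2 * d ≤ s) : s ≤ S → ∀ Q, Disjoint Q B → Q.card = s →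
      (f Q : ℝ) ≤ s.descFactorial i * (D + (j + 1) * G * ∑ t ∈ Finset.Icc 1 s, w t) := by
  induction s, hs using Nat.le_induction with
  | base =>
    intro _ Q hQ hc
    have h1 : (1 : ℝ) ≤ ((2 * d).descFactorial i : ℕ) := by
      exact_mod_cast Nat.pos_iff_ne_zero.2 fun h => by
        rw [Nat.descFactorial_eq_zero_iff_lt] at h; omega
    have h2 : 0 ≤ (j + 1) * G * ∑ t ∈ Finset.Icc 1 (2 * d), w t :=
      mul_nonneg (by positivity) (Finset.sum_nonneg fun t _ => hw0 t)
    have h3 := hf Q hQ hc.le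
    nlinarith
  | succ s hs ih =>
    intro hsS Q hQ hc
    set a : ℝ := D + (j + 1) * G * ∑ t ∈ Finset.Icc 1 s, w t with ha
    have h1 : ((s + 1 - i : ℕ) : ℝ) * f Q ≤
        ∑ h ∈ Q, (f (Q.erase h) : ℝ) + (j + 1) * g Q := by
      have := hrec Q hQ
      rw [hc] at this
      exact_mod_cast this
    have h2 : ∑ h ∈ Q, (f (Q.erase h) : ℝ) ≤ (s + 1 : ℕ) * (s.descFactorial i * a) := by
      rw [← hc, ← nsmul_eq_mul]
      refine Finset.sum_le_card_nsmul _ _ _ fun h hh => ?_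
      exact ih (by omega) _ (hQ.mono_left (Finset.erase_subset _ _))
        (by rw [Finset.card_erase_of_mem hh, hc]; omega)
    have h3 : ((s + 1 - i : ℕ) : ℝ) * (s + 1).descFactorial i =
        (s + 1 : ℕ) * s.descFactorial i := by
      exact_mod_cast Nat.succ_descFactorial s i
    have h4 : (g Q : ℝ) ≤ G * (w (s + 1) * (((s + 1 - i : ℕ) : ℝ) * (s + 1).descFactorial i)) := by
      refine (hg Q hQ (by omega)).trans (mul_le_mul_of_nonneg_left ?_ hG)
      rw [hc]
      exact hw (s + 1) (by omega)
    have h5 : (0 : ℝ) < ((s + 1 - i : ℕ) : ℝ) := by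
      exact_mod_cast (by omega : 0 < s + 1 - i)
    refine le_of_mul_le_mul_left ?_ h5
    rw [Finset.sum_Icc_succ_top (by omega)]
    calc _ ≤ _ := h1
      _ ≤ (s + 1 : ℕ) * (s.descFactorial i * a) + (j + 1) *
          (G * (w (s + 1) * (((s + 1 - i : ℕ) : ℝ) * (s + 1).descFactorial i))) :=
        add_le_add h2 (mul_le_mul_of_nonneg_left h4 (by positivity))
      _ = _ := by
        rw [← mul_assoc ((s + 1 : ℕ) : ℝ), ← h3, ha]; ring

lemma half_pow_le_descFactorial {s : ℕ} (hs : 2 * d < s) (hi : i < d) :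
    ((s : ℝ) + 1) ^ i ≤ 2 ^ i * (s.descFactorial i : ℝ) := by
  have h1 : (((s + 1 - i : ℕ) : ℝ)) ^ i ≤ (s.descFactorial i : ℝ) := by
    exact_mod_cast Nat.pow_sub_le_descFactorial s i
  have h2 : ((s : ℝ) + 1) ≤ 2 * ((s + 1 - i : ℕ) : ℝ) := by
    exact_mod_cast (by omega : s + 1 ≤ 2 * (s + 1 - i))
  calc ((s : ℝ) + 1) ^ i ≤ (2 * ((s + 1 - i : ℕ) : ℝ)) ^ i := by gcongr
    _ = 2 ^ i * ((s + 1 - i : ℕ) : ℝ) ^ i := by rw [mul_pow]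
    _ ≤ _ := by gcongr

lemma recursion_log
    (hrec : ∀ Q, Disjoint Q B →
      (Q.card - (d - 1)) * f Q ≤ ∑ h ∈ Q, f (Q.erase h) + (j + 1) * g Q)
    (hf : ∀ Q, Disjoint Q B → Q.card ≤ 2 * d → (f Q : ℝ) ≤ D)
    (hg : ∀ Q, Disjoint Q B → Q.card ≤ S → (g Q : ℝ) ≤ G * (Q.card + 1) ^ (d - 1))
    (hD : 0 ≤ D) (hG : 0 ≤ G) (hd : 1 ≤ d) (hj : j < d) :
    ∀ Q, Disjoint Q B → Q.card ≤ S →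
      (f Q : ℝ) ≤ (D + d * 2 ^ d * G * (1 + Real.log S)) * (Q.card + 1) ^ (d - 1) := by
  intro Q hQ hS
  have hlog : 0 ≤ Real.log S := Real.log_natCast_nonneg S
  have hone : (1 : ℝ) ≤ ((Q.card : ℝ) + 1) ^ (d - 1) :=
    one_le_pow₀ (by have : (0 : ℝ) ≤ Q.card := by positivity
                    linarith)
  have hE : 0 ≤ d * 2 ^ d * G * (1 + Real.log S) := by positivity
  by_cases hs : 2 * d ≤ Q.card
  · have h := le_descFactorial_mul_of_recursion (fun s => 2 ^ d / s) (fun s => by positivity)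
      hrec hf hg hG (by omega) (fun s hs => ?_) Q.card hs hS Q hQ rfl
    · have h1 : ((Q.card.descFactorial (d - 1) : ℕ) : ℝ) ≤ ((Q.card : ℝ) + 1) ^ (d - 1) := by
        have : ((Q.card.descFactorial (d - 1) : ℕ) : ℝ) ≤ (Q.card : ℝ) ^ (d - 1) := by
          exact_mod_cast Nat.descFactorial_le_pow _ _
        exact this.trans (by gcongr; linarith)
      have h2 : ∑ t ∈ Finset.Icc 1 Q.card, (2 : ℝ) ^ d / t ≤ 2 ^ d * (1 + Real.log S) := by
        have e : ∑ t ∈ Finset.Icc 1 Q.card, (2 : ℝ) ^ d / t = 2 ^ d * (harmonic Q.card : ℝ) := by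
          rw [harmonic_eq_sum_Icc]
          push_cast
          rw [Finset.mul_sum]
          rfl
        rw [e]
        have h3 := harmonic_le_one_add_log Q.card
        have h4 : Real.log Q.card ≤ Real.log S :=
          Real.log_le_log (by exact_mod_cast (by omega : 0 < Q.card)) (by exact_mod_cast hS)
        gcongr
        linarith
      have h5 : ((j : ℝ) + 1) ≤ d := by exact_mod_cast hj
      calc _ ≤ _ := h
        _ ≤ ((Q.card : ℝ) + 1) ^ (d - 1) * (D + d * G * (2 ^ d * (1 + Real.log S))) := by
          gcongr
        _ = _ := by ring
    · have h1 := half_pow_le_descFactorial hs (i := d - 1) (by omega)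
      have hs0 : (0 : ℝ) < s := by exact_mod_cast (by omega : 0 < s)
      have h2 : (s : ℝ) ≤ 2 * ((s - (d - 1) : ℕ) : ℝ) := by
        exact_mod_cast (by omega : s ≤ 2 * (s - (d - 1)))
      have h3 : (2 : ℝ) ^ d = 2 * 2 ^ (d - 1) := by
        rw [← pow_succ']; congr 1; omega
      rw [h3, div_mul_eq_mul_div, le_div_iff₀ hs0]
      calc _ ≤ (2 ^ (d - 1) * (s.descFactorial (d - 1) : ℝ)) * (2 * ((s - (d - 1) : ℕ) : ℝ)) := by
            gcongr
        _ = _ := by ring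
  · have := hf Q hQ (by omega)
    nlinarith

lemma recursion_nolog
    (hrec : ∀ Q, Disjoint Q B →
      (Q.card - (d - 2)) * f Q ≤ ∑ h ∈ Q, f (Q.erase h) + (j + 1) * g Q)
    (hf : ∀ Q, Disjoint Q B → Q.card ≤ 2 * d → (f Q : ℝ) ≤ D)
    (hg : ∀ Q, Disjoint Q B → Q.card ≤ S → (g Q : ℝ) ≤ G * (Q.card + 1) ^ (d - 1))
    (hD : 0 ≤ D) (hG : 0 ≤ G) (hd : 2 ≤ d) (hj : j < d) :
    ∀ Q, Disjoint Q B → Q.card ≤ S →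
      (f Q : ℝ) ≤ (D + d * 2 ^ d * G) * (Q.card + 1) ^ (d - 1) := by
  intro Q hQ hS
  have hone : (1 : ℝ) ≤ ((Q.card : ℝ) + 1) ^ (d - 1) :=
    one_le_pow₀ (by have : (0 : ℝ) ≤ Q.card := by positivity
                    linarith)
  have hE : 0 ≤ d * 2 ^ d * G := by positivity
  by_cases hs : 2 * d ≤ Q.card
  · have h := le_descFactorial_mul_of_recursion (fun s => 2 ^ d) (fun s => by positivity)
      hrec hf hg hG (by omega) (fun s hs => ?_) Q.card hs hS Q hQ rfl
    · have h1 : ((Q.card.descFactorial (d - 2) : ℕ) : ℝ) ≤ ((Q.card : ℝ) + 1) ^ (d - 2) := by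
        have : ((Q.card.descFactorial (d - 2) : ℕ) : ℝ) ≤ (Q.card : ℝ) ^ (d - 2) := by
          exact_mod_cast Nat.descFactorial_le_pow _ _
        exact this.trans (by gcongr; linarith)
      have h5 : ((j : ℝ) + 1) ≤ d := by exact_mod_cast hj
      have h6 : ((Q.card : ℝ) + 1) ^ (d - 1) = ((Q.card : ℝ) + 1) ^ (d - 2) * (Q.card + 1) := by
        rw [← pow_succ]; congr 1; omega
      have h7 : ∑ t ∈ Finset.Icc 1 Q.card, (2 : ℝ) ^ d = Q.card * 2 ^ d := by simp
      rw [h7] at h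
      have h8 : (1 : ℝ) ≤ Q.card + 1 := by
        have : (0 : ℝ) ≤ Q.card := by positivity
        linarith
      calc _ ≤ _ := h
        _ ≤ ((Q.card : ℝ) + 1) ^ (d - 2) * (D * (Q.card + 1) + d * G * ((Q.card + 1) * 2 ^ d)) := by
          gcongr
          · nlinarith
          · linarith
        _ = _ := by rw [h6]; ring
    · have h1 := half_pow_le_descFactorial hs (i := d - 2) (by omega)
      have h2 : (s : ℝ) + 1 ≤ 2 * ((s - (d - 2) : ℕ) : ℝ) := by
        exact_mod_cast (by omega : s + 1 ≤ 2 * (s - (d - 2)))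
      have h3 : (2 : ℝ) ^ d = 4 * 2 ^ (d - 2) := by
        rw [show (4 : ℝ) = 2 ^ 2 by norm_num, ← pow_add]; congr 1; omega
      have h6 : ((s : ℝ) + 1) ^ (d - 1) = ((s : ℝ) + 1) ^ (d - 2) * (s + 1) := by
        rw [← pow_succ]; congr 1; omega
      rw [h3, h6]
      have h9 : 0 ≤ (2 ^ (d - 2) * (s.descFactorial (d - 2) : ℝ)) *
          (2 * ((s - (d - 2) : ℕ) : ℝ)) := by
        positivity
      calc _ ≤ (2 ^ (d - 2) * (s.descFactorial (d - 2) : ℝ)) * (2 * ((s - (d - 2) : ℕ) : ℝ)) := by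
            gcongr
        _ ≤ 2 * ((2 ^ (d - 2) * (s.descFactorial (d - 2) : ℝ)) *
            (2 * ((s - (d - 2) : ℕ) : ℝ))) := by linarith
        _ = _ := by ring
  · have := hf Q hQ (by omega)
    nlinarith

end Recursion

/-- The constant lost in one step of the zone recursion. -/
def zoneStep (d b : ℕ) : ℝ := 2 * d * (8 ^ (b + 2 * d) + d * 2 ^ d)

lemma one_le_zoneStep {d b : ℕ} (hd : 1 ≤ d) : 1 ≤ zoneStep d b := by
  have h1 : (1 : ℝ) ≤ d := by exact_mod_cast hd
  have h2 : (1 : ℝ) ≤ 8 ^ (b + 2 * d) := one_le_pow₀ (by norm_num)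
  have h3 : (0 : ℝ) ≤ d * 2 ^ d := by positivity
  unfold zoneStep
  nlinarith

/-- The zone of a convex body has few vertices. -/
lemma card_Zs_zero_le {d : ℕ} {ι : Type*} [Fintype ι] {y : ι → EuclideanSpace ℝ (Fin d) × ℝ}
    {φ : EuclideanSpace ℝ (Fin d)} {B : Finset ι} {X : Finset (EuclideanSpace ℝ (Fin d))}
    (hd : 3 ≤ d) (hy : GP y φ) {K : Set (EuclideanSpace ℝ (Fin d))}
    (hK : Convex ℝ K) (hKc : IsCompact K)
    (hB : Bornology.IsBounded {x | ∀ h ∈ B, 0 ≤ ev (y h) x})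
    (hXB : ∀ q ∈ X, ∀ h ∈ B, 0 < ev (y h) q)
    (hX0 : ∀ q ∈ X, ∀ h, ev (y h) q ≠ 0) (hXK : ∀ q ∈ X, q ∈ K)
    (hXi : ∀ q ∈ X, q ∉ interior K) {S : ℕ} {Q : Finset ι} (hQB : Disjoint Q B)
    (hQS : Q.card ≤ S) :
    ((Zs y X (B ∪ Q) d 0).card : ℝ) ≤ (zoneStep d B.card ^ (d + 2) * (3 * 2 ^ (d - 1) *
      (B.card + 1) ^ (d - 1))) * (1 + Real.log S) ^ 2 * (Q.card + 1) ^ (d - 1) := by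
  set M := zoneStep d B.card with hM
  have hM1 : 1 ≤ M := one_le_zoneStep (by omega)
  set l := 1 + Real.log S with hl
  have hl1 : 1 ≤ l := by have := Real.log_natCast_nonneg S; linarith
  set G0 : ℝ := 3 * 2 ^ (d - 1) * (B.card + 1) ^ (d - 1) with hG0
  have hG01 : 1 ≤ G0 := by
    have h2 : (1 : ℝ) ≤ 2 ^ (d - 1) := one_le_pow₀ (by norm_num)
    have h3 : (1 : ℝ) ≤ ((B.card : ℝ) + 1) ^ (d - 1) :=
      one_le_pow₀ (by have : (0 : ℝ) ≤ B.card := by positivity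
                      linarith)
    rw [hG0]; nlinarith [mul_nonneg (sub_nonneg.2 h2) (sub_nonneg.2 h3)]
  have hd1 : (1 : ℝ) ≤ d := by exact_mod_cast (by omega : 1 ≤ d)
  let ZB : ℕ → ℕ → ℝ → Prop := fun i j G => ∀ Q : Finset ι, Disjoint Q B → Q.card ≤ S →
    ((Zs y X (B ∪ Q) i j).card : ℝ) ≤ G * (Q.card + 1) ^ (d - 1)
  have hmono : ∀ {i j G G'}, G ≤ G' → ZB i j G → ZB i j G' := by
    intro i j G G' hG h Q hQ hS
    refine (h Q hQ hS).trans ?_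
    gcongr
  have htriv : ∀ i j, ∀ Q, Disjoint Q B → Q.card ≤ 2 * d →
      ((Zs y X (B ∪ Q) i j).card : ℝ) ≤ 8 ^ (B.card + 2 * d) := by
    intro i j Q hQ hc
    have h1 : (Zs y X (B ∪ Q) i j).card ≤ 8 ^ (B.card + 2 * d) :=
      card_Zs_le.trans (Nat.pow_le_pow_right (by norm_num)
        ((Finset.card_union_le _ _).trans (by omega)))
    exact_mod_cast h1
  have htop : ZB d d G0 := by
    intro Q hQ _
    have h1 := (card_Zs_top hy (X := X) (R := B ∪ Q)).trans (card_cells_le hy hK hKc hB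
      Finset.subset_union_left hXB (fun q hq h _ => hX0 q hq h) hXK hXi)
    have h2 : (B ∪ Q).card + 1 ≤ (B.card + 1) * (Q.card + 1) := by
      have := Finset.card_union_le B Q
      nlinarith
    have h3 : (Zs y X (B ∪ Q) d d).card ≤
        3 * 2 ^ (d - 1) * ((B.card + 1) * (Q.card + 1)) ^ (d - 1) :=
      h1.trans (by gcongr)
    rw [mul_pow, ← mul_assoc] at h3
    rw [hG0]
    exact_mod_cast h3
  have hstep_log : ∀ {j G}, 1 ≤ G → j < d → ZB d (j + 1) G → ZB (d - 1) j (M / 2 * G * l) := by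
    intro j G hG hj h
    have h1 := recursion_log (d := d) (S := S) (B := B) (D := 8 ^ (B.card + 2 * d)) (G := G)
      (f := fun Q => (Zs y X (B ∪ Q) (d - 1) j).card)
      (g := fun Q => (Zs y X (B ∪ Q) d (j + 1)).card) (j := j) (fun Q hQ => by
        have := Zs_recursion (y := y) (X := X) (i := d - 1) (j := j) hQ
        rwa [Nat.sub_add_cancel (by omega : 1 ≤ d)] at this) (htriv _ _) h (by positivity)
        (by linarith) (by omega) hj
    refine hmono ?_ h1
    have e1 : (8 : ℝ) ^ (B.card + 2 * d) ≤ 8 ^ (B.card + 2 * d) * (G * l) :=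
      le_mul_of_one_le_right (by positivity) (by nlinarith)
    have e2 : (0 : ℝ) ≤ (8 ^ (B.card + 2 * d) + d * 2 ^ d) * (G * l) := by positivity
    rw [hM, zoneStep]
    nlinarith
  have hstep_nolog : ∀ {j G}, 1 ≤ G → j < d → ZB (d - 1) (j + 1) G →
      ZB (d - 2) j (M / (2 * d) * G) := by
    intro j G hG hj h
    have h1 := recursion_nolog (d := d) (S := S) (B := B) (D := 8 ^ (B.card + 2 * d)) (G := G)
      (f := fun Q => (Zs y X (B ∪ Q) (d - 2) j).card)
      (g := fun Q => (Zs y X (B ∪ Q) (d - 1) (j + 1)).card) (j := j) (fun Q hQ => by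
        have := Zs_recursion (y := y) (X := X) (i := d - 2) (j := j) hQ
        rwa [show d - 2 + 1 = d - 1 by omega] at this) (htriv _ _) h (by positivity)
        (by linarith) (by omega) hj
    refine hmono ?_ h1
    have e1 : (8 : ℝ) ^ (B.card + 2 * d) ≤ 8 ^ (B.card + 2 * d) * G :=
      le_mul_of_one_le_right (by positivity) hG
    have e3 : M / (2 * d) = 8 ^ (B.card + 2 * d) + d * 2 ^ d := by
      rw [hM, zoneStep]; field_simp
    rw [e3]
    linarith
  have hvert : ∀ {e j G}, j + (2 * e - 1) ≤ d → ZB (d - e) j G → ZB d j (2 * G) := by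
    intro e j G he h Q hQ hS
    have h1 := card_Zs_vertex_le hy e he (X := X) (R := B ∪ Q)
    have h2 : ((Zs y X (B ∪ Q) d j).card : ℝ) ≤ 2 * (Zs y X (B ∪ Q) (d - e) j).card := by
      exact_mod_cast h1
    have := h Q hQ hS
    nlinarith
  have hedge : ∀ {j G}, ZB d j G → ZB (d - 1) j (d * G) := by
    intro j G h Q hQ hS
    have h1 := card_Zs_edge_le hy (by omega) hB (R := B ∪ Q) (X := X)
      Finset.subset_union_left hXB (j := j)
    have h2 : ((Zs y X (B ∪ Q) (d - 1) j).card : ℝ) ≤ d * (Zs y X (B ∪ Q) d j).card := by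
      exact_mod_cast h1
    have := mul_le_mul_of_nonneg_left (h Q hQ hS) (by linarith : (0 : ℝ) ≤ d)
    rw [← mul_assoc] at this
    exact h2.trans this
  have a1 : ZB (d - 1) (d - 1) (M / 2 * G0 * l) :=
    hstep_log hG01 (by omega) (by rwa [Nat.sub_add_cancel (by omega : 1 ≤ d)])
  have a2 : ZB d (d - 1) (M * G0 * l) :=
    hmono (by linarith) (hvert (e := 1) (by omega) a1)
  have a3 : ZB (d - 1) (d - 2) (M ^ 2 * G0 * l ^ 2) := by
    have hG : 1 ≤ M * G0 * l := by nlinarith [mul_nonneg (sub_nonneg.2 hM1) (sub_nonneg.2 hG01)]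
    refine hmono ?_ (hstep_log hG (j := d - 2) (by omega)
      (by rwa [show d - 2 + 1 = d - 1 by omega]))
    have : 0 ≤ M * G0 * l * M * l := by positivity
    nlinarith
  have hbase1 : ∀ n, 1 ≤ M ^ n * G0 * l ^ 2 := by
    intro n
    have e1 := one_le_pow₀ hM1 (n := n)
    have e2 := one_le_pow₀ hl1 (n := 2)
    nlinarith [mul_nonneg (sub_nonneg.2 e1) (sub_nonneg.2 hG01)]
  have a4 : ∀ n, n + 2 ≤ d → ZB (d - 1) (d - 2 - n) (M ^ (n + 2) * G0 * l ^ 2) ∧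
      (1 ≤ n → ZB d (d - 2 - n) (M ^ (n + 2) * G0 * l ^ 2)) := by
    intro n
    induction n with
    | zero => exact fun _ => ⟨a3, by simp⟩
    | succ n ih =>
      intro hn
      obtain ⟨ih, -⟩ := ih (by omega)
      have b1 := hstep_nolog (hbase1 (n + 2)) (j := d - 2 - (n + 1)) (by omega)
        (by rwa [show d - 2 - (n + 1) + 1 = d - 2 - n by omega])
      have b2 := hvert (e := 2) (by omega) b1
      have b3 := hedge b2
      have hpos : 0 ≤ M ^ (n + 2) * G0 * l ^ 2 := by positivity
      have e : (d : ℝ) * (2 * (M / (2 * d) * (M ^ (n + 2) * G0 * l ^ 2))) =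
          M ^ (n + 1 + 2) * G0 * l ^ 2 := by
        field_simp
        ring
      refine ⟨hmono e.le b3, fun _ => hmono ?_ b2⟩
      rw [← e]
      refine le_mul_of_one_le_left ?_ hd1
      positivity
  have a5 := (a4 (d - 2) (by omega)).2 (by omega)
  rw [Nat.sub_self, Nat.sub_add_cancel (by omega : 2 ≤ d)] at a5
  refine (a5 Q hQB hQS).trans ?_
  have : M ^ d ≤ M ^ (d + 2) := pow_le_pow_right₀ hM1 (by omega)
  gcongr

/-- `v` is a vertex of the arrangement `y`. -/
def IsVtx {d : ℕ} {ι : Type*} (y : ι → EuclideanSpace ℝ (Fin d) × ℝ)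
    (v : EuclideanSpace ℝ (Fin d)) : Prop :=
  ∃ A : Finset ι, A.card = d ∧ ∀ h ∈ A, ev (y h) v = 0

/-- `x` lies on no flat spanned by at most `m` vertices of the arrangement. -/
def GenPt {d : ℕ} {ι : Type*} (y : ι → EuclideanSpace ℝ (Fin d) × ℝ) (m : ℕ)
    (x : EuclideanSpace ℝ (Fin d)) : Prop :=
  ∀ S : Finset (EuclideanSpace ℝ (Fin d)), S.card ≤ m → (∀ v ∈ S, IsVtx y v) →
    x ∉ affineSpan ℝ (S : Set (EuclideanSpace ℝ (Fin d)))

/-- `x` lies in the simplex with vertex list `V` of the bottom-vertex triangulation of the face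
`poly y R q I`, the facets chosen successively being `l`. -/
inductive Chain {d : ℕ} {ι : Type*} (y : ι → EuclideanSpace ℝ (Fin d) × ℝ)
    (φ : EuclideanSpace ℝ (Fin d)) (R : Finset ι) (q : EuclideanSpace ℝ (Fin d)) :
    Finset ι → List ι → List (EuclideanSpace ℝ (Fin d)) → EuclideanSpace ℝ (Fin d) → Prop
  | nil {I b} (hb : IsBot y φ R q I b) : Chain y φ R q I [] [b] b
  | cons {I h l V b z x} (t : ℝ) (hR : h ∈ R) (hI : h ∉ I) (hb : IsBot y φ R q I b)
      (ht0 : 0 ≤ t) (ht1 : t ≤ 1) (hx : x = (1 - t) • b + t • z)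
      (hz : Chain y φ R q (insert h I) l V z) : Chain y φ R q I (h :: l) (b :: V) x

section Triangulation

variable {d : ℕ} {ι : Type*} {y : ι → EuclideanSpace ℝ (Fin d) × ℝ}
  {φ : EuclideanSpace ℝ (Fin d)} {B R I : Finset ι} {q x : EuclideanSpace ℝ (Fin d)}
  {l : List ι} {V : List (EuclideanSpace ℝ (Fin d))}

lemma Chain.mem_poly (h : Chain y φ R q I l V x) : x ∈ poly y R q I := by
  induction h with
  | nil hb => exact hb.1
  | cons t hR hI hb ht0 ht1 hx _ ih =>
    rw [hx]
    exact convex_poly hb.1 (poly_mono subset_rfl (Finset.subset_insert _ _) ih)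
      (by linarith) ht0 (by ring)

lemma Chain.length (h : Chain y φ R q I l V x) : V.length = l.length + 1 := by
  induction h with
  | nil hb => rfl
  | cons t hR hI hb ht0 ht1 hx _ ih => simp [ih]

lemma Chain.vertex_mem_poly (h : Chain y φ R q I l V x) : ∀ v ∈ V, v ∈ poly y R q I := by
  induction h with
  | nil hb => intro v hv; rw [List.mem_singleton.1 hv]; exact hb.1
  | cons t hR hI hb ht0 ht1 hx _ ih =>
    intro v hv
    rcases List.mem_cons.1 hv with rfl | hv
    · exact hb.1
    · exact poly_mono subset_rfl (Finset.subset_insert _ _) (ih v hv)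

lemma IsBot.isVtx [Fintype ι] {b : EuclideanSpace ℝ (Fin d)} (hy : GP y φ) (hIR : I ⊆ R)
    (hb : IsBot y φ R q I b) : IsVtx y b :=
  ⟨_, hb.card_act hy hIR, fun _ hh => (mem_act.1 hh).2⟩

lemma Chain.vertex_act [Fintype ι] (hy : GP y φ) (h : Chain y φ R q I l V x) (hIR : I ⊆ R) :
    ∀ v ∈ V, (act y R v).card = d := by
  induction h with
  | nil hb => intro v hv; rw [List.mem_singleton.1 hv]; exact hb.card_act hy hIR
  | cons t hR hI hb ht0 ht1 hx _ ih =>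
    intro v hv
    rcases List.mem_cons.1 hv with rfl | hv
    · exact hb.card_act hy hIR
    · exact ih (Finset.insert_subset hR hIR) v hv

lemma Chain.vertex_isVtx [Fintype ι] (hy : GP y φ) (h : Chain y φ R q I l V x) (hIR : I ⊆ R) :
    ∀ v ∈ V, IsVtx y v := fun v hv =>
  ⟨_, h.vertex_act hy hIR v hv, fun _ hh => (mem_act.1 hh).2⟩

lemma Chain.mem_hull (h : Chain y φ R q I l V x) :
    x ∈ convexHull ℝ (V.toFinset : Set (EuclideanSpace ℝ (Fin d))) := by
  induction h with
  | nil hb => simp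
  | cons t hR hI hb ht0 ht1 hx _ ih =>
    rw [hx]
    refine convex_convexHull ℝ _ (subset_convexHull ℝ _ (by simp)) (convexHull_mono ?_ ih)
      (by linarith) ht0 (by ring)
    intro v hv; simp at hv ⊢; exact Or.inr hv

/-- Generic points determine generic points on the opposite facet. -/
lemma GenPt.of_combo {m : ℕ} {b z : EuclideanSpace ℝ (Fin d)} {t : ℝ}
    (h : GenPt y (m + 1) x) (hb : IsVtx y b) (hx : x = (1 - t) • b + t • z) : GenPt y m z := by
  intro S hS hSv hz
  refine h (insert b S) ((Finset.card_insert_le _ _).trans (by omega)) ?_ ?_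
  · intro v hv
    rcases Finset.mem_insert.1 hv with rfl | hv
    · exact hb
    · exact hSv v hv
  · have h1 : b ∈ affineSpan ℝ ((insert b S : Finset _) : Set (EuclideanSpace ℝ (Fin d))) :=
      subset_affineSpan ℝ _ (by simp)
    have h2 : z ∈ affineSpan ℝ ((insert b S : Finset _) : Set (EuclideanSpace ℝ (Fin d))) :=
      affineSpan_mono ℝ (by simp) hz
    have := AffineMap.lineMap_mem t h1 h2
    rwa [AffineMap.lineMap_apply_module, ← hx] at this

lemma Chain.not_genPt_of_combo [Fintype ι] (hy : GP y φ) {z b : EuclideanSpace ℝ (Fin d)} {t : ℝ}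
    (h : Chain y φ R q I l V z) (hIR : I ⊆ R) (hb : b ∈ V) (hx : x = (1 - t) • b + t • z) :
    ¬ GenPt y (l.length + 1) x := by
  intro hg
  refine hg V.toFinset ((List.toFinset_card_le _).trans h.length.le)
    (fun v hv => h.vertex_isVtx hy hIR v (List.mem_toFinset.1 hv)) ?_
  have h1 : b ∈ affineSpan ℝ (V.toFinset : Set (EuclideanSpace ℝ (Fin d))) :=
    subset_affineSpan ℝ _ (by simpa using hb)
  have h2 := convexHull_subset_affineSpan _ h.mem_hull
  have := AffineMap.lineMap_mem t h1 h2
  rwa [AffineMap.lineMap_apply_module, ← hx] at this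

lemma Chain.bot_mem [Fintype ι] (hy : GP y φ) (hq : ∀ h ∈ R, ev (y h) q ≠ 0)
    (h : Chain y φ R q I l V x) (hIR : I ⊆ R) {b : EuclideanSpace ℝ (Fin d)}
    (hb : IsBot y φ R q I b) : b ∈ V := by
  cases h with
  | nil hb' => rw [hb.unique hy hIR hq hb']; simp
  | cons t hR hI hb' ht0 ht1 hx _ => rw [hb.unique hy hIR hq hb']; simp

/-- The bottom vertex of a face is off every facet opposite to it. -/
lemma Chain.bot_ne_zero [Fintype ι] (hy : GP y φ) (hq : ∀ h ∈ R, ev (y h) q ≠ 0)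
    {h : ι} {z b : EuclideanSpace ℝ (Fin d)} {t : ℝ} (hz : Chain y φ R q (insert h I) l V z)
    (hIR : I ⊆ R) (hR : h ∈ R) (hb : IsBot y φ R q I b) (hx : x = (1 - t) • b + t • z)
    (hg : GenPt y (l.length + 1) x) : ev (y h) b ≠ 0 := by
  intro h0
  have hb' : IsBot y φ R q (insert h I) b := by
    refine ⟨⟨hb.1.1, fun g hg => ?_⟩, fun w hw => hb.2 w
      (poly_mono subset_rfl (Finset.subset_insert _ _) hw)⟩
    rcases Finset.mem_insert.1 hg with rfl | hg
    · exact h0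
    · exact hb.1.2 g hg
  exact hz.not_genPt_of_combo hy (Finset.insert_subset hR hIR)
    (hz.bot_mem hy hq (Finset.insert_subset hR hIR) hb') hx hg

lemma Chain.ne_zero [Fintype ι] (hy : GP y φ) (hq : ∀ h ∈ R, ev (y h) q ≠ 0)
    (h : Chain y φ R q I l V x) (hIR : I ⊆ R) (hc : I.card + l.length = d)
    (hg : GenPt y l.length x) : ∀ g ∈ R, g ∉ I → ev (y g) x ≠ 0 := by
  induction h with
  | nil hb =>
    rename_i I b
    intro g hgR hgI h0
    have := hy.card_le (A := insert g I) (x := b) fun i hi => by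
      rcases Finset.mem_insert.1 hi with rfl | hi
      · exact h0
      · exact hb.1.2 i hi
    rw [Finset.card_insert_of_notMem hgI] at this
    simp at hc; omega
  | cons t hR hI hb ht0 ht1 hx hz ih =>
    rename_i I h l V b z x
    intro g hgR hgI
    have hIR' := Finset.insert_subset hR hIR
    simp only [List.length_cons] at hc hg
    have hzg := hg.of_combo (hb.isVtx hy hIR) hx
    have ih := ih hIR' (by rw [Finset.card_insert_of_notMem hI]; omega) hzg
    by_cases hgh : g = h
    · subst hgh
      rw [hx, ev_combo _ _ _ (by ring), hz.mem_poly.2 g (by simp), mul_zero, add_zero]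
      refine mul_ne_zero (fun h1 => ?_) (hz.bot_ne_zero hy hq hIR hR hb hx hg)
      have hzx : x = z := by rw [hx, h1, show t = 1 by linarith]; simp
      obtain ⟨v, hv⟩ : ∃ v, v ∈ V := by
        have := hz.length
        exact List.exists_mem_of_length_pos (by omega)
      exact hz.not_genPt_of_combo hy hIR' (t := 1) hv (by rw [hzx]; simp) hg
    · have h1 := ih g hgR (by simp [hgh, hgI])
      have hz1 : 0 < ev (y g) q * ev (y g) z :=
        lt_of_le_of_ne (hz.mem_poly.1 g hgR) (mul_ne_zero (hq g hgR) h1).symm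
      have ht : t ≠ 0 := by
        rintro rfl
        refine hg {b} (by simp) (by simpa using hb.isVtx hy hIR) ?_
        rw [hx]; simp
      have ht : 0 < t := lt_of_le_of_ne ht0 ht.symm
      have hb1 := hb.1.1 g hgR
      intro h0
      rw [hx, ev_combo _ _ _ (by ring)] at h0
      have : (1 - t) * (ev (y g) q * ev (y g) b) + t * (ev (y g) q * ev (y g) z) = 0 := by
        linear_combination ev (y g) q * h0
      have := mul_pos ht hz1
      have := mul_nonneg (sub_nonneg.2 ht1) hb1
      linarith

lemma combo_solve {x b z : EuclideanSpace ℝ (Fin d)} {t : ℝ} (ht : t ≠ 0)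
    (hx : x = (1 - t) • b + t • z) : z = b + t⁻¹ • (x - b) := by
  rw [hx, show (1 - t) • b + t • z - b = t • (z - b) by rw [smul_sub, sub_smul, one_smul]; abel,
    smul_smul, inv_mul_cancel₀ ht, one_smul]; abel

lemma Chain.unique [Fintype ι] (hy : GP y φ) (hq : ∀ h ∈ R, ev (y h) q ≠ 0)
    {l' : List ι} {V' : List (EuclideanSpace ℝ (Fin d))}
    (h : Chain y φ R q I l V x) (h' : Chain y φ R q I l' V' x) (hIR : I ⊆ R)
    (hc : I.card + l.length = d) (hll : l.length = l'.length)
    (hg : GenPt y l.length x) : l = l' ∧ V = V' := by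
  induction h generalizing l' V' with
  | nil hb =>
    cases h' with
    | nil hb' => exact ⟨rfl, rfl⟩
    | cons => simp at hll
  | cons t hR hI hb ht0 ht1 hx hz ih =>
    rename_i I h l V b z x
    cases h' with
    | nil hb' => simp at hll
    | cons t' hR' hI' hb' ht0' ht1' hx' hz' =>
      rename_i h' l' V' b' z'
      obtain rfl := hb.unique hy hIR hq hb'
      simp only [List.length_cons] at hc hg hll
      have hl : l.length = l'.length := by omega
      have hIR1 := Finset.insert_subset hR hIR
      have hxb : x ≠ b := fun h0 => hg {b} (by simp) (by simpa using hb.isVtx hy hIR)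
        (by rw [h0]; simp)
      have htn : t ≠ 0 := by rintro rfl; exact hxb (by rw [hx]; simp)
      have htn' : t' ≠ 0 := by rintro rfl; exact hxb (by rw [hx']; simp)
      have htp : 0 < t⁻¹ := inv_pos.2 (lt_of_le_of_ne ht0 htn.symm)
      have htp' : 0 < t'⁻¹ := inv_pos.2 (lt_of_le_of_ne ht0' htn'.symm)
      have hzb := combo_solve htn hx
      have hzb' := combo_solve htn' hx'
      have hbn := hz.bot_ne_zero hy hq hIR hR hb hx hg
      have hbn' := hz'.bot_ne_zero hy hq hIR hR' hb hx' (hl ▸ hg)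
      -- travelling from the bottom vertex, no facet is met strictly before another one
      have key : ∀ (g : ι) (s s' : ℝ), g ∈ R → ev (y g) b ≠ 0 → 0 < s →
          ev (y g) (b + s • (x - b)) = 0 → b + s' • (x - b) ∈ poly y R q I → s' ≤ s := by
        intro g s s' hgR hgb hs h0 hp
        rw [ev_add_smul] at h0
        have h1 := hp.1 g hgR
        rw [ev_add_smul] at h1
        have h2 : 0 < ev (y g) q * ev (y g) b :=
          lt_of_le_of_ne (hb.1.1 g hgR) (mul_ne_zero (hq g hgR) hgb).symm
        by_contra! hlt
        have h3 : s * (ev (y g) q * (ev (y g) b + s' * ⟪(y g).1, x - b⟫)) =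
            (s - s') * (ev (y g) q * ev (y g) b) := by
          linear_combination s' * ev (y g) q * h0
        have h4 := mul_nonneg hs.le h1
        rw [h3] at h4
        nlinarith
      have hzp := poly_mono subset_rfl (Finset.subset_insert _ _) hz.mem_poly
      have hzp' := poly_mono subset_rfl (Finset.subset_insert _ _) hz'.mem_poly
      have hss : t⁻¹ = t'⁻¹ := by
        refine le_antisymm (key h' _ _ hR' hbn' htp' ?_ (hzb ▸ hzp))
          (key h _ _ hR hbn htp ?_ (hzb' ▸ hzp'))
        · rw [← hzb']; exact hz'.mem_poly.2 h' (by simp)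
        · rw [← hzb]; exact hz.mem_poly.2 h (by simp)
      have hzz : z = z' := by rw [hzb, hzb', hss]
      subst hzz
      have hzg := hg.of_combo (hb.isVtx hy hIR) hx
      have hcard : (insert h I).card + l.length = d := by
        rw [Finset.card_insert_of_notMem hI]; omega
      have hhh : h' = h := by
        by_contra hne
        exact hz.ne_zero hy hq hIR1 hcard hzg h' hR' (by simp [hne, hI'])
          (hz'.mem_poly.2 h' (by simp))
      subst hhh
      obtain ⟨rfl, rfl⟩ := ih hz' hIR1 hcard hl hzg
      exact ⟨rfl, rfl⟩

lemma Chain.exists [Fintype ι] (hy : GP y φ) (hbd : Bornology.IsBounded (poly y R q ∅))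
    (m : ℕ) (hIR : I ⊆ R) (hc : I.card + m = d)
    (hx : x ∈ poly y R q I) (hg : GenPt y m x) :
    ∃ l V, Chain y φ R q I l V x ∧ l.length = m := by
  induction m generalizing I x with
  | zero =>
    refine ⟨[], [x], Chain.nil ⟨hx, fun w hw => ?_⟩, rfl⟩
    rw [hy.eq_of_ev_eq (A := I) (x := x) (x' := w) (by omega) fun i hi => by
      rw [hx.2 i hi, hw.2 i hi]]
  | succ m ih =>
    obtain ⟨b, hb⟩ := exists_isBot (φ := φ) (hbd.subset (poly_mono (subset_refl R)
      (Finset.empty_subset I))) ⟨x, hx⟩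
    have hxb : x - b ≠ 0 := fun h0 => hg {b} (by simp) (by simpa using hb.isVtx hy hIR)
      (by rw [sub_eq_zero.1 h0]; simp)
    obtain ⟨t, ht0, htp, ⟨g, hgR, hgn, hg0⟩, -⟩ := ray_exit hbd
      (poly_mono (subset_refl R) (Finset.empty_subset I) hx) hxb
    have hu : ∀ i ∈ I, ⟪(y i).1, x - b⟫ = 0 := fun i hi => by
      rw [← ev_sub, hx.2 i hi, hb.1.2 i hi, sub_zero]
    have hgI : g ∉ I := fun hgI => by rw [hu g hgI, mul_zero] at hgn; exact lt_irrefl _ hgn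
    have hzp : x + t • (x - b) ∈ poly y R q (insert g I) := by
      refine ⟨htp.1, fun i hi => ?_⟩
      rcases Finset.mem_insert.1 hi with rfl | hi
      · exact hg0
      · rw [ev_add_smul, hu i hi, hx.2 i hi]; simp
    have ht1 : 0 < 1 + t := by linarith
    have hxe : x = (1 - (1 + t)⁻¹) • b + (1 + t)⁻¹ • (x + t • (x - b)) := by
      rw [show x + t • (x - b) = (1 + t) • x - t • b by rw [smul_sub, add_smul, one_smul]; abel,
        smul_sub, smul_smul, smul_smul, inv_mul_cancel₀ ht1.ne', one_smul,
        show (1 - (1 + t)⁻¹) = (1 + t)⁻¹ * t by field_simp; ring]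
      abel
    obtain ⟨l, V, hl, hlen⟩ := ih (Finset.insert_subset hgR hIR)
      (by rw [Finset.card_insert_of_notMem hgI]; omega) hzp
      (hg.of_combo (hb.isVtx hy hIR) hxe)
    exact ⟨g :: l, b :: V, Chain.cons _ hgR hgI hb (inv_nonneg.2 ht1.le)
      (inv_le_one_of_one_le₀ (by linarith)) hxe hl, by simp [hlen]⟩

/-- Deleting from the sample a functional that passes through no vertex of the simplex does not
change the simplex. -/
lemma Chain.of_insert {h : ι} (hh : Chain y φ (insert h R) q I l V x)
    (hI : h ∉ I) (hV : ∀ v ∈ V, ev (y h) v ≠ 0) :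
    Chain y φ R q I l V x := by
  induction hh with
  | nil hb => exact Chain.nil (hb.of_insert (hV _ (by simp)))
  | cons t hR hI' hb ht0 ht1 hx hz ih =>
    rename_i I g l V b z x
    have hgh : g ≠ h := by
      rintro rfl
      obtain ⟨v, hv⟩ : ∃ v, v ∈ V := by
        have := hz.length
        exact List.exists_mem_of_length_pos (by omega)
      exact hV v (by simp [hv]) ((hz.vertex_mem_poly v hv).2 g (by simp))
    refine Chain.cons t ((Finset.mem_insert.1 hR).resolve_left hgh) hI'
      (hb.of_insert (hV _ (by simp))) ht0 ht1 hx (ih ?_ fun v hv => hV v (by simp [hv]))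
    simp [hI, hgh.symm]

lemma Chain.point (h : Chain y φ R q I l V x) :
    ∃ v, v ∈ poly y R q (I ∪ l.toFinset) := by
  induction h with
  | nil hb => exact ⟨_, by simpa using hb.1⟩
  | cons t hR hI hb ht0 ht1 hx hz ih =>
    obtain ⟨v, hv⟩ := ih
    refine ⟨v, ?_⟩
    rwa [List.toFinset_cons, Finset.union_insert, ← Finset.insert_union]

lemma Chain.nodup (h : Chain y φ R q I l V x) :
    l.Nodup ∧ (∀ g ∈ l, g ∉ I ∧ g ∈ R) := by
  induction h with
  | nil hb => simp
  | cons t hR hI hb ht0 ht1 hx hz ih =>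
    refine ⟨List.nodup_cons.2 ⟨fun hm => ?_, ih.1⟩, fun g hg => ?_⟩
    · exact (ih.2 _ hm).1 (by simp)
    · rcases List.mem_cons.1 hg with rfl | hg
      · exact ⟨hI, hR⟩
      · exact ⟨fun h' => (ih.2 g hg).1 (by simp [h']), (ih.2 g hg).2⟩

end Triangulation

/-- The vertices of the canonical simplex of the arrangement `R` around `q`. -/
def vlist {d : ℕ} {ι : Type*} (y : ι → EuclideanSpace ℝ (Fin d) × ℝ)
    (φ : EuclideanSpace ℝ (Fin d)) (R : Finset ι) (q : EuclideanSpace ℝ (Fin d)) :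
    List (EuclideanSpace ℝ (Fin d)) :=
  if h : ∃ V l, Chain y φ R q ∅ l V q ∧ l.length = d then h.choose else []

/-- The functional `h` separates `q` from a vertex of its canonical simplex. -/
def Crs {d : ℕ} {ι : Type*} (y : ι → EuclideanSpace ℝ (Fin d) × ℝ)
    (φ : EuclideanSpace ℝ (Fin d)) (R : Finset ι) (q : EuclideanSpace ℝ (Fin d)) (h : ι) : Prop :=
  ∃ v ∈ vlist y φ R q, ev (y h) q * ev (y h) v < 0

/-- The point `q` is generic for the arrangement `y` and lies inside the box `B`. -/
structure Good {d : ℕ} {ι : Type*} (y : ι → EuclideanSpace ℝ (Fin d) × ℝ) (B : Finset ι)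
    (q : EuclideanSpace ℝ (Fin d)) : Prop where
  pos : ∀ h ∈ B, 0 < ev (y h) q
  ne : ∀ h, ev (y h) q ≠ 0
  gen : GenPt y d q

section Simplex

variable {d : ℕ} {ι : Type*} {y : ι → EuclideanSpace ℝ (Fin d) × ℝ}
  {φ : EuclideanSpace ℝ (Fin d)} {B R : Finset ι} {q x : EuclideanSpace ℝ (Fin d)}

lemma vlist_spec [Fintype ι] (hy : GP y φ)
    (hB : Bornology.IsBounded {x | ∀ h ∈ B, 0 ≤ ev (y h) x}) (hBR : B ⊆ R) (hq : Good y B q) :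
    ∃ l, Chain y φ R q ∅ l (vlist y φ R q) q ∧ l.length = d := by
  have h : ∃ V l, Chain y φ R q ∅ l V q ∧ l.length = d := by
    obtain ⟨l, V, h⟩ := Chain.exists hy (isBounded_poly hB hBR hq.pos) d (I := ∅)
      (Finset.empty_subset _) (by simp) (x := q)
      ⟨fun h _ => mul_self_nonneg _, by simp⟩ hq.gen
    exact ⟨V, l, h⟩
  rw [vlist, dif_pos h]
  exact h.choose_spec

lemma vlist_eq [Fintype ι] (hy : GP y φ)
    (hB : Bornology.IsBounded {x | ∀ h ∈ B, 0 ≤ ev (y h) x}) (hBR : B ⊆ R) (hq : Good y B q)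
    {l : List ι} {V : List (EuclideanSpace ℝ (Fin d))} (h : Chain y φ R q ∅ l V q)
    (hl : l.length = d) : vlist y φ R q = V := by
  obtain ⟨l', h', hl'⟩ := vlist_spec hy hB hBR hq
  exact (h'.unique hy (fun h _ => hq.ne h) h (Finset.empty_subset _) (by simp [hl'])
    (hl'.trans hl.symm) (hl'.symm ▸ hq.gen)).2

lemma isOpenSimplex_of_mem_hull {x : EuclideanSpace ℝ (Fin d)}
    (S : Finset (EuclideanSpace ℝ (Fin d))) (hS : S.card ≤ d + 1)
    (hx : x ∈ convexHull ℝ (S : Set (EuclideanSpace ℝ (Fin d))))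
    (hg : ∀ T ⊆ S, T.card ≤ d → x ∉ affineSpan ℝ (T : Set (EuclideanSpace ℝ (Fin d)))) :
    IsOpenSimplex (interior (convexHull ℝ (S : Set (EuclideanSpace ℝ (Fin d))))) ∧
      x ∈ interior (convexHull ℝ (S : Set (EuclideanSpace ℝ (Fin d)))) := by
  have hxc := hx
  rw [convexHull_eq_union] at hx
  simp only [Set.mem_iUnion] at hx
  obtain ⟨T, hTS, hT, hxT⟩ := hx
  have hTS : T ⊆ S := by exact_mod_cast hTS
  have hTd : d < T.card := by
    by_contra! h
    exact hg T hTS h (convexHull_subset_affineSpan _ hxT)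
  obtain rfl := Finset.eq_of_subset_of_card_le hTS (by omega)
  have hcard : T.card = d + 1 := by omega
  have htop : affineSpan ℝ (Set.range ((↑) : T → EuclideanSpace ℝ (Fin d))) = ⊤ :=
    hT.affineSpan_eq_top_iff_card_eq_finrank_add_one.2 (by simp [hcard])
  have e : Fin (d + 1) ≃ T := (Finset.equivFinOfCardEq hcard).symm
  let b : AffineBasis T ℝ (EuclideanSpace ℝ (Fin d)) := ⟨(↑), hT, htop⟩
  have hr : Set.range b = (T : Set (EuclideanSpace ℝ (Fin d))) := by
    show Set.range ((↑) : T → EuclideanSpace ℝ (Fin d)) = _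
    simp
  refine ⟨⟨fun i => (e i : EuclideanSpace ℝ (Fin d)), hT.comp_embedding e.toEmbedding, ?_⟩, ?_⟩
  · congr 2
    ext v
    simp only [Set.mem_range, Finset.mem_coe]
    exact ⟨fun hv => ⟨e.symm ⟨v, hv⟩, by simp⟩, by rintro ⟨i, rfl⟩; exact (e i).2⟩
  · rw [← hr, b.interior_convexHull]
    intro i
    have h0 : ∀ i, 0 ≤ b.coord i x := by
      have := hxc
      rw [← hr, b.convexHull_eq_nonneg_coord] at this
      exact this
    refine lt_of_le_of_ne (h0 i) fun hi => ?_
    refine hg (T.erase i) (Finset.erase_subset _ _)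
      (by rw [Finset.card_erase_of_mem i.2, hcard]; simp) ?_
    have hsum := b.linear_combination_coord_eq_self x
    have hs1 := b.sum_coord_apply_eq_one x
    rw [← Finset.add_sum_erase _ _ (Finset.mem_univ i), ← hi, zero_smul, zero_add] at hsum
    rw [← Finset.add_sum_erase _ _ (Finset.mem_univ i), ← hi, zero_add] at hs1
    rw [← hsum, ← Finset.affineCombination_eq_linear_combination _ _ _ hs1]
    refine affineSpan_mono ℝ ?_ (affineCombination_mem_affineSpan_image hs1
      (s' := {j | j ≠ i}) ?_ _)
    · rintro _ ⟨j, hj, rfl⟩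
      simp only [Finset.coe_erase, Set.mem_sdiff, Finset.mem_coe, Set.mem_singleton_iff]
      exact ⟨j.2, fun h => hj (Subtype.ext h)⟩
    · intro j hj hj'
      simp at hj hj'; exact absurd hj' hj

lemma vlist_simplex [Fintype ι] (hy : GP y φ)
    (hB : Bornology.IsBounded {x | ∀ h ∈ B, 0 ≤ ev (y h) x}) (hBR : B ⊆ R) (hq : Good y B q) :
    IsOpenSimplex (interior (convexHull ℝ
      ((vlist y φ R q).toFinset : Set (EuclideanSpace ℝ (Fin d))))) ∧
      q ∈ interior (convexHull ℝ
        ((vlist y φ R q).toFinset : Set (EuclideanSpace ℝ (Fin d)))) := by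
  obtain ⟨l, h, hl⟩ := vlist_spec hy hB hBR hq
  refine isOpenSimplex_of_mem_hull _ ((List.toFinset_card_le _).trans ?_) h.mem_hull
    fun T hT hTd => hq.gen T hTd fun v hv =>
      h.vertex_isVtx hy (Finset.empty_subset _) v (List.mem_toFinset.1 (hT hv))
  rw [h.length, hl]

lemma crs_of_meets {h : ι} (hq : ev (y h) q ≠ 0)
    (hx : x ∈ interior (convexHull ℝ
        ((vlist y φ R q).toFinset : Set (EuclideanSpace ℝ (Fin d)))))
    (h0 : ev (y h) x = 0) : Crs y φ R q h := by
  by_contra hc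
  simp only [Crs, not_exists, not_and, not_lt] at hc
  have hsub : convexHull ℝ ((vlist y φ R q).toFinset : Set (EuclideanSpace ℝ (Fin d))) ⊆
      poly y {h} q ∅ :=
    convexHull_min (fun v hv => ⟨fun g hg => by
      rw [Finset.mem_singleton.1 hg]; exact hc v (by simpa using hv), by simp⟩) convex_poly
  have hcont : Filter.Tendsto (fun t : ℝ => x + t • (x - q)) (nhdsWithin 0 (Set.Ioi 0))
      (nhds x) := by
    have : Continuous fun t : ℝ => x + t • (x - q) := by fun_prop
    have := this.tendsto 0
    simp only [zero_smul, add_zero] at this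
    exact this.mono_left nhdsWithin_le_nhds
  obtain ⟨t, ht, ht0⟩ := ((hcont.eventually (isOpen_interior.mem_nhds hx)).and
    self_mem_nhdsWithin).exists
  have ht0 : 0 < t := ht0
  have h1 := (hsub (interior_subset ht)).1 h (by simp)
  rw [ev_add_smul, ← ev_sub, h0, zero_add, zero_sub] at h1
  have := mul_pos ht0 (mul_self_pos.2 hq)
  nlinarith

lemma not_crs_of_mem [Fintype ι] (hy : GP y φ)
    (hB : Bornology.IsBounded {x | ∀ h ∈ B, 0 ≤ ev (y h) x}) (hBR : B ⊆ R) (hq : Good y B q)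
    {h : ι} (hh : h ∈ R) : ¬ Crs y φ R q h := by
  rintro ⟨v, hv, hlt⟩
  obtain ⟨l, hc, -⟩ := vlist_spec hy hB hBR hq
  exact absurd ((hc.vertex_mem_poly v hv).1 h hh) (not_le.2 hlt)

/-- Few members of a sample cross the simplex obtained after deleting them. -/
lemma card_crs_erase_le [Fintype ι] (hy : GP y φ)
    (hB : Bornology.IsBounded {x | ∀ h ∈ B, 0 ≤ ev (y h) x}) (hBR : B ⊆ R) (hq : Good y B q) :
    ((R \ B).filter fun h => Crs y φ (R.erase h) q h).card ≤ (d + 1) * d := by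
  obtain ⟨l, hc, hl⟩ := vlist_spec hy hB hBR hq
  have hlen := hc.length
  have hsub : ((R \ B).filter fun h => Crs y φ (R.erase h) q h) ⊆
      (vlist y φ R q).toFinset.biUnion fun v => act y R v := by
    intro h hh
    obtain ⟨hRB, hcr⟩ := Finset.mem_filter.1 hh
    obtain ⟨hR, hnB⟩ := Finset.mem_sdiff.1 hRB
    by_contra hno
    simp only [Finset.mem_biUnion, List.mem_toFinset, mem_act, not_exists, not_and] at hno
    have hc' : Chain y φ (insert h (R.erase h)) q ∅ l (vlist y φ R q) q := by
      rwa [Finset.insert_erase hR]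
    have h1 := hc'.of_insert (by simp) fun v hv => hno v hv hR
    have hBe : B ⊆ R.erase h := fun g hg =>
      Finset.mem_erase.2 ⟨fun e => hnB (e ▸ hg), hBR hg⟩
    rw [Crs, vlist_eq hy hB hBe hq h1 hl] at hcr
    exact not_crs_of_mem hy hB hBR hq hR hcr
  refine (Finset.card_le_card hsub).trans (Finset.card_biUnion_le.trans ?_)
  rw [Finset.sum_congr rfl fun v hv => hc.vertex_act hy (Finset.empty_subset _) v
    (List.mem_toFinset.1 hv), Finset.sum_const, smul_eq_mul]
  gcongr
  exact (List.toFinset_card_le _).trans (by omega)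

lemma poly_congr {q' : EuclideanSpace ℝ (Fin d)} {I : Finset ι} (hq : ∀ h ∈ R, ev (y h) q ≠ 0)
    (hq' : ∀ h ∈ R, ev (y h) q' ≠ 0) (h : sg y R q = sg y R q') : poly y R q I = poly y R q' I := by
  have key : ∀ h ∈ R, ∀ x, 0 ≤ ev (y h) q * ev (y h) x ↔ 0 ≤ ev (y h) q' * ev (y h) x := by
    intro g hg x
    have := congrArg (fun s => g ∈ s) h
    simp only [mem_sg, hg, true_and, eq_iff_iff] at this
    rcases lt_or_gt_of_ne (hq g hg) with h1 | h1
    · have h2 : ev (y g) q' < 0 :=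
        lt_of_le_of_ne (not_lt.1 fun h2 => (this.2 h2).not_gt h1) (hq' g hg)
      have aux : ∀ a b : ℝ, a < 0 → (0 ≤ a * b ↔ b ≤ 0) := fun a b ha =>
        ⟨fun h => not_lt.1 fun hb => (mul_neg_of_neg_of_pos ha hb).not_ge h,
          fun h => mul_nonneg_of_nonpos_of_nonpos ha.le h⟩
      rw [aux _ _ h1, aux _ _ h2]
    · rw [mul_nonneg_iff_of_pos_left h1, mul_nonneg_iff_of_pos_left (this.1 h1)]
  ext x
  simp only [poly, Set.mem_ofPred_eq]
  exact and_congr_left' (forall₂_congr fun h hh => key h hh x)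

lemma Chain.vertices_unique [Fintype ι] (hy : GP y φ) {q' x' : EuclideanSpace ℝ (Fin d)}
    {I : Finset ι} {l : List ι} {V V' : List (EuclideanSpace ℝ (Fin d))}
    (hq : ∀ h ∈ R, ev (y h) q ≠ 0) (hp : ∀ I, poly y R q I = poly y R q' I)
    (h : Chain y φ R q I l V x) (h' : Chain y φ R q' I l V' x') (hIR : I ⊆ R) : V = V' := by
  have hb : ∀ {I b b'}, I ⊆ R → IsBot y φ R q I b → IsBot y φ R q' I b' → b = b' := by
    intro I b b' hI hb hb'
    refine hb.unique hy hI hq ?_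
    rwa [IsBot, ← hp I] at hb'
  induction h generalizing V' x' with
  | nil h1 =>
    cases h' with
    | nil h2 => rw [hb hIR h1 h2]
  | cons t hR hI h1 ht0 ht1 hx hz ih =>
    cases h' with
    | cons t' hR' hI' h2 ht0' ht1' hx' hz' =>
      rw [hb hIR h1 h2, ih hz' (Finset.insert_subset hR hIR)]

/-- The number of canonical simplices containing points of `X`. -/
lemma card_image_vlist_le [Fintype ι] (hy : GP y φ)
    (hB : Bornology.IsBounded {x | ∀ h ∈ B, 0 ≤ ev (y h) x}) (hBR : B ⊆ R)
    {X : Finset (EuclideanSpace ℝ (Fin d))} (hX : ∀ q ∈ X, Good y B q) :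
    (X.image (vlist y φ R)).card ≤ d.factorial * (Zs y X R d 0).card := by
  have h1 : ∀ q : EuclideanSpace ℝ (Fin d), ∃ l, Good y B q →
      Chain y φ R q ∅ l (vlist y φ R q) q ∧ l.length = d := by
    intro q
    by_cases hq : Good y B q
    · obtain ⟨l, hl⟩ := vlist_spec hy hB hBR hq
      exact ⟨l, fun _ => hl⟩
    · exact ⟨[], fun h => absurd h hq⟩
  choose L hL using h1
  let F : EuclideanSpace ℝ (Fin d) → Finset ι × List ι := fun q => (sg y R q, L q)
  have h2 : (X.image (vlist y φ R)).card ≤ (X.image F).card := by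
    have hcho : ∀ p : Finset ι × List ι, ∃ V, ∀ q ∈ X, F q = p → vlist y φ R q = V := by
      intro p
      by_cases hp : ∃ q ∈ X, F q = p
      · obtain ⟨q, hq, rfl⟩ := hp
        refine ⟨vlist y φ R q, fun q' hq' he => ?_⟩
        have e1 := congrArg Prod.fst he
        have e2 := congrArg Prod.snd he
        simp only [F] at e1 e2
        have hc := (hL q' (hX q' hq')).1
        rw [e2] at hc
        exact hc.vertices_unique hy (fun h _ => (hX q' hq').ne h)
          (fun I => poly_congr (fun h _ => (hX q' hq').ne h) (fun h _ => (hX q hq).ne h) e1)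
          (hL q (hX q hq)).1 (Finset.empty_subset _)
      · exact ⟨[], fun q hq he => absurd ⟨q, hq, he⟩ hp⟩
    choose G hG using hcho
    refine (Finset.card_le_card (t := (X.image F).image G) ?_).trans Finset.card_image_le
    intro V hV
    obtain ⟨q, hq, rfl⟩ := Finset.mem_image.1 hV
    rw [hG (F q) q hq rfl]
    exact Finset.mem_image_of_mem _ (Finset.mem_image_of_mem _ hq)
  refine h2.trans ?_
  refine Finset.card_le_mul_card_image_of_maps_to
    (f := fun p : Finset ι × List ι => (p.2.toFinset, (∅ : Finset ι), p.1)) ?_ _ ?_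
  · intro p hp
    obtain ⟨q, hq, rfl⟩ := Finset.mem_image.1 hp
    obtain ⟨hc, hlen⟩ := hL q (hX q hq)
    have hnd := hc.nodup
    have hcard : (L q).toFinset.card = d := by rw [List.toFinset_card_of_nodup hnd.1, hlen]
    obtain ⟨v, hv⟩ := hc.point
    rw [Finset.empty_union] at hv
    refine mem_Zs.2 ⟨fun g hg => (hnd.2 g (List.mem_toFinset.1 hg)).2, Finset.filter_subset _ _,
      hcard, Finset.empty_subset _, rfl, Finset.disjoint_empty_right _, ⟨v, hv.2, ?_⟩, ?_⟩
    · intro h hR hh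
      have hne : ev (y h) v ≠ 0 := by
        intro h0
        have := hy.card_le (A := insert h (L q).toFinset) (x := v) fun i hi => by
          rcases Finset.mem_insert.1 hi with rfl | hi
          · exact h0
          · exact hv.2 i hi
        rw [Finset.card_insert_of_notMem hh] at this
        have hcard' : (F q).2.toFinset.card = d := hcard
        omega
      have hpos : 0 < ev (y h) q * ev (y h) v :=
        lt_of_le_of_ne (hv.1 h hR) (mul_ne_zero ((hX q hq).ne h) hne).symm
      refine ⟨hne, ?_⟩
      rw [pos_iff_of_mul_pos hpos]
      simp [F, mem_sg, hR]
    · intro T hT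
      rw [Finset.subset_empty.1 hT, Finset.union_empty]
      exact Finset.mem_image_of_mem _ hq
  · intro z hz
    have : ((X.image F).filter fun p => (p.2.toFinset, (∅ : Finset ι), p.1) = z) ⊆
        (z.1.toList.permutations.toFinset).image fun l => (z.2.2, l) := by
      intro p hp
      obtain ⟨hpF, rfl⟩ := Finset.mem_filter.1 hp
      obtain ⟨q, hq, rfl⟩ := Finset.mem_image.1 hpF
      refine Finset.mem_image.2 ⟨L q, ?_, rfl⟩
      rw [List.mem_toFinset, List.mem_permutations]
      exact List.perm_of_nodup_nodup_toFinset_eq (hL q (hX q hq)).1.nodup.1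
        (Finset.nodup_toList _) (by simp [F])
    refine (Finset.card_le_card this).trans (Finset.card_image_le.trans
      ((List.toFinset_card_le _).trans ?_))
    obtain ⟨I, J, τ⟩ := z
    rw [List.length_permutations, Finset.length_toList, (mem_Zs.1 hz).2.2.1]

end Simplex

section Sampling

/-- Backward analysis: on average over random samples of size `s`, few members of the family are
in conflict with the sample. -/
lemma sum_conflict_le {ι : Type*} [Fintype ι] (B : Finset ι) (K : Finset ι → ι → Prop) (D s : ℕ)
    (w : ι → ℝ) (hw : ∀ h, 0 ≤ w h) (hwB : ∀ h ∈ B, w h = 0)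
    (hK : ∀ R, B ⊆ R → ∀ h ∈ R, ¬ K R h)
    (hD : ∀ R, B ⊆ R → ((R \ B).filter fun h => K (R.erase h) h).card ≤ D) :
    ((s : ℝ) + 1) * ∑ g : Fin s → ι, (∏ i, w (g i)) *
      ∑ h, (if K (B ∪ Finset.univ.image g) h then w h else 0) ≤ D * (∑ h, w h) ^ (s + 1) := by
  have h1 : ∀ i : Fin (s + 1), ∑ g : Fin s → ι, (∏ i, w (g i)) *
      ∑ h, (if K (B ∪ Finset.univ.image g) h then w h else 0) =
      ∑ G : Fin (s + 1) → ι, (∏ j, w (G j)) *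
        (if K (B ∪ Finset.univ.image (fun j => G (i.succAbove j))) (G i) then 1 else 0) := by
    intro i
    rw [← (Fin.insertNthEquiv (fun _ => ι) i).sum_comp, Fintype.sum_prod_type, Finset.sum_comm]
    refine Finset.sum_congr rfl fun g _ => ?_
    rw [Finset.mul_sum]
    refine Finset.sum_congr rfl fun h _ => ?_
    rw [Fin.prod_univ_succAbove _ i]
    simp only [Fin.insertNthEquiv_apply, Fin.insertNth_apply_same, Fin.insertNth_apply_succAbove]
    split_ifs <;> ring
  have h2 : ((s : ℝ) + 1) * ∑ g : Fin s → ι, (∏ i, w (g i)) *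
      ∑ h, (if K (B ∪ Finset.univ.image g) h then w h else 0) =
      ∑ G : Fin (s + 1) → ι, (∏ j, w (G j)) * ∑ i : Fin (s + 1),
        (if K (B ∪ Finset.univ.image (fun j => G (i.succAbove j))) (G i) then (1 : ℝ) else 0) := by
    simp_rw [Finset.mul_sum (s := (Finset.univ : Finset (Fin (s + 1))))]
    rw [Finset.sum_comm, ← Finset.sum_congr rfl fun i _ => h1 i, Finset.sum_const]
    simp
  rw [h2, Fintype.sum_pow, Finset.mul_sum]
  refine Finset.sum_le_sum fun G _ => ?_
  rw [mul_comm (D : ℝ)]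
  by_cases h0 : ∏ j, w (G j) = 0
  · simp [h0]
  refine mul_le_mul_of_nonneg_left ?_ (Finset.prod_nonneg fun j _ => hw _)
  have hGB : ∀ i, G i ∉ B := fun i hi =>
    h0 (Finset.prod_eq_zero (Finset.mem_univ i) (hwB _ hi))
  rw [Finset.sum_boole]
  have hset : ∀ i, K (B ∪ Finset.univ.image (fun j => G (i.succAbove j))) (G i) →
      (∀ j, G (i.succAbove j) ≠ G i) ∧ B ∪ Finset.univ.image (fun j => G (i.succAbove j)) =
        (B ∪ Finset.univ.image G).erase (G i) := by
    intro i hi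
    have hne : ∀ j, G (i.succAbove j) ≠ G i := by
      intro j hj
      refine hK _ Finset.subset_union_left _ ?_ hi
      rw [← hj]
      exact Finset.mem_union_right _ (Finset.mem_image_of_mem _ (Finset.mem_univ _))
    refine ⟨hne, ?_⟩
    ext x
    simp only [Finset.mem_union, Finset.mem_image, Finset.mem_univ, true_and, Finset.mem_erase]
    constructor
    · rintro (hx | ⟨j, rfl⟩)
      · exact ⟨fun e => hGB i (e ▸ hx), Or.inl hx⟩
      · exact ⟨hne j, Or.inr ⟨_, rfl⟩⟩
    · rintro ⟨hxi, hx | ⟨j, rfl⟩⟩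
      · exact Or.inl hx
      · right
        obtain ⟨j', rfl⟩ := Fin.exists_succAbove_eq (x := j) (y := i) fun e => hxi (by rw [e])
        exact ⟨j', rfl⟩
  refine le_trans ?_ (Nat.cast_le.2 (hD (B ∪ Finset.univ.image G) Finset.subset_union_left))
  refine Nat.cast_le.2 (Finset.card_le_card_of_injOn G ?_ ?_)
  · intro i hi
    have hi : K (B ∪ Finset.univ.image (fun j => G (i.succAbove j))) (G i) := by simpa using hi
    simp only [Finset.coe_filter, Set.mem_ofPred_eq, Finset.mem_sdiff]
    rw [← (hset i hi).2]
    exact ⟨⟨by simp, hGB i⟩, hi⟩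
  · intro i hi i' hi' he
    by_contra hne
    have hi : K (B ∪ Finset.univ.image (fun j => G (i.succAbove j))) (G i) := by simpa using hi
    obtain ⟨j, hj⟩ := Fin.exists_succAbove_eq (x := i') (y := i) (Ne.symm hne)
    exact (hset i hi).1 j (by rw [hj, he])

lemma exists_le_of_weighted {α : Type*} (s : Finset α) (p F : α → ℝ) (c : ℝ)
    (hp : ∀ a ∈ s, 0 ≤ p a) (hpos : 0 < ∑ a ∈ s, p a)
    (h : ∑ a ∈ s, p a * F a ≤ (∑ a ∈ s, p a) * c) : ∃ a ∈ s, F a ≤ c := by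
  by_contra! hc
  rw [Finset.sum_mul] at h
  have h1 : ∀ a ∈ s, p a * c ≤ p a * F a := fun a ha =>
    mul_le_mul_of_nonneg_left (hc a ha).le (hp a ha)
  obtain ⟨a, ha, hpa⟩ := Finset.exists_ne_zero_of_sum_ne_zero hpos.ne'
  have hpa : 0 < p a := lt_of_le_of_ne (hp a ha) hpa.symm
  exact absurd h (not_le.2 (Finset.sum_lt_sum h1 ⟨a, ha, mul_lt_mul_of_pos_left (hc a ha) hpa⟩))

/-- A digraph with all outdegrees at most `D` has an independent set containing at least the
fraction `1 / (2 D + 1)` of its vertices. -/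
lemma exists_independent {α : Type*} (T : α → Finset α) (D : ℕ) (hT : ∀ a, (T a).card ≤ D)
    (G : Finset α) : ∃ X ⊆ G, G.card ≤ (2 * D + 1) * X.card ∧
      ∀ a ∈ X, ∀ b ∈ X, a ≠ b → b ∉ T a := by
  induction hn : G.card using Nat.strong_induction_on generalizing G with
  | _ n ih =>
    rcases G.eq_empty_or_nonempty with rfl | hne
    · exact ⟨∅, by simp, by simp at hn; omega, by simp⟩
    have hdeg : ∃ a ∈ G, (G.filter fun b => a ∈ T b).card ≤ D := by
      refine Finset.exists_le_of_sum_le hne ?_ (f := fun a => (G.filter fun b => a ∈ T b).card)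
        (g := fun _ => D)
      have := Finset.sum_card_bipartiteAbove_eq_sum_card_bipartiteBelow
        (s := G) (t := G) fun a b => a ∈ T b
      simp only [Finset.bipartiteAbove, Finset.bipartiteBelow] at this
      rw [this]
      refine Finset.sum_le_sum fun b _ => (Finset.card_le_card ?_).trans (hT b)
      intro a ha; exact (Finset.mem_filter.1 ha).2
    obtain ⟨a, ha, hda⟩ := hdeg
    set N := insert a (T a ∪ G.filter fun b => a ∈ T b) with hN
    have hNc : N.card ≤ 2 * D + 1 := by
      refine (Finset.card_insert_le _ _).trans ?_
      have := Finset.card_union_le (T a) (G.filter fun b => a ∈ T b)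
      have := hT a
      omega
    have hlt : (G \ N).card < n := by
      rw [← hn]
      refine Finset.card_lt_card ⟨Finset.sdiff_subset, fun h => ?_⟩
      exact (Finset.mem_sdiff.1 (h ha)).2 (by simp [hN])
    obtain ⟨X, hXG, hXc, hX⟩ := ih _ hlt (G \ N) rfl
    have haX : a ∉ X := fun h => (Finset.mem_sdiff.1 (hXG h)).2 (by simp [hN])
    refine ⟨insert a X, ?_, ?_, ?_⟩
    · exact Finset.insert_subset ha (hXG.trans Finset.sdiff_subset)
    · rw [Finset.card_insert_of_notMem haX, ← hn]
      have := Finset.card_le_card_sdiff_add_card (s := G) (t := N)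
      nlinarith
    · intro b hb c hc hbc
      rcases Finset.mem_insert.1 hb with hba | hb' <;> rcases Finset.mem_insert.1 hc with hca | hc'
      · exact absurd (hba.trans hca.symm) hbc
      · intro h
        rw [hba] at h
        exact (Finset.mem_sdiff.1 (hXG hc')).2 (by simp [hN, h])
      · intro h
        rw [hca] at h
        have := hXG hb'
        rw [Finset.mem_sdiff] at this
        exact this.2 (by simp [hN, h, this.1])
      · exact hX b hb' c hc' hbc

end Sampling

section Step

variable {d : ℕ} {ι : Type*} {y : ι → EuclideanSpace ℝ (Fin d) × ℝ}
  {φ : EuclideanSpace ℝ (Fin d)} {B R : Finset ι}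

lemma notMem_interior_convexHull {X : Set (EuclideanSpace ℝ (Fin d))}
    {q a : EuclideanSpace ℝ (Fin d)} (ha : a ≠ 0) (h : ∀ x ∈ X, ⟪q, a⟫ ≤ ⟪x, a⟫) :
    q ∉ interior (convexHull ℝ X) := by
  intro hq
  have hsub : convexHull ℝ X ⊆ {x | ⟪q, a⟫ ≤ ⟪x, a⟫} := by
    refine convexHull_min h ?_
    intro x hx z hz s t hs ht hst
    simp only [Set.mem_ofPred_eq, inner_add_left, real_inner_smul_left] at hx hz ⊢
    have e : ⟪q, a⟫ = s * ⟪q, a⟫ + t * ⟪q, a⟫ := by rw [← add_mul, hst, one_mul]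
    rw [e]
    gcongr
  have hcont : Filter.Tendsto (fun t : ℝ => q - t • a) (nhdsWithin 0 (Set.Ioi 0)) (nhds q) := by
    have : Continuous fun t : ℝ => q - t • a := by fun_prop
    have := this.tendsto 0
    simp only [zero_smul, sub_zero] at this
    exact this.mono_left nhdsWithin_le_nhds
  obtain ⟨t, ht, ht0⟩ := ((hcont.eventually (isOpen_interior.mem_nhds hq)).and
    self_mem_nhdsWithin).exists
  have ht0 : 0 < t := ht0
  have h1 := hsub (interior_subset ht)
  simp only [Set.mem_ofPred_eq, inner_sub_left, real_inner_smul_left] at h1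
  have := mul_pos ht0 (real_inner_self_pos.2 ha)
  linarith

/-- The constant in the zone bound. -/
def zoneConst (d b : ℕ) : ℝ :=
  d.factorial * (zoneStep d b ^ (d + 2) * (3 * 2 ^ (d - 1) * (b + 1) ^ (d - 1)))

lemma card_good_le [Fintype ι] (hd : 3 ≤ d) (hy : GP y φ)
    (hB : Bornology.IsBounded {x | ∀ h ∈ B, 0 ≤ ev (y h) x}) {s k : ℕ} {Q : Finset ι}
    (hQ : Q.card ≤ s) {P G : Finset (EuclideanSpace ℝ (Fin d))} (hGP : G ⊆ P)
    (hgood : ∀ q ∈ P, Good y B q) (hsh : ∀ q ∈ P, IsShallowPt P k q)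
    (hfib : ∀ V, (G.filter fun q => vlist y φ (B ∪ Q) q = V).card ≤ k) :
    (G.card : ℝ) ≤
      (4 * k + 1) * (zoneConst d B.card * (1 + Real.log s) ^ 2 * (s + 1) ^ (d - 1)) := by
  choose! a b ha hab hcard using hsh
  let T : EuclideanSpace ℝ (Fin d) → Finset (EuclideanSpace ℝ (Fin d)) := fun q =>
    if q ∈ P then (G.filter fun q' => vlist y φ (B ∪ Q) q' = vlist y φ (B ∪ Q) q) ∪
      (P.filter fun x => x ∈ halfspace (a q) (b q)) else ∅
  have hT : ∀ q, (T q).card ≤ 2 * k := by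
    intro q
    by_cases hq : q ∈ P
    · simp only [T, if_pos hq]
      refine (Finset.card_union_le _ _).trans ?_
      have h1 := hfib (vlist y φ (B ∪ Q) q)
      have h2 := hcard q hq
      have h3 : ((P : Set (EuclideanSpace ℝ (Fin d))) ∩ halfspace (a q) (b q)) =
          ((P.filter fun x => x ∈ halfspace (a q) (b q) : Finset _) : Set _) := by
        ext x; simp
      rw [h3, Set.ncard_coe_finset] at h2
      omega
    · simp [T, hq]
  obtain ⟨X, hXG, hXc, hX⟩ := exists_independent T (2 * k) hT G
  have hXP := hXG.trans hGP
  have hcf : (X.image (vlist y φ (B ∪ Q))).card = X.card := by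
    refine Finset.card_image_of_injOn fun q hq q' hq' he => ?_
    by_contra hne
    refine hX q hq q' hq' hne ?_
    simp only [T, if_pos (hXP hq)]
    exact Finset.mem_union_left _ (Finset.mem_filter.2 ⟨hXG hq', he.symm⟩)
  have h1 := card_image_vlist_le (φ := φ) hy hB (Finset.subset_union_left (s₂ := Q))
    (X := X) fun q hq => hgood q (hXP hq)
  rw [hcf] at h1
  have hKc : IsCompact (convexHull ℝ (X : Set (EuclideanSpace ℝ (Fin d)))) :=
    X.finite_toSet.isCompact_convexHull ℝ
  have hBQ : B ∪ Q = B ∪ (Q \ B) := by simp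
  have hQB : (Q \ B).card ≤ s := (Finset.card_le_card Finset.sdiff_subset).trans hQ
  have h2 := card_Zs_zero_le (φ := φ) hd hy (convex_convexHull ℝ _) hKc hB (X := X)
    (fun q hq => (hgood q (hXP hq)).pos) (fun q hq => (hgood q (hXP hq)).ne)
    (fun q hq => subset_convexHull ℝ _ hq)
    (fun q hq => notMem_interior_convexHull (ha q (hXP hq)) fun x hx => by
      by_cases hxq : x = q
      · rw [hxq]
      have hno := hX q hq x hx (Ne.symm hxq)
      simp only [T, if_pos (hXP hq), Finset.mem_union, not_or] at hno
      have h3 : ¬ ⟪x, a q⟫ ≤ b q := fun h => hno.2 (Finset.mem_filter.2 ⟨hXP hx, h⟩)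
      have h4 := hab q (hXP hq)
      exact le_trans h4 (not_le.1 h3).le)
    (Finset.sdiff_disjoint (s := B) (t := Q)) hQB
  rw [← hBQ] at h2
  have h3 : (X.card : ℝ) ≤ zoneConst d B.card * (1 + Real.log s) ^ 2 * (s + 1) ^ (d - 1) := by
    calc (X.card : ℝ) ≤ d.factorial * ((Zs y X (B ∪ Q) d 0).card : ℝ) := by exact_mod_cast h1
      _ ≤ d.factorial *
          ((zoneStep d B.card ^ (d + 2) * (3 * 2 ^ (d - 1) * (B.card + 1) ^ (d - 1))) *
          (1 + Real.log s) ^ 2 * ((Q \ B).card + 1) ^ (d - 1)) := by gcongr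
      _ ≤ d.factorial *
          ((zoneStep d B.card ^ (d + 2) * (3 * 2 ^ (d - 1) * (B.card + 1) ^ (d - 1))) *
          (1 + Real.log s) ^ 2 * (s + 1) ^ (d - 1)) := by
        have : 0 ≤ zoneStep d B.card := zero_le_one.trans (one_le_zoneStep (by omega))
        gcongr
      _ = _ := by rw [zoneConst]; ring
  calc (G.card : ℝ) ≤ (4 * k + 1) * X.card := by
        have : ((G.card : ℕ) : ℝ) ≤ ((2 * (2 * k) + 1) * X.card : ℕ) := by exact_mod_cast hXc
        push_cast at this; linarith
    _ ≤ _ := by gcongr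

/-- One step of the construction: a simplex with `k` points that is crossed by few functionals. -/
lemma exists_simplex [Fintype ι] (hd : 3 ≤ d) (hy : GP y φ)
    (hB : Bornology.IsBounded {x | ∀ h ∈ B, 0 ≤ ev (y h) x}) {s k : ℕ}
    {P : Finset (EuclideanSpace ℝ (Fin d))}
    (hgood : ∀ q ∈ P, Good y B q) (hsh : ∀ q ∈ P, IsShallowPt P k q)
    (w : ι → ℝ) (hw : ∀ h, 0 ≤ w h) (hwB : ∀ h ∈ B, w h = 0) (hW : 0 < ∑ h, w h)
    (hs : 2 * ((4 * k + 1) * (zoneConst d B.card * (1 + Real.log s) ^ 2 * (s + 1) ^ (d - 1))) <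
      P.card) :
    ∃ (Δ : Set (EuclideanSpace ℝ (Fin d))) (P₁ : Finset (EuclideanSpace ℝ (Fin d))),
      IsOpenSimplex Δ ∧ P₁ ⊆ P ∧ P₁.card = k ∧ (P₁ : Set (EuclideanSpace ℝ (Fin d))) ⊆ Δ ∧
      ∑ h, (if ∃ x ∈ Δ, ev (y h) x = 0 then w h else 0) ≤
        2 * ((d + 1) * d) * (∑ h, w h) / (s + 1) := by
  set W := ∑ h, w h with hWdef
  let cr : (Fin s → ι) → EuclideanSpace ℝ (Fin d) → ℝ := fun g q =>
    ∑ h, (if Crs y φ (B ∪ Finset.univ.image g) q h then w h else 0)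
  have hs1 : (0 : ℝ) < s + 1 := by positivity
  have hPW : ∑ g : Fin s → ι, ∏ i, w (g i) = W ^ s := (Fintype.sum_pow w s).symm
  have hDpos : (0 : ℝ) ≤ (d + 1) * d := by positivity
  obtain ⟨g, -, hg⟩ := exists_le_of_weighted Finset.univ (fun g : Fin s → ι => ∏ i, w (g i))
    (fun g => ∑ q ∈ P, cr g q) (P.card * ((d + 1) * d * W / (s + 1)))
    (fun g _ => Finset.prod_nonneg fun i _ => hw _) (by rw [hPW]; positivity) (by
      rw [hPW]
      simp_rw [Finset.mul_sum (s := P)]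
      rw [Finset.sum_comm]
      refine (Finset.sum_le_sum (g := fun _ => W ^ s * ((d + 1) * d * W / (s + 1)))
        fun q hq => ?_).trans ?_
      · have := sum_conflict_le B (fun R h => Crs y φ R q h) ((d + 1) * d) s w hw hwB
          (fun R hR h hh => not_crs_of_mem hy hB hR (hgood q hq) hh)
          (fun R hR => card_crs_erase_le hy hB hR (hgood q hq))
        rw [← mul_div_assoc, le_div_iff₀ hs1, mul_comm]
        refine this.trans (le_of_eq ?_)
        push_cast
        ring
      · rw [Finset.sum_const, nsmul_eq_mul]
        exact le_of_eq (by ring))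
  set c := (d + 1) * d * W / ((s : ℝ) + 1) with hc
  have hd0 : (0 : ℝ) < d := by exact_mod_cast (by omega : 0 < d)
  have hcpos : 0 < c := by positivity
  set G := P.filter fun q => cr g q ≤ 2 * c with hG
  have hcr0 : ∀ q, 0 ≤ cr g q := fun q => Finset.sum_nonneg fun h _ => by
    split_ifs
    exacts [hw h, le_rfl]
  have hGc : (P.card : ℝ) ≤ 2 * G.card := by
    have h1 : ∑ q ∈ P.filter (fun q => ¬ cr g q ≤ 2 * c), (2 * c) ≤ ∑ q ∈ P, cr g q :=
      (Finset.sum_le_sum fun q hq => (not_le.1 (Finset.mem_filter.1 hq).2).le).trans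
        (Finset.sum_le_sum_of_subset_of_nonneg (Finset.filter_subset _ _) fun q _ _ => hcr0 q)
    rw [Finset.sum_const, nsmul_eq_mul] at h1
    have h2 := Finset.card_filter_add_card_filter_not (s := P) fun q => cr g q ≤ 2 * c
    have h3 : (G.card : ℝ) + ((P.filter (fun q => ¬ cr g q ≤ 2 * c)).card : ℝ) = P.card := by
      exact_mod_cast h2
    have h4 : ((P.filter (fun q => ¬ cr g q ≤ 2 * c)).card : ℝ) * 2 ≤ P.card := by
      refine le_of_mul_le_mul_right ?_ hcpos
      linarith
    linarith
  have hfib : ∃ V, k < (G.filter fun q => vlist y φ (B ∪ Finset.univ.image g) q = V).card := by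
    by_contra! hno
    have := card_good_le (s := s) hd hy hB (Finset.card_image_le.trans (by simp)) (G := G)
      (Finset.filter_subset _ _) hgood hsh hno
    linarith
  obtain ⟨V, hV⟩ := hfib
  obtain ⟨P₁, hP₁, hP₁c⟩ := Finset.exists_subset_card_eq hV.le
  have hsub : ∀ q ∈ G.filter (fun q => vlist y φ (B ∪ Finset.univ.image g) q = V),
      q ∈ P ∧ cr g q ≤ 2 * c ∧ vlist y φ (B ∪ Finset.univ.image g) q = V := by
    intro q hq
    obtain ⟨hq, hqV⟩ := Finset.mem_filter.1 hq
    exact ⟨(Finset.mem_filter.1 hq).1, (Finset.mem_filter.1 hq).2, hqV⟩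
  obtain ⟨q₀, hq₀⟩ : (G.filter fun q => vlist y φ (B ∪ Finset.univ.image g) q = V).Nonempty :=
    Finset.card_pos.1 (by omega)
  obtain ⟨hq₀P, hq₀c, hq₀V⟩ := hsub q₀ hq₀
  have hsimp := fun q hq => vlist_simplex (φ := φ) hy hB
    (Finset.subset_union_left (s₂ := Finset.univ.image g)) (hgood q hq)
  refine ⟨interior (convexHull ℝ (V.toFinset : Set (EuclideanSpace ℝ (Fin d)))), P₁,
    hq₀V ▸ (hsimp q₀ hq₀P).1, fun q hq => (hsub q (hP₁ hq)).1, hP₁c, fun q hq => ?_, ?_⟩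
  · obtain ⟨h1, -, h2⟩ := hsub q (hP₁ hq)
    exact h2 ▸ (hsimp q h1).2
  · refine le_trans ?_ (hq₀c.trans (le_of_eq (by rw [hc]; ring)))
    refine Finset.sum_le_sum fun h _ => ?_
    by_cases hx : ∃ x ∈ interior (convexHull ℝ (V.toFinset : Set (EuclideanSpace ℝ (Fin d)))),
        ev (y h) x = 0
    · obtain ⟨x, hxV, hx0⟩ := hx
      have := crs_of_meets (φ := φ) ((hgood q₀ hq₀P).ne h) (x := x) (by rw [hq₀V]; exact hxV) hx0
      rw [if_pos ⟨x, hxV, hx0⟩, if_pos this]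
    · rw [if_neg hx]
      split_ifs
      exacts [hw h, le_rfl]

end Step

section Big

variable {d : ℕ}

/-- Every bounded set lies in an open simplex. -/
lemma exists_big_simplex (S : Set (EuclideanSpace ℝ (Fin d))) (hS : Bornology.IsBounded S) :
    ∃ Δ : Set (EuclideanSpace ℝ (Fin d)), IsOpenSimplex Δ ∧ S ⊆ Δ := by
  obtain ⟨b⟩ : Nonempty (AffineBasis (Fin (d + 1)) ℝ (EuclideanSpace ℝ (Fin d))) :=
    AffineBasis.exists_affineBasis_of_finiteDimensional (by simp)
  have hx := b.centroid_mem_interior_convexHull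
  set x₀ := Finset.univ.centroid ℝ b with hx₀
  obtain ⟨ε, hε, hball⟩ := Metric.isOpen_iff.1 isOpen_interior _ hx
  obtain ⟨M, hM⟩ := hS.subset_closedBall x₀
  set c : ℝ := (|M| + 1) / ε with hc
  have hMpos : 0 < |M| + 1 := by positivity
  have hcpos : 0 < c := by positivity
  let e : EuclideanSpace ℝ (Fin d) ≃ᵃ[ℝ] EuclideanSpace ℝ (Fin d) :=
    AffineEquiv.homothetyUnitsMulHom x₀ (Units.mk0 c hcpos.ne')
  have he : ∀ x, e x = c • (x - x₀) + x₀ := fun x => by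
    simp [e, AffineEquiv.coe_homothetyUnitsMulHom_apply, AffineMap.homothety_apply]
  refine ⟨interior (convexHull ℝ (Set.range (e ∘ b))), ⟨e ∘ b, ?_, rfl⟩, fun s hs => ?_⟩
  · exact (AffineEquiv.affineIndependent_iff e).2 b.ind
  · have h1 : convexHull ℝ (Set.range (e ∘ b)) = e '' convexHull ℝ (Set.range b) := by
      rw [Set.range_comp]
      exact (AffineMap.image_convexHull e.toAffineMap _).symm
    have h2 := (e.toContinuousAffineEquiv).toHomeomorph.image_interior (convexHull ℝ (Set.range b))
    rw [h1]
    refine h2.subset ?_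
    refine ⟨c⁻¹ • (s - x₀) + x₀, hball ?_, ?_⟩
    · rw [Metric.mem_ball, dist_eq_norm, add_sub_cancel_right, norm_smul, Real.norm_eq_abs,
        abs_of_pos (inv_pos.2 hcpos), inv_mul_lt_iff₀ hcpos, hc, div_mul_cancel₀ _ hε.ne']
      have := hM hs
      rw [Metric.mem_closedBall, dist_eq_norm] at this
      exact this.trans_lt ((le_abs_self M).trans_lt (lt_add_one _))
    · refine (he _).trans ?_
      rw [add_sub_cancel_right, smul_smul, mul_inv_cancel₀ hcpos.ne', one_smul,
        sub_add_cancel]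

end Big

section Reweight

variable {d : ℕ} {ι : Type*}

/-- Iterating a step with multiplicative reweighting. -/
lemma exists_partition_weights [Fintype ι] (M : Set (EuclideanSpace ℝ (Fin d)) → ι → Prop)
    {k : ℕ} (hk : 1 ≤ k) (θ : ℕ → ℝ) (hθ : ∀ l, 0 ≤ θ l) (ok : (ι → ℝ) → Prop)
    (hok : ∀ w, ok w → ∀ h, 0 ≤ w h)
    (hok2 : ∀ w Δ, ok w → ok fun h => w h * if M Δ h then 2 else 1)
    (P : Finset (EuclideanSpace ℝ (Fin d)))
    (hstep : ∀ P' ⊆ P, 2 * k ≤ P'.card → ∀ w : ι → ℝ, ok w →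
      ∃ (Δ : Set (EuclideanSpace ℝ (Fin d))) (P₁ : Finset (EuclideanSpace ℝ (Fin d))),
        IsOpenSimplex Δ ∧ P₁ ⊆ P' ∧ P₁.card = k ∧ (P₁ : Set (EuclideanSpace ℝ (Fin d))) ⊆ Δ ∧
        ∑ h, (if M Δ h then w h else 0) ≤ θ (P'.card / k) * ∑ h, w h) :
    ∀ P' ⊆ P, k ≤ P'.card → ∀ w : ι → ℝ, ok w →
      ∃ (m : ℕ) (parts : Fin m → Finset (EuclideanSpace ℝ (Fin d)))
          (Δ : Fin m → Set (EuclideanSpace ℝ (Fin d))),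
          (∀ i j, i ≠ j → Disjoint (parts i) (parts j)) ∧
          (∀ p, p ∈ P' ↔ ∃ i, p ∈ parts i) ∧
          (∀ i, k ≤ (parts i).card ∧ (parts i).card ≤ 2 * k) ∧
          (∀ i, IsOpenSimplex (Δ i)) ∧
          (∀ i, (parts i : Set (EuclideanSpace ℝ (Fin d))) ⊆ Δ i) ∧
          ∑ h, w h * ∏ i, (if M (Δ i) h then (2 : ℝ) else 1) ≤
            (∑ h, w h) * (2 * ∏ l ∈ Finset.Icc 2 (P'.card / k), (1 + θ l)) := by
  intro P'
  induction hn : P'.card using Nat.strong_induction_on generalizing P' with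
  | _ n ih =>
    subst hn
    intro hP' hkP w hw
    by_cases h2 : P'.card < 2 * k
    · obtain ⟨Δ, hΔ, hPΔ⟩ := exists_big_simplex (P' : Set (EuclideanSpace ℝ (Fin d)))
        P'.finite_toSet.isBounded
      refine ⟨1, fun _ => P', fun _ => Δ, fun i j hij => absurd (Subsingleton.elim i j) hij,
        by simp, fun _ => ⟨hkP, h2.le⟩, fun _ => hΔ, fun _ => hPΔ, ?_⟩
      have hdiv : P'.card / k = 1 := by
        exact Nat.div_eq_of_lt_le (by omega) (by omega)
      rw [hdiv, Finset.sum_mul]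
      simp only [Finset.univ_unique, Finset.prod_const, Finset.card_singleton, pow_one]
      refine Finset.sum_le_sum fun h _ => mul_le_mul_of_nonneg_left ?_ (hok w hw h)
      split_ifs <;> norm_num
    · push Not at h2
      obtain ⟨Δ, P₁, hΔ, hP₁, hc, hPΔ, hsum⟩ := hstep P' hP' h2 w hw
      have hcard : (P' \ P₁).card = P'.card - k := by rw [Finset.card_sdiff_of_subset hP₁, hc]
      obtain ⟨m, parts, Δs, h1, h3, h4, h5, h6, h7⟩ := ih _ (by omega) (P' \ P₁) rfl
        (Finset.sdiff_subset.trans hP') (by omega) _ (hok2 w Δ hw)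
      have hdisj : ∀ j, Disjoint P₁ (parts j) := fun j => by
        refine Finset.disjoint_left.2 fun p hp hpj => ?_
        exact (Finset.mem_sdiff.1 ((h3 p).2 ⟨j, hpj⟩)).2 hp
      refine ⟨m + 1, Fin.cons P₁ parts, Fin.cons Δ Δs, ?_, ?_, ?_, ?_, ?_, ?_⟩
      · intro i j hij
        induction i using Fin.cases with
        | zero => induction j using Fin.cases with
          | zero => exact absurd rfl hij
          | succ j => simpa using hdisj j
        | succ i => induction j using Fin.cases with
          | zero => simpa using (hdisj i).symm
          | succ j => simpa using h1 i j fun e => hij (by rw [e])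
      · intro p
        rw [Fin.exists_fin_succ]
        simp only [Fin.cons_zero, Fin.cons_succ, ← h3, Finset.mem_sdiff]
        constructor
        · intro hp
          by_cases hp1 : p ∈ P₁
          · exact Or.inl hp1
          · exact Or.inr ⟨hp, hp1⟩
        · rintro (hp | hp)
          · exact hP₁ hp
          · exact hp.1
      · intro i
        induction i using Fin.cases with
        | zero => simp [hc]; omega
        | succ i => simpa using h4 i
      · intro i
        induction i using Fin.cases with
        | zero => simpa using hΔ
        | succ i => simpa using h5 i
      · intro i
        induction i using Fin.cases with
        | zero => simpa using hPΔ
        | succ i => simpa using h6 i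
      · simp only [Fin.prod_univ_succ, Fin.cons_zero, Fin.cons_succ, ← mul_assoc] at h7 ⊢
        refine h7.trans ?_
        have hdiv : P'.card / k = (P' \ P₁).card / k + 1 := by
          rw [hcard, ← Nat.add_div_right _ (by omega), Nat.sub_add_cancel hkP]
        have hge : 2 ≤ (P' \ P₁).card / k + 1 := by
          have : 1 ≤ (P' \ P₁).card / k := (Nat.le_div_iff_mul_le (by omega)).2 (by omega)
          omega
        rw [hdiv] at hsum ⊢
        rw [Finset.prod_Icc_succ_top hge]
        have hW : ∑ h, w h * (if M Δ h then (2 : ℝ) else 1) ≤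
            (∑ h, w h) * (1 + θ ((P' \ P₁).card / k + 1)) := by
          have : ∑ h, w h * (if M Δ h then (2 : ℝ) else 1) =
              ∑ h, w h + ∑ h, (if M Δ h then w h else 0) := by
            rw [← Finset.sum_add_distrib]
            refine Finset.sum_congr rfl fun h _ => ?_
            split_ifs <;> ring
          rw [this]
          linarith
        have hpr : 0 ≤ ∏ l ∈ Finset.Icc 2 ((P' \ P₁).card / k), (1 + θ l) :=
          Finset.prod_nonneg fun l _ => by linarith [hθ l]
        calc _ ≤ (∑ h, w h) * (1 + θ ((P' \ P₁).card / k + 1)) * 2 *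
              ∏ l ∈ Finset.Icc 2 ((P' \ P₁).card / k), (1 + θ l) := by gcongr
          _ = _ := by ring

lemma sum_rpow_neg_le {α : ℝ} (h0 : 0 ≤ α) (h1 : α ≤ 1 / 2) (L : ℕ) :
    ∑ l ∈ Finset.Icc 1 L, (l : ℝ) ^ (-α) ≤ 2 * (L : ℝ) ^ (1 - α) := by
  induction L with
  | zero => simp [Real.zero_rpow (by linarith : (1 - α) ≠ 0)]
  | succ L ih =>
    rw [Finset.sum_Icc_succ_top (by omega)]
    have hL : (0 : ℝ) < (L : ℝ) + 1 := by positivity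
    have hb := rpow_one_add_le_one_add_mul_self (s := -1 / ((L : ℝ) + 1)) (p := 1 - α)
      (by rw [neg_div, neg_le_neg_iff, div_le_one hL]; linarith [(Nat.cast_nonneg L : (0:ℝ) ≤ L)])
      (by linarith) (by linarith)
    have e1 : (1 : ℝ) + -1 / (L + 1) = L / (L + 1) := by field_simp; ring
    rw [e1, Real.div_rpow (Nat.cast_nonneg L) hL.le, div_le_iff₀ (Real.rpow_pos_of_pos hL _)] at hb
    have e2 : ((L : ℝ) + 1) ^ (1 - α) = (L + 1) * ((L : ℝ) + 1) ^ (-α) := by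
      rw [sub_eq_add_neg, Real.rpow_add hL, Real.rpow_one]
    have e3 : 0 ≤ ((L : ℝ) + 1) ^ (-α) := Real.rpow_nonneg hL.le _
    push_cast
    rw [e2] at hb ⊢
    have e4 : (1 + (1 - α) * (-1 / ((L : ℝ) + 1))) * ((L + 1) * ((L : ℝ) + 1) ^ (-α)) =
        (L + 1) * ((L : ℝ) + 1) ^ (-α) - (1 - α) * ((L : ℝ) + 1) ^ (-α) := by
      field_simp; ring
    rw [e4] at hb
    nlinarith

end Reweight

section TestPartition

variable {d : ℕ} {ι : Type*} {y : ι → EuclideanSpace ℝ (Fin d) × ℝ}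
  {φ : EuclideanSpace ℝ (Fin d)} {B : Finset ι}

lemma isShallowPt_mono {P P' : Finset (EuclideanSpace ℝ (Fin d))} (h : P' ⊆ P) {k : ℕ}
    {p : EuclideanSpace ℝ (Fin d)} (hp : IsShallowPt P k p) : IsShallowPt P' k p := by
  obtain ⟨a, b, ha, hab, hc⟩ := hp
  refine ⟨a, b, ha, hab, (Set.ncard_le_ncard ?_ (P.finite_toSet.inter_of_left _)).trans hc⟩
  exact Set.inter_subset_inter_left _ (by exact_mod_cast h)

lemma zoneConst_nonneg (hd : 1 ≤ d) (b : ℕ) : 0 ≤ zoneConst d b := by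
  have := zero_le_one.trans (one_le_zoneStep (b := b) hd)
  unfold zoneConst; positivity

/-- A partition whose simplices are crossed by few members of the family. -/
lemma exists_partition_family [Fintype ι] (hd : 3 ≤ d) (hy : GP y φ)
    (hB : Bornology.IsBounded {x | ∀ h ∈ B, 0 ≤ ev (y h) x}) {k : ℕ} (hk : 1 ≤ k)
    {P : Finset (EuclideanSpace ℝ (Fin d))} (hkP : k ≤ P.card)
    (hgood : ∀ q ∈ P, Good y B q) (hsh : ∀ q ∈ P, IsShallowPt P k q) :
    ∃ (m : ℕ) (parts : Fin m → Finset (EuclideanSpace ℝ (Fin d)))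
      (Δ : Fin m → Set (EuclideanSpace ℝ (Fin d))),
      (∀ i j, i ≠ j → Disjoint (parts i) (parts j)) ∧
      (∀ p, p ∈ P ↔ ∃ i, p ∈ parts i) ∧
      (∀ i, k ≤ (parts i).card ∧ (parts i).card ≤ 2 * k) ∧
      (∀ i, IsOpenSimplex (Δ i)) ∧
      (∀ i, (parts i : Set (EuclideanSpace ℝ (Fin d))) ⊆ Δ i) ∧
      ∀ h ∉ B, ((Finset.univ.filter fun i => ∃ x ∈ Δ i, ev (y h) x = 0).card : ℝ) * Real.log 2 ≤
        Real.log (Fintype.card ι) + Real.log 2 +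
          8 * ((d + 1) * d) * ((20 * zoneConst d B.card + 1) *
            (1 + Real.log (P.card / k : ℕ)) ^ 2) ^ (1 / ((d : ℝ) - 1)) *
            ((P.card / k : ℕ) : ℝ) ^ (1 - 1 / ((d : ℝ) - 1)) := by
  set L := P.card / k with hL
  set α := 1 / ((d : ℝ) - 1) with hα
  set Λ := 1 + Real.log L with hΛ
  set Z := zoneConst d B.card with hZ
  set A : ℝ := 4 * ((d + 1) * d) with hA
  have hd3 : (3 : ℝ) ≤ d := by exact_mod_cast hd
  have hd1 : (0 : ℝ) < (d : ℝ) - 1 := by linarith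
  have hα0 : 0 < α := by positivity
  have hα1 : α ≤ 1 / 2 := by
    rw [hα]; exact one_div_le_one_div_of_le (by norm_num) (by linarith)
  have hαd : α * ((d - 1 : ℕ) : ℝ) = 1 := by
    rw [hα, Nat.cast_sub (by omega), Nat.cast_one]; field_simp
  have hL1 : 1 ≤ L := (Nat.le_div_iff_mul_le (by omega)).2 (by omega)
  have hlogL : 0 ≤ Real.log L := Real.log_natCast_nonneg L
  have hΛ1 : 1 ≤ Λ := by linarith
  have hZ0 : 0 ≤ Z := zoneConst_nonneg (by omega) _
  set c := (20 * Z + 1) * Λ ^ 2 with hc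
  have hΛ2 : 1 ≤ Λ ^ 2 := one_le_pow₀ hΛ1
  have hc1 : 1 ≤ c := one_le_mul_of_one_le_of_one_le (by linarith) hΛ2
  have hc0 : 0 < c := by linarith
  have hcα : 0 < c ^ α := Real.rpow_pos_of_pos hc0 _
  have hA0 : 2 ≤ A := by rw [hA]; nlinarith
  let θ : ℕ → ℝ := fun l => A * c ^ α * (l : ℝ) ^ (-α)
  have hθ : ∀ l, 0 ≤ θ l := fun l => by
    have := Real.rpow_nonneg (Nat.cast_nonneg l : (0 : ℝ) ≤ l) (-α)
    have : 0 ≤ A := by linarith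
    positivity
  let M : Set (EuclideanSpace ℝ (Fin d)) → ι → Prop := fun Δ h => ∃ x ∈ Δ, ev (y h) x = 0
  have hstep : ∀ P' ⊆ P, 2 * k ≤ P'.card → ∀ w : ι → ℝ,
      ((∀ h, 0 ≤ w h) ∧ ∀ h ∈ B, w h = 0) →
      ∃ (Δ : Set (EuclideanSpace ℝ (Fin d))) (P₁ : Finset (EuclideanSpace ℝ (Fin d))),
        IsOpenSimplex Δ ∧ P₁ ⊆ P' ∧ P₁.card = k ∧ (P₁ : Set (EuclideanSpace ℝ (Fin d))) ⊆ Δ ∧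
        ∑ h, (if M Δ h then w h else 0) ≤ θ (P'.card / k) * ∑ h, w h := by
    rintro P' hP' h2k w ⟨hw, hwB⟩
    set l := P'.card / k with hl
    have hl2 : 2 ≤ l := (Nat.le_div_iff_mul_le (by omega)).2 h2k
    have hlL : l ≤ L := Nat.div_le_div_right (Finset.card_le_card hP')
    have hlk : (l : ℝ) * k ≤ P'.card := by exact_mod_cast Nat.div_mul_le_self _ _
    have hl0 : (0 : ℝ) < l := by exact_mod_cast (by omega : 0 < l)
    have hW0 : 0 ≤ ∑ h, w h := Finset.sum_nonneg fun h _ => hw h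
    set σ := ((l : ℝ) / c) ^ α with hσ
    have hσ0 : 0 < σ := Real.rpow_pos_of_pos (div_pos hl0 hc0) _
    have hθσ : θ l = A / σ := by
      simp only [θ]
      rw [hσ, Real.div_rpow hl0.le hc0.le, Real.rpow_neg hl0.le, div_div_eq_mul_div, div_eq_mul_inv]
    by_cases hbig : (∑ h, w h = 0) ∨ σ < 2
    · obtain ⟨P₁, hP₁, hP₁c⟩ := Finset.exists_subset_card_eq (by omega : k ≤ P'.card)
      obtain ⟨Δ, hΔ, hPΔ⟩ := exists_big_simplex (P₁ : Set (EuclideanSpace ℝ (Fin d)))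
        P₁.finite_toSet.isBounded
      refine ⟨Δ, P₁, hΔ, hP₁, hP₁c, hPΔ, ?_⟩
      have h1 : ∑ h, (if M Δ h then w h else 0) ≤ ∑ h, w h :=
        Finset.sum_le_sum fun h _ => by split_ifs; exacts [le_rfl, hw h]
      refine h1.trans ?_
      rcases hbig with h0 | h0
      · rw [h0, mul_zero]
      · refine le_mul_of_one_le_left hW0 ?_
        rw [hθσ, le_div_iff₀ hσ0]; linarith
    · push Not at hbig
      obtain ⟨hWne, hσ2⟩ := hbig
      have hWpos : 0 < ∑ h, w h := lt_of_le_of_ne hW0 (Ne.symm hWne)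
      set s := ⌊σ⌋₊ - 1 with hs
      have hfl : 2 ≤ ⌊σ⌋₊ := Nat.le_floor (by exact_mod_cast hσ2)
      have hs1 : s + 1 = ⌊σ⌋₊ := by omega
      have hsσ : ((s : ℝ) + 1) ≤ σ := by
        have := Nat.floor_le hσ0.le
        rw [← hs1] at this; exact_mod_cast this
      have hsσ' : σ ≤ 2 * ((s : ℝ) + 1) := by
        have := Nat.lt_floor_add_one σ
        rw [← hs1] at this; push_cast at this
        have : (0 : ℝ) ≤ s := Nat.cast_nonneg s
        linarith
      have hpow : ((s : ℝ) + 1) ^ (d - 1) ≤ l / c := by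
        calc ((s : ℝ) + 1) ^ (d - 1) ≤ σ ^ (d - 1) := by gcongr
          _ = l / c := by
            rw [hσ, ← Real.rpow_natCast, ← Real.rpow_mul (div_pos hl0 hc0).le, hαd, Real.rpow_one]
      have hsL : (s : ℝ) ≤ L := by
        have h1 : (s : ℝ) + 1 ≤ ((s : ℝ) + 1) ^ (d - 1) :=
          le_self_pow₀ (by linarith [(Nat.cast_nonneg s : (0 : ℝ) ≤ s)]) (by omega)
        have h2 : (l : ℝ) / c ≤ l := div_le_self hl0.le hc1
        have h3 : (l : ℝ) ≤ L := by exact_mod_cast hlL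
        linarith
      have hlogs : Real.log s ≤ Real.log L := by
        have : 1 ≤ s := by omega
        exact Real.log_le_log (by exact_mod_cast this) hsL
      have hlogs0 : 0 ≤ Real.log s := Real.log_natCast_nonneg s
      have hk0 : (1 : ℝ) ≤ k := by exact_mod_cast hk
      obtain ⟨Δ, P₁, h1, h2, h3, h4, h5⟩ := exists_simplex (φ := φ) (s := s) (k := k) hd hy hB
        (P := P') (fun q hq => hgood q (hP' hq)) (fun q hq => isShallowPt_mono hP' (hsh q (hP' hq)))
        w hw hwB hWpos (by
          calc 2 * ((4 * (k : ℝ) + 1) * (Z * (1 + Real.log s) ^ 2 * (s + 1) ^ (d - 1)))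
              ≤ 2 * ((5 * (k : ℝ)) * (Z * Λ ^ 2 * (l / c))) := by
                gcongr
                · linarith
                · rw [hΛ]; linarith
            _ = (20 * Z) / (20 * Z + 1) * (l * k / 2) := by
                rw [hc]; field_simp; ring
            _ ≤ 1 * (l * k / 2) := by
                gcongr
                rw [div_le_one (by linarith)]; linarith
            _ < P'.card := by nlinarith)
      refine ⟨Δ, P₁, h1, h2, h3, h4, h5.trans ?_⟩
      rw [hθσ, div_mul_eq_mul_div, div_le_div_iff₀ (by positivity) hσ0]
      have : 0 ≤ 2 * ((d + 1) * d) * (∑ h, w h) := by positivity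
      calc 2 * (((d : ℝ) + 1) * d) * (∑ h, w h) * σ
          ≤ 2 * ((d + 1) * d) * (∑ h, w h) * (2 * (s + 1)) := by gcongr
        _ = _ := by rw [hA]; ring
  let w₀ : ι → ℝ := fun h => if h ∈ B then 0 else 1
  obtain ⟨m, parts, Δ, h1, h2, h3, h4, h5, h6⟩ := exists_partition_weights M hk θ hθ
    (fun w => (∀ h, 0 ≤ w h) ∧ ∀ h ∈ B, w h = 0) (fun w hw => hw.1)
    (fun w Δ hw => ⟨fun h => mul_nonneg (hw.1 h) (by split_ifs <;> norm_num), fun h hh => by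
      simp only [hw.2 h hh, zero_mul]⟩) P hstep P subset_rfl hkP w₀
    ⟨fun h => by simp only [w₀]; split_ifs <;> norm_num, fun h hh => by simp [w₀, hh]⟩
  refine ⟨m, parts, Δ, h1, h2, h3, h4, h5, fun h hh => ?_⟩
  have hw₀ : ∑ h, w₀ h ≤ Fintype.card ι := by
    calc ∑ h, w₀ h ≤ ∑ _h : ι, (1 : ℝ) := Finset.sum_le_sum fun h _ => by
          simp only [w₀]; split_ifs <;> norm_num
      _ = _ := by simp
  have hle : (2 : ℝ) ^ (Finset.univ.filter fun i => ∃ x ∈ Δ i, ev (y h) x = 0).card ≤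
      Fintype.card ι * (2 * Real.exp (∑ l ∈ Finset.Icc 2 L, θ l)) := by
    calc (2 : ℝ) ^ (Finset.univ.filter fun i => ∃ x ∈ Δ i, ev (y h) x = 0).card
        = w₀ h * ∏ i, (if M (Δ i) h then (2 : ℝ) else 1) := by
          rw [Finset.prod_ite]; simp [w₀, hh, M]
      _ ≤ ∑ h, w₀ h * ∏ i, (if M (Δ i) h then (2 : ℝ) else 1) := by
          refine Finset.single_le_sum (f := fun h => w₀ h * ∏ i, (if M (Δ i) h then (2 : ℝ) else 1))
            (fun g _ => mul_nonneg ?_ (Finset.prod_nonneg fun i _ => ?_)) (Finset.mem_univ h)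
          · simp only [w₀]; split_ifs <;> norm_num
          · split_ifs <;> norm_num
      _ ≤ _ := h6
      _ ≤ _ := by
          have : 0 ≤ ∏ l ∈ Finset.Icc 2 L, (1 + θ l) :=
            Finset.prod_nonneg fun l _ => by linarith [hθ l]
          gcongr
          rw [Real.exp_sum]
          refine Finset.prod_le_prod (fun l _ => by linarith [hθ l]) fun l _ => ?_
          rw [add_comm]; exact Real.add_one_le_exp _
  have hι : (0 : ℝ) < Fintype.card ι := by
    exact_mod_cast Fintype.card_pos_iff.2 ⟨h⟩
  have hlog := Real.log_le_log (by positivity) hle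
  rw [Real.log_pow, Real.log_mul hι.ne' (by positivity), Real.log_mul (by norm_num)
    (Real.exp_pos _).ne', Real.log_exp] at hlog
  refine hlog.trans ?_
  rw [add_assoc]
  gcongr
  calc ∑ l ∈ Finset.Icc 2 L, θ l ≤ ∑ l ∈ Finset.Icc 1 L, θ l :=
        Finset.sum_le_sum_of_subset_of_nonneg (Finset.Icc_subset_Icc_left (by norm_num))
          fun l _ _ => hθ l
    _ = A * c ^ α * ∑ l ∈ Finset.Icc 1 L, (l : ℝ) ^ (-α) := by rw [Finset.mul_sum]
    _ ≤ A * c ^ α * (2 * (L : ℝ) ^ (1 - α)) := by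
        have : 0 ≤ A * c ^ α := by positivity
        gcongr
        exact sum_rpow_neg_le hα0.le hα1 L
    _ = _ := by rw [hA]; ring

end TestPartition

section Generic

/-- A nonempty open set is not covered by finitely many closed sets each of which is left
along some direction. -/
lemma exists_mem_forall_notMem {V κ : Type*} [NormedAddCommGroup V] [NormedSpace ℝ V]
    [CompleteSpace V] [Finite κ] (F : κ → Set V) (hF : ∀ k, IsClosed (F k))
    (hw : ∀ k, ∃ w, ∀ x ∈ F k, ∀ t : ℝ, t ≠ 0 → x + t • w ∉ F k) {O : Set V} (hO : IsOpen O)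
    (hne : O.Nonempty) : ∃ x ∈ O, ∀ k, x ∉ F k := by
  have hd : Dense (⋂ k, (F k)ᶜ) := by
    refine dense_iInter_of_isOpen (fun k => (hF k).isOpen_compl) fun k => ?_
    rw [← interior_eq_empty_iff_dense_compl]
    by_contra hcon
    obtain ⟨x, hx⟩ := Set.nonempty_iff_ne_empty.2 hcon
    obtain ⟨w, hw⟩ := hw k
    have hc : Filter.Tendsto (fun t : ℝ => x + t • w) (nhdsWithin 0 {0}ᶜ) (nhds x) := by
      have : Continuous fun t : ℝ => x + t • w := by fun_prop
      have := this.tendsto 0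
      rw [zero_smul, add_zero] at this
      exact this.mono_left nhdsWithin_le_nhds
    have h1 := hc.eventually (isOpen_interior.mem_nhds hx)
    obtain ⟨t, ht, ht0⟩ := (h1.and self_mem_nhdsWithin).exists
    exact hw x (interior_subset hx) t ht0 (interior_subset ht)
  obtain ⟨x, hxO, hx⟩ := hd.inter_open_nonempty O hO hne
  exact ⟨x, hxO, fun k hk => Set.mem_iInter.1 hx k hk⟩

lemma exists_dir_of_ne_top {V : Type*} [AddCommGroup V] [Module ℝ V] {W : Submodule ℝ V}
    (hW : W ≠ ⊤) : ∃ w, ∀ x ∈ W, ∀ t : ℝ, t ≠ 0 → x + t • w ∉ W := by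
  obtain ⟨w, hw⟩ := SetLike.exists_not_mem_of_ne_top W hW rfl
  refine ⟨w, fun x hx t ht h => hw ?_⟩
  have := W.smul_mem t⁻¹ ((W.add_mem_iff_right hx).1 h)
  rwa [inv_smul_smul₀ ht] at this

lemma exists_dir_of_affine_ne_top {V : Type*} [AddCommGroup V] [Module ℝ V]
    {W : AffineSubspace ℝ V} (hW : W.direction ≠ ⊤) :
    ∃ w, ∀ x ∈ W, ∀ t : ℝ, t ≠ 0 → x + t • w ∉ W := by
  obtain ⟨w, hw⟩ := SetLike.exists_not_mem_of_ne_top W.direction hW rfl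
  refine ⟨w, fun x hx t ht h => hw ?_⟩
  have h1 : t • w ∈ W.direction := by
    have := AffineSubspace.vsub_mem_direction h hx
    simpa using this
  have := W.direction.smul_mem t⁻¹ h1
  rwa [inv_smul_smul₀ ht] at this

lemma span_image_ne_top {V κ : Type*} [AddCommGroup V] [Module ℝ V]
    (f : κ → V) (A : Finset κ) (hA : A.card < Module.finrank ℝ V) :
    Submodule.span ℝ (f '' (A : Set κ)) ≠ ⊤ := by
  intro h
  have h1 := finrank_span_finset_le_card (R := ℝ) (A.image f)
  rw [Finset.coe_image, Set.finrank, h, finrank_top] at h1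
  have := Finset.card_image_le (s := A) (f := f)
  omega

lemma direction_affineSpan_ne_top {d : ℕ} (hd : 1 ≤ d)
    (S : Finset (EuclideanSpace ℝ (Fin d))) (hS : S.card ≤ d) :
    (affineSpan ℝ (S : Set (EuclideanSpace ℝ (Fin d)))).direction ≠ ⊤ := by
  intro h
  rw [direction_affineSpan] at h
  rcases S.eq_empty_or_nonempty with rfl | hne
  · rw [Finset.coe_empty, vectorSpan_empty] at h
    have := congrArg (fun W : Submodule ℝ _ => Module.finrank ℝ W) h
    simp at this
    omega
  · have h1 := finrank_vectorSpan_image_finset_le ℝ (id : EuclideanSpace ℝ (Fin d) → _) S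
      (n := S.card - 1) (by have := hne.card_pos; omega)
    rw [Finset.image_id, h, finrank_top, finrank_euclideanSpace_fin] at h1
    have := hne.card_pos
    omega

variable {d : ℕ} {ι : Type*}

lemma exists_independent_family (O : ι → Set (EuclideanSpace ℝ (Fin d) × ℝ))
    (hO : ∀ i, IsOpen (O i)) (hne : ∀ i, (O i).Nonempty) (s : Finset ι) :
    ∃ y : ι → EuclideanSpace ℝ (Fin d) × ℝ, (∀ i, y i ∈ O i) ∧
      ∀ A ⊆ s, (A.card ≤ d + 1 → LinearIndepOn ℝ y (A : Set ι)) ∧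
        (A.card ≤ d → LinearIndepOn ℝ (fun i => (y i).1) (A : Set ι)) := by
  induction s using Finset.induction_on with
  | empty =>
    choose y hy using hne
    refine ⟨y, hy, fun A hA => ?_⟩
    rw [Finset.subset_empty] at hA
    subst hA
    simp
  | insert i s his ih =>
    obtain ⟨y, hy, hyA⟩ := ih
    let F : {A // A ∈ s.powerset.filter fun A => A.card ≤ d} ⊕
        {A // A ∈ s.powerset.filter fun A => A.card < d} →
        Submodule ℝ (EuclideanSpace ℝ (Fin d) × ℝ) := Sum.elim
      (fun A => Submodule.span ℝ (y '' (A.1 : Set ι)))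
      (fun A => (Submodule.span ℝ ((fun i => (y i).1) '' (A.1 : Set ι))).comap
        (LinearMap.fst ℝ _ _))
    have hF : ∀ k, F k ≠ ⊤ := by
      rintro (⟨A, hA⟩ | ⟨A, hA⟩)
      · refine span_image_ne_top _ _ ?_
        simp only [Finset.mem_filter] at hA
        simp; omega
      · simp only [Finset.mem_filter] at hA
        intro h
        refine span_image_ne_top (fun i => (y i).1) A (by simpa using hA.2) ?_
        rw [Submodule.eq_top_iff'] at h ⊢
        exact fun x => h (x, 0)
    obtain ⟨u, huO, hu⟩ := exists_mem_forall_notMem (fun k => (F k : Set _))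
      (fun k => (F k).closed_of_finiteDimensional) (fun k => exists_dir_of_ne_top (hF k))
      (hO i) (hne i)
    have hup : ∀ A ⊆ s, ∀ j ∈ A, Function.update y i u j = y j := fun A hA j hj =>
      Function.update_of_ne (ne_of_mem_of_not_mem (hA hj) his) _ _
    refine ⟨Function.update y i u, fun j => ?_, fun A hA => ?_⟩
    · rcases eq_or_ne j i with rfl | hj
      · simpa using huO
      · simpa [hj] using hy j
    · by_cases hiA : i ∈ A
      · set A' := A.erase i with hA'
        have hA's : A' ⊆ s := by
          rw [hA', Finset.erase_eq]; intro j hj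
          simp only [Finset.mem_sdiff, Finset.mem_singleton] at hj
          exact (Finset.mem_insert.1 (hA hj.1)).resolve_left hj.2
        have hiA' : i ∉ (A' : Set ι) := by simp [hA']
        have hAA : (A : Set ι) = insert i (A' : Set ι) := by
          rw [hA', ← Finset.coe_insert, Finset.insert_erase hiA]
        have hcard : A'.card + 1 = A.card := Finset.card_erase_add_one hiA
        rw [hAA, linearIndepOn_insert hiA', linearIndepOn_insert hiA']
        refine ⟨fun hc => ⟨?_, ?_⟩, fun hc => ⟨?_, ?_⟩⟩
        · exact ((hyA A' hA's).1 (by omega)).congr fun j hj => (hup A' hA's j hj).symm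
        · rw [Function.update_self, Set.image_congr (hup A' hA's)]
          exact hu (Sum.inl ⟨A', by simp [hA's]; omega⟩)
        · exact ((hyA A' hA's).2 (by omega)).congr fun j hj => by
            simp only [hup A' hA's j hj]
        · rw [Function.update_self, Set.image_congr fun j hj => by rw [hup A' hA's j hj]]
          exact hu (Sum.inr ⟨A', by simp [hA's]; omega⟩)
      · have hAs : A ⊆ s := fun j hj =>
          (Finset.mem_insert.1 (hA hj)).resolve_left fun h => hiA (h ▸ hj)
        exact ⟨fun hc => ((hyA A hAs).1 hc).congr fun j hj => (hup A hAs j hj).symm,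
          fun hc => ((hyA A hAs).2 hc).congr fun j hj => by simp only [hup A hAs j hj]⟩

lemma finite_isVtx [Fintype ι] {y : ι → EuclideanSpace ℝ (Fin d) × ℝ}
    {φ : EuclideanSpace ℝ (Fin d)} (hy : GP y φ) : {v | IsVtx y v}.Finite := by
  have : {v | IsVtx y v} ⊆ ⋃ A : {A : Finset ι // A.card = d},
      {v | ∀ h ∈ A.1, ev (y h) v = 0} := by
    rintro v ⟨A, hA, h⟩
    exact Set.mem_iUnion.2 ⟨⟨A, hA⟩, h⟩
  refine (Set.finite_iUnion fun A => Set.Subsingleton.finite ?_).subset this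
  intro v hv v' hv'
  exact hy.eq_of_ev_eq A.2 fun i hi => (hv i hi).trans (hv' i hi).symm

/-- Members of prescribed open sets of affine functionals can be chosen in general position,
and such that the points of a given finite set are generic with respect to them. -/
lemma exists_generic_family [Fintype ι] (hd : 1 ≤ d)
    (O : ι → Set (EuclideanSpace ℝ (Fin d) × ℝ)) (hO : ∀ i, IsOpen (O i))
    (hne : ∀ i, (O i).Nonempty) (P : Finset (EuclideanSpace ℝ (Fin d))) :
    ∃ (y : ι → EuclideanSpace ℝ (Fin d) × ℝ) (φ : EuclideanSpace ℝ (Fin d)),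
      (∀ i, y i ∈ O i) ∧ GP y φ ∧ ∀ q ∈ P, (∀ h, ev (y h) q ≠ 0) ∧ GenPt y d q := by
  obtain ⟨y, hyO, hyA⟩ := exists_independent_family O hO hne Finset.univ
  let W : {J : Finset ι // J.card < d} → Submodule ℝ (EuclideanSpace ℝ (Fin d)) :=
    fun J => Submodule.span ℝ ((fun h => (y h).1) '' (J.1 : Set ι))
  have hW : ∀ J, W J ≠ ⊤ := fun J =>
    span_image_ne_top (fun h => (y h).1) J.1 (by simpa using J.2)
  obtain ⟨φ, -, hφ⟩ := exists_mem_forall_notMem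
    (V := EuclideanSpace ℝ (Fin d)) (fun J => (W J : Set (EuclideanSpace ℝ (Fin d))))
    (fun J => (W J).closed_of_finiteDimensional)
    (fun J => exists_dir_of_ne_top (hW J))
    isOpen_univ Set.univ_nonempty
  have hgp : GP y φ := by
    refine ⟨fun A hA => (hyA A (Finset.subset_univ _)).2 hA, fun x => ?_, fun J hJ => hφ ⟨J, hJ⟩⟩
    by_contra hcon
    obtain ⟨A, hAs, hA⟩ := Finset.exists_subset_card_eq (Nat.succ_le_of_lt (not_le.1 hcon))
    have hind := (hyA A (Finset.subset_univ _)).1 hA.le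
    have htop : Submodule.span ℝ (y '' (A : Set ι)) = ⊤ := by
      have h := LinearIndependent.span_eq_top_of_card_eq_finrank' hind (by simp [hA])
      rw [← h]; congr 1; ext x; simp
    let L : EuclideanSpace ℝ (Fin d) × ℝ →ₗ[ℝ] ℝ :=
      LinearMap.coprod (innerₛₗ ℝ x) LinearMap.id
    have hL : ∀ u, L u = ev u x := fun u => by simp [L, ev, real_inner_comm]
    have hle : Submodule.span ℝ (y '' (A : Set ι)) ≤ LinearMap.ker L := by
      rw [Submodule.span_le]
      rintro _ ⟨h, hh, rfl⟩
      simp only [SetLike.mem_coe, LinearMap.mem_ker, hL]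
      exact (Finset.mem_filter.1 (hAs hh)).2
    rw [htop] at hle
    have h1 : L (0, 1) = 0 := hle (x := (0, 1)) trivial
    simp [L] at h1
  have hfin := finite_isVtx hgp
  set vs := hfin.toFinset with hvs
  let U : Set (EuclideanSpace ℝ (Fin d)) :=
    ⋂ i, (fun τ => ((y i).1, (y i).2 - ⟪(y i).1, τ⟫)) ⁻¹' (O i)
  have hU : IsOpen U := isOpen_iInter_of_finite fun i => (hO i).preimage (by fun_prop)
  have hU0 : U.Nonempty := ⟨0, by simp [U, hyO]⟩
  have hy0 : ∀ i, (y i).1 ≠ 0 := fun i => by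
    have := (hgp.indep {i} (by simpa using hd)).ne_zero ⟨i, by simp⟩
    exact this
  obtain ⟨τ, hτU, hτ⟩ := exists_mem_forall_notMem
    (κ := (P × ι) ⊕ (P × {S // S ∈ vs.powerset.filter fun S => S.card ≤ d}))
    (Sum.elim (fun k => {τ | ev (y k.2) (k.1 - τ) = 0})
      (fun k => {τ | (k.1 : EuclideanSpace ℝ (Fin d)) - τ ∈
        (affineSpan ℝ (k.2.1 : Set (EuclideanSpace ℝ (Fin d))) : Set _)}))
    (by
      rintro (⟨q, i⟩ | ⟨q, S⟩)
      · exact isClosed_eq ((continuous_ev _).comp (by fun_prop)) continuous_const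
      · exact (AffineSubspace.closed_of_finiteDimensional _).preimage
          (f := fun τ => (q : EuclideanSpace ℝ (Fin d)) - τ) (by fun_prop))
    (by
      rintro (⟨q, i⟩ | ⟨q, S⟩)
      · refine ⟨(y i).1, fun x hx t ht h => ?_⟩
        simp only [Sum.elim_inl, Set.mem_ofPred_eq] at hx h
        rw [show (q : EuclideanSpace ℝ (Fin d)) - (x + t • (y i).1) = (q - x) + (-t) • (y i).1 by
          module, ev_add_smul, hx, zero_add] at h
        exact mul_ne_zero (neg_ne_zero.2 ht) (inner_self_ne_zero.2 (hy0 i)) h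
      · obtain ⟨w, hw⟩ := exists_dir_of_affine_ne_top (direction_affineSpan_ne_top hd S.1
          (Finset.mem_filter.1 S.2).2)
        refine ⟨w, fun x hx t ht h => hw _ hx (-t) (neg_ne_zero.2 ht) ?_⟩
        have h' : (q : EuclideanSpace ℝ (Fin d)) - (x + t • w) ∈ affineSpan ℝ (S.1 : Set _) := h
        rwa [show (q : EuclideanSpace ℝ (Fin d)) - (x + t • w) = (q - x) + (-t) • w by
          module] at h')
    hU hU0
  have hev : ∀ i x, ev ((y i).1, (y i).2 - ⟪(y i).1, τ⟫) x = ev (y i) (x - τ) := fun i x => by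
    simp only [ev, inner_sub_right]; ring
  refine ⟨fun i => ((y i).1, (y i).2 - ⟪(y i).1, τ⟫), φ, fun i => Set.mem_iInter.1 hτU i,
    ⟨hgp.indep, fun x => ?_, hgp.generic⟩, fun q hq => ⟨fun h => ?_, fun S hS hSv hqS => ?_⟩⟩
  · simp only [hev]; exact hgp.card_zero (x - τ)
  · rw [hev]; exact hτ (Sum.inl ⟨⟨q, hq⟩, h⟩)
  · refine hτ (Sum.inr ⟨⟨q, hq⟩, ⟨S.image (· - τ), ?_⟩⟩) ?_
    · simp only [Finset.mem_filter, Finset.mem_powerset]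
      refine ⟨fun v hv => ?_, Finset.card_image_le.trans hS⟩
      obtain ⟨v', hv', rfl⟩ := Finset.mem_image.1 hv
      obtain ⟨A, hA, h⟩ := hSv v' hv'
      rw [hvs, Set.Finite.mem_toFinset]
      exact ⟨A, hA, fun i hi => by rw [← hev]; exact h i hi⟩
    · have := AffineSubspace.mem_map_of_mem
        (AffineEquiv.constVAdd ℝ (EuclideanSpace ℝ (Fin d)) (-τ)).toAffineMap hqS
      rw [AffineSubspace.map_span] at this
      simp only [Sum.elim_inr, Set.mem_ofPred_eq, Finset.coe_image]
      have himg : (fun x => x - τ) '' (S : Set (EuclideanSpace ℝ (Fin d))) =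
          (AffineEquiv.constVAdd ℝ (EuclideanSpace ℝ (Fin d)) (-τ)).toAffineMap '' S :=
        Set.image_congr fun x _ => by simp [sub_eq_neg_add]
      rw [himg]
      simpa [sub_eq_neg_add] using this

end Generic

section Box

variable {d : ℕ}

lemma ev_eq_sum (u : EuclideanSpace ℝ (Fin d) × ℝ) (x : EuclideanSpace ℝ (Fin d)) :
    ev u x = ∑ j, u.1 j * x j + u.2 := by
  simp [ev, PiLp.inner_apply, mul_comm]

lemma continuous_ev_left (x : EuclideanSpace ℝ (Fin d)) :
    Continuous fun u : EuclideanSpace ℝ (Fin d) × ℝ => ev u x := by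
  unfold ev; fun_prop

/-- Open sets of affine functionals, any choice of which bounds a region around `P`. -/
lemma exists_box (P : Finset (EuclideanSpace ℝ (Fin d))) :
    ∃ O : (Fin d → Bool) → Set (EuclideanSpace ℝ (Fin d) × ℝ),
      (∀ η, IsOpen (O η)) ∧ (∀ η, (O η).Nonempty) ∧ (∀ η, ∀ u ∈ O η, ∀ q ∈ P, 0 < ev u q) ∧
      ∀ y : (Fin d → Bool) → EuclideanSpace ℝ (Fin d) × ℝ, (∀ η, y η ∈ O η) →
        Bornology.IsBounded {x | ∀ η, 0 ≤ ev (y η) x} := by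
  let sg : Bool → ℝ := fun b => if b then 1 else -1
  let a : (Fin d → Bool) → EuclideanSpace ℝ (Fin d) := fun η => WithLp.toLp 2 fun j => 2 * sg (η j)
  have hb : ∃ b : ℝ, ∀ η, ∀ q ∈ P, 0 < ev (a η, b) q := by
    obtain ⟨M, hM⟩ := (((Finset.univ : Finset (Fin d → Bool)) ×ˢ P).image
      fun k => -⟪a k.1, k.2⟫).exists_le
    refine ⟨M + 1, fun η q hq => ?_⟩
    have := hM (-⟪a η, q⟫) (Finset.mem_image.2 ⟨(η, q), by simp [hq], rfl⟩)
    simp only [ev]; linarith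
  obtain ⟨b, hb⟩ := hb
  refine ⟨fun η => {u | (∀ j, 1 < sg (η j) * u.1 j) ∧ u.2 < b + 1 ∧ ∀ q ∈ P, 0 < ev u q},
    fun η => ?_, fun η => ⟨(a η, b), ?_, by simp, hb η⟩, fun η u hu => hu.2.2, fun y hy => ?_⟩
  · simp only [Set.ofPred_and, Set.ofPred_forall]
    refine (isOpen_iInter_of_finite fun j => isOpen_lt continuous_const (by fun_prop)).inter
      ((isOpen_lt (by fun_prop) continuous_const).inter ?_)
    exact P.finite_toSet.isOpen_biInter fun q _ => isOpen_lt continuous_const (continuous_ev_left q)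
  · intro j
    simp only [a, sg]
    split_ifs <;> norm_num
  · refine isBounded_iff_forall_norm_le.2 ⟨√(d * (b + 1) ^ 2), fun x hx => ?_⟩
    have key : ∀ j, |x j| ≤ b + 1 := by
      let η : Fin d → Bool := fun j => decide (x j < 0)
      have h1 := hx η
      obtain ⟨h2, h3, -⟩ := hy η
      rw [ev_eq_sum] at h1
      have h4 : ∀ j, (y η).1 j * x j ≤ -|x j| := fun j => by
        have := h2 j
        simp only [sg, η] at this
        by_cases hj : x j < 0
        · rw [abs_of_neg hj]
          simp [hj] at this
          nlinarith
        · rw [abs_of_nonneg (not_lt.1 hj)]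
          simp [hj] at this
          nlinarith
      intro j
      have h5 : ∑ j, (y η).1 j * x j ≤ ∑ j, -|x j| := Finset.sum_le_sum fun j _ => h4 j
      rw [Finset.sum_neg_distrib] at h5
      have h6 := Finset.single_le_sum (f := fun j => |x j|) (fun j _ => abs_nonneg _)
        (Finset.mem_univ j)
      simp only at h6
      linarith
    refine Real.le_sqrt_of_sq_le ?_
    rw [EuclideanSpace.norm_sq_eq]
    calc ∑ j, ‖x j‖ ^ 2 ≤ ∑ _j : Fin d, (b + 1) ^ 2 := Finset.sum_le_sum fun j _ => by
          rw [Real.norm_eq_abs]; exact pow_le_pow_left₀ (abs_nonneg _) (key j) 2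
      _ = _ := by simp

/-- A partition whose simplices are crossed by few members of a family of affine functionals
that lie in prescribed open sets. -/
lemma exists_partition_open {κ : Type*} [Fintype κ] (hd : 3 ≤ d)
    (O : κ → Set (EuclideanSpace ℝ (Fin d) × ℝ)) (hO : ∀ i, IsOpen (O i))
    (hne : ∀ i, (O i).Nonempty) {k : ℕ} (hk : 1 ≤ k)
    {P : Finset (EuclideanSpace ℝ (Fin d))} (hkP : k ≤ P.card)
    (hsh : ∀ q ∈ P, IsShallowPt P k q) :
    ∃ z : κ → EuclideanSpace ℝ (Fin d) × ℝ, (∀ i, z i ∈ O i) ∧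
    ∃ (m : ℕ) (parts : Fin m → Finset (EuclideanSpace ℝ (Fin d)))
      (Δ : Fin m → Set (EuclideanSpace ℝ (Fin d))),
      (∀ i j, i ≠ j → Disjoint (parts i) (parts j)) ∧
      (∀ p, p ∈ P ↔ ∃ i, p ∈ parts i) ∧
      (∀ i, k ≤ (parts i).card ∧ (parts i).card ≤ 2 * k) ∧
      (∀ i, IsOpenSimplex (Δ i)) ∧
      (∀ i, (parts i : Set (EuclideanSpace ℝ (Fin d))) ⊆ Δ i) ∧
      ∀ h, ((Finset.univ.filter fun i => ∃ x ∈ Δ i, ev (z h) x = 0).card : ℝ) * Real.log 2 ≤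
        Real.log (2 ^ d + Fintype.card κ) + Real.log 2 +
          8 * ((d + 1) * d) * ((20 * zoneConst d (2 ^ d) + 1) *
            (1 + Real.log (P.card / k : ℕ)) ^ 2) ^ (1 / ((d : ℝ) - 1)) *
            ((P.card / k : ℕ) : ℝ) ^ (1 - 1 / ((d : ℝ) - 1)) := by
  obtain ⟨Ob, hOb, hneb, hposb, hbdd⟩ := exists_box P
  obtain ⟨y, φ, hyO, hgp, hgen⟩ := exists_generic_family (ι := (Fin d → Bool) ⊕ κ) (by omega)
    (Sum.elim Ob O) (by rintro (η | i); exacts [hOb η, hO i])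
    (by rintro (η | i); exacts [hneb η, hne i]) P
  set B : Finset ((Fin d → Bool) ⊕ κ) := Finset.univ.map Function.Embedding.inl with hB
  have hBc : B.card = 2 ^ d := by simp [hB]
  obtain ⟨m, parts, Δ, h1, h2, h3, h4, h5, h6⟩ := exists_partition_family (B := B) hd hgp
    ((hbdd (fun η => y (Sum.inl η)) fun η => hyO (Sum.inl η)).subset fun x hx η =>
      hx (Sum.inl η) (by simp [hB])) hk hkP
    (fun q hq => ⟨fun h hh => by
      obtain ⟨η, -, rfl⟩ := Finset.mem_map.1 hh
      exact hposb η _ (hyO (Sum.inl η)) q hq, (hgen q hq).1, (hgen q hq).2⟩) hsh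
  refine ⟨fun i => y (Sum.inr i), fun i => hyO (Sum.inr i), m, parts, Δ, h1, h2, h3, h4, h5,
    fun h => ?_⟩
  have := h6 (Sum.inr h) (by simp [hB])
  rw [hBc] at this
  simpa using this

end Box

section Sample

/-- A random sample meets all large sets of a family that depends on a bounded number of
sample points. -/
lemma exists_sample {α J Θ ζ : Type*} [Fintype α] [Fintype J] [Fintype Θ] [Fintype ζ]
    (R : J → (Θ → α) → Finset α) (F : ζ → α) {k N : ℕ} (hk : k < Fintype.card α)
    (hN : Fintype.card J * (N + Fintype.card ζ) ^ Fintype.card Θ *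
      (Fintype.card α ^ Fintype.card Θ * (Fintype.card α - k) ^ (N - Fintype.card Θ)) <
        Fintype.card α ^ N) :
    ∃ A : Fin N → α, ∀ (j : J) (τ : Θ → Fin N ⊕ ζ),
      (∀ i, A i ∉ R j (Sum.elim A F ∘ τ)) → (R j (Sum.elim A F ∘ τ)).card ≤ k := by
  by_contra! hcon
  have hα : 0 < Fintype.card α := by omega
  obtain ⟨a₀⟩ := Fintype.card_pos_iff.1 hα
  let T : (Θ → Fin N ⊕ ζ) → Finset (Fin N) := fun τ =>
    Finset.univ.filter fun i => ∃ θ, τ θ = Sum.inl i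
  have hTc : ∀ τ, (T τ).card ≤ Fintype.card Θ := by
    intro τ
    have : T τ ⊆ Finset.univ.biUnion fun θ : Θ => Finset.univ.filter fun i => τ θ = Sum.inl i := by
      intro i hi
      simpa [T] using hi
    refine (Finset.card_le_card this).trans (Finset.card_biUnion_le.trans ?_)
    calc ∑ θ : Θ, (Finset.univ.filter fun i => τ θ = Sum.inl i).card ≤ ∑ _θ : Θ, 1 := by
          refine Finset.sum_le_sum fun θ _ => Finset.card_le_one.2 fun a ha b hb => ?_
          simp only [Finset.mem_filter, Finset.mem_univ, true_and] at ha hb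
          exact Sum.inl_injective (ha.symm.trans hb)
      _ = _ := by simp
  let tup : (τ : Θ → Fin N ⊕ ζ) → (T τ → α) → Θ → α := fun τ v =>
    Sum.elim (fun i => if h : i ∈ T τ then v ⟨i, h⟩ else a₀) F ∘ τ
  let W : (j : J) → (τ : Θ → Fin N ⊕ ζ) → (T τ → α) → Finset (Fin N → α) := fun j τ v =>
    if k < (R j (tup τ v)).card then
      Fintype.piFinset fun i => if h : i ∈ T τ then {v ⟨i, h⟩} else (R j (tup τ v))ᶜ
    else ∅
  have hcover : (Finset.univ : Finset (Fin N → α)) ⊆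
      Finset.univ.biUnion fun x : J × (Θ → Fin N ⊕ ζ) => Finset.univ.biUnion (W x.1 x.2) := by
    intro A _
    obtain ⟨j, τ, h1, h2⟩ := hcon A
    refine Finset.mem_biUnion.2 ⟨(j, τ), Finset.mem_univ _,
      Finset.mem_biUnion.2 ⟨fun i => A i, Finset.mem_univ _, ?_⟩⟩
    have htup : tup τ (fun i => A i) = Sum.elim A F ∘ τ := by
      funext θ
      simp only [tup, Function.comp_apply]
      rcases hθ : τ θ with i | z
      · have : i ∈ T τ := by
          simp only [T, Finset.mem_filter, Finset.mem_univ, true_and]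
          exact ⟨θ, hθ⟩
        simp [this]
      · simp
    simp only [W, htup, if_pos h2, Fintype.mem_piFinset]
    intro i
    split_ifs with h
    · simp
    · exact Finset.mem_compl.2 (h1 i)
  have hW : ∀ j τ v, (W j τ v).card ≤ (Fintype.card α - k) ^ (N - (T τ).card) := by
    intro j τ v
    simp only [W]
    split_ifs with h
    swap
    · simp
    rw [Fintype.card_piFinset]
    calc ∏ i : Fin N, (if h : i ∈ T τ then {v ⟨i, h⟩} else (R j (tup τ v))ᶜ).card
        ≤ ∏ i : Fin N, (if i ∈ T τ then 1 else Fintype.card α - k) := by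
          refine Finset.prod_le_prod' fun i _ => ?_
          by_cases hi : i ∈ T τ
          · simp [hi]
          · rw [dif_neg hi, if_neg hi, Finset.card_compl]
            omega
      _ = (Fintype.card α - k) ^ (N - (T τ).card) := by
          rw [Finset.prod_ite]
          simp only [Finset.prod_const_one, one_mul, Finset.prod_const]
          congr 1
          rw [Finset.filter_not, Finset.card_sdiff]
          simp
  have hWW : ∀ x : J × (Θ → Fin N ⊕ ζ), (Finset.univ.biUnion (W x.1 x.2)).card ≤
      Fintype.card α ^ Fintype.card Θ * (Fintype.card α - k) ^ (N - Fintype.card Θ) := by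
    rintro ⟨j, τ⟩
    have hT := hTc τ
    have hTN : (T τ).card ≤ N := by simpa using (T τ).card_le_univ
    calc _ ≤ ∑ v, (W j τ v).card := Finset.card_biUnion_le
      _ ≤ ∑ _v : T τ → α, (Fintype.card α - k) ^ (N - (T τ).card) :=
          Finset.sum_le_sum fun v _ => hW j τ v
      _ = Fintype.card α ^ (T τ).card * (Fintype.card α - k) ^ (N - (T τ).card) := by simp
      _ ≤ Fintype.card α ^ (T τ).card * (Fintype.card α ^ (Fintype.card Θ - (T τ).card) *
          (Fintype.card α - k) ^ (N - Fintype.card Θ)) := by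
          refine Nat.mul_le_mul_left _ ?_
          calc (Fintype.card α - k) ^ (N - (T τ).card) ≤
                (Fintype.card α - k) ^ ((Fintype.card Θ - (T τ).card) + (N - Fintype.card Θ)) :=
                Nat.pow_le_pow_right (by omega) (by omega)
            _ ≤ _ := by
                rw [pow_add]
                exact Nat.mul_le_mul_right _ (Nat.pow_le_pow_left (by omega) _)
      _ = _ := by
          rw [← mul_assoc, ← pow_add, Nat.add_sub_cancel' hT]
  have h1 := (Finset.card_le_card hcover).trans (Finset.card_biUnion_le.trans
    (Finset.sum_le_sum fun x _ => hWW x))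
  simp only [Finset.card_univ, Finset.sum_const, Fintype.card_prod, Fintype.card_fun,
    Fintype.card_sum, Fintype.card_fin, smul_eq_mul] at h1
  exact absurd h1 (not_le.2 hN)

/-- An exponential in the square root outgrows polynomials. -/
lemma exists_forall_mul_pow_lt_exp_sqrt (c : ℝ) (a m : ℕ) :
    ∃ N₀ : ℕ, ∀ N ≥ N₀, c * ((N : ℝ) + a) ^ m < Real.exp √N := by
  have h1 : (fun x : ℝ => c * (x ^ 2 + a) ^ m) =o[Filter.atTop] Real.exp := by
    let p : Polynomial ℝ := Polynomial.C c * (Polynomial.X ^ 2 + Polynomial.C (a : ℝ)) ^ m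
    have := p.isEquivalent_atTop_lead.isBigO.trans_isLittleO
      ((Real.isLittleO_pow_exp_atTop (n := p.natDegree)).const_mul_left p.leadingCoeff)
    simpa [p] using this
  have h2 : Filter.Tendsto (fun N : ℕ => √(N : ℝ)) Filter.atTop Filter.atTop :=
    Real.tendsto_sqrt_atTop.comp tendsto_natCast_atTop_atTop
  have h3 := h2.eventually (h1.bound (by norm_num : (0 : ℝ) < 1 / 2))
  obtain ⟨N₀, h⟩ := Filter.eventually_atTop.1 h3
  refine ⟨N₀, fun N hN => ?_⟩
  have := h N hN
  rw [Real.sq_sqrt (Nat.cast_nonneg N), Real.norm_eq_abs, Real.norm_eq_abs, Real.abs_exp] at this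
  have h4 := le_abs_self (c * ((N : ℝ) + a) ^ m)
  have := Real.exp_pos √(N : ℝ)
  linarith

/-- A sample of size `O((n/k)^2)` suffices in `exists_sample`. -/
lemma exists_small_sample (cJ cΘ cζ : ℕ) : ∃ K : ℕ, ∀ {α J Θ ζ : Type} [Fintype α] [Fintype J]
    [Fintype Θ] [Fintype ζ] (R : J → (Θ → α) → Finset α) (F : ζ → α) {k : ℕ}, 1 ≤ k →
    2 * k ≤ Fintype.card α → Fintype.card J = cJ → Fintype.card Θ = cΘ → Fintype.card ζ = cζ →
    ∃ N : ℕ, (N : ℝ) ≤ K * ((Fintype.card α : ℝ) / k) ^ 2 ∧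
    ∃ A : Fin N → α, ∀ (j : J) (τ : Θ → Fin N ⊕ ζ),
      (∀ i, A i ∉ R j (Sum.elim A F ∘ τ)) → (R j (Sum.elim A F ∘ τ)).card ≤ k := by
  obtain ⟨N₀, hN₀⟩ := exists_forall_mul_pow_lt_exp_sqrt (cJ * Real.exp cΘ) cζ cΘ
  refine ⟨N₀ + cΘ + 2, ?_⟩
  intro α J Θ ζ _ _ _ _ R F k hk hkα hJ hΘ hζ
  set n := Fintype.card α with hn
  have hk0 : (0 : ℝ) < k := by exact_mod_cast hk
  have hn0 : (0 : ℝ) < n := by exact_mod_cast (by omega : 0 < n)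
  set r : ℝ := (n : ℝ) / k with hr
  have hr2 : 2 ≤ r := by rw [hr, le_div_iff₀ hk0]; exact_mod_cast hkα
  have hr4 : 4 ≤ r ^ 2 := by nlinarith
  set N := N₀ + cΘ + ⌈r ^ 2⌉₊ with hN
  have hrN : r ^ 2 ≤ N := by
    refine (Nat.le_ceil (r ^ 2)).trans ?_
    rw [hN]; push_cast
    have : (0 : ℝ) ≤ N₀ + cΘ := by positivity
    linarith
  refine ⟨N, ?_, exists_sample R F (by omega) ?_⟩
  · have h1 := (Nat.ceil_lt_add_one (zero_le_four.trans hr4)).le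
    rw [hN]; push_cast
    have : (0 : ℝ) ≤ N₀ + cΘ := by positivity
    nlinarith
  · have hexp : ((n - k : ℕ) : ℝ) ^ (N - cΘ) ≤
        (n : ℝ) ^ (N - cΘ) * (Real.exp cΘ * Real.exp (-√N)) := by
      have hr0 : 0 < r := by linarith
      have hnk : ((n - k : ℕ) : ℝ) = n * (1 - 1 / r) := by
        rw [Nat.cast_sub (by omega), hr]; field_simp
      have h1 : 1 - 1 / r ≤ Real.exp (-(1 / r)) := by
        have := Real.add_one_le_exp (-(1 / r)); linarith
      have h0 : 0 ≤ 1 - 1 / r := by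
        rw [sub_nonneg, div_le_one hr0]; linarith
      rw [hnk, mul_pow]
      gcongr
      calc (1 - 1 / r) ^ (N - cΘ) ≤ Real.exp (-(1 / r)) ^ (N - cΘ) := by gcongr
        _ = Real.exp (((N - cΘ : ℕ) : ℝ) * -(1 / r)) := by rw [← Real.exp_nat_mul]
        _ ≤ Real.exp (cΘ + -√N) := by
            apply Real.exp_le_exp.2
            rw [Nat.cast_sub (by omega)]
            have h2 : √(N : ℝ) ≤ N * (1 / r) := by
              rw [mul_one_div, le_div_iff₀ hr0]
              have h3 : r ≤ √(N : ℝ) := Real.le_sqrt_of_sq_le hrN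
              have h4 := Real.mul_self_sqrt (Nat.cast_nonneg N : (0 : ℝ) ≤ N)
              nlinarith [Real.sqrt_nonneg (N : ℝ)]
            have h3 : (cΘ : ℝ) * (1 / r) ≤ cΘ := by
              refine mul_le_of_le_one_right (Nat.cast_nonneg _) ?_
              rw [div_le_one hr0]; linarith
            linarith
        _ = _ := Real.exp_add _ _
    have hmain := hN₀ N (by omega)
    rw [hJ, hΘ, hζ, ← hn]
    have hgoal : ((cJ * (N + cζ) ^ cΘ * (n ^ cΘ * (n - k) ^ (N - cΘ)) : ℕ) : ℝ) < (n ^ N : ℕ) := by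
      push_cast
      calc (cJ : ℝ) * (N + cζ) ^ cΘ * ((n : ℝ) ^ cΘ * ((n - k : ℕ) : ℝ) ^ (N - cΘ))
          ≤ cJ * (N + cζ) ^ cΘ * ((n : ℝ) ^ cΘ *
              ((n : ℝ) ^ (N - cΘ) * (Real.exp cΘ * Real.exp (-√N)))) := by gcongr
        _ = (cJ * Real.exp cΘ * (N + cζ) ^ cΘ) * Real.exp (-√N) * (n ^ cΘ * n ^ (N - cΘ)) := by
            ring
        _ < Real.exp √N * Real.exp (-√N) * (n ^ cΘ * n ^ (N - cΘ)) := by gcongr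
        _ = _ := by
            rw [← Real.exp_add, add_neg_cancel, Real.exp_zero, one_mul, ← pow_add,
              Nat.add_sub_cancel' (by omega)]
    exact_mod_cast hgoal

end Sample

section Cone

variable {V I : Type*} [AddCommGroup V] [Module ℝ V]

/-- `w` spans an extreme ray of the cone on which all `f i` are nonnegative. -/
def IsRay (f : I → Module.Dual ℝ V) (w : V) : Prop :=
  w ≠ 0 ∧ (∀ i, 0 ≤ f i w) ∧ ∀ v, (∀ i, f i w = 0 → f i v = 0) → ∃ c : ℝ, v = c • w

lemma exists_face_hit [Fintype I] (f : I → Module.Dual ℝ V) {h v : V} (hh : ∀ i, 0 ≤ f i h)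
    (hv : ∀ i, f i h = 0 → f i v = 0) (hneg : ∃ i, f i v < 0) :
    ∃ t : ℝ, 0 < t ∧ (∀ i, 0 ≤ f i (h + t • v)) ∧
      (Finset.univ.filter fun i => f i (h + t • v) ≠ 0).card <
        (Finset.univ.filter fun i => f i h ≠ 0).card := by
  obtain ⟨i₀, hi₀⟩ := hneg
  obtain ⟨i, hi, hmin⟩ := (Finset.univ.filter fun i => f i v < 0).exists_min_image
    (fun i => f i h / (-f i v)) ⟨i₀, by simpa using hi₀⟩
  simp only [Finset.mem_filter, Finset.mem_univ, true_and] at hi hmin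
  have hpos : 0 < f i h := lt_of_le_of_ne (hh i) fun h0 => hi.ne (hv i h0.symm)
  refine ⟨f i h / (-f i v), div_pos hpos (neg_pos.2 hi), fun j => ?_, Finset.card_lt_card ?_⟩
  · rw [map_add, map_smul, smul_eq_mul]
    rcases lt_or_ge (f j v) 0 with hj | hj
    · have := hmin j hj
      rw [le_div_iff₀ (neg_pos.2 hj)] at this
      linarith
    · have := mul_nonneg (div_pos hpos (neg_pos.2 hi)).le hj
      linarith [hh j]
  · refine ⟨fun j hj => ?_, fun hsub => ?_⟩
    · simp only [Finset.mem_filter, Finset.mem_univ, true_and] at hj ⊢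
      intro h0
      exact hj (by rw [map_add, map_smul, h0, hv j h0]; simp)
    · have := hsub (show i ∈ Finset.univ.filter fun i => f i h ≠ 0 by simpa using hpos.ne')
      simp only [Finset.mem_filter, Finset.mem_univ, true_and] at this
      refine this ?_
      rw [map_add, map_smul, smul_eq_mul]
      field_simp [hi.ne]
      ring

/-- A nonzero point of a pointed polyhedral cone is a convex combination of points on extreme
rays. -/
lemma mem_convexHull_isRay [Fintype I] (f : I → Module.Dual ℝ V)
    (hker : ∀ v, (∀ i, f i v = 0) → v = 0) {h : V} (h0 : h ≠ 0) (hh : ∀ i, 0 ≤ f i h) :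
    h ∈ convexHull ℝ {w | IsRay f w} := by
  induction hn : (Finset.univ.filter fun i => f i h ≠ 0).card using Nat.strong_induction_on
    generalizing h with
  | _ n ih =>
    by_cases hray : IsRay f h
    · exact subset_convexHull _ _ hray
    have hex : ∃ v, (∀ i, f i h = 0 → f i v = 0) ∧ ∀ c : ℝ, v ≠ c • h := by
      by_contra! hcon
      exact hray ⟨h0, hh, hcon⟩
    obtain ⟨v, hv, hvc⟩ := hex
    have hθ : ∀ {g : V}, g ≠ 0 → (∀ i, 0 ≤ f i g) → 0 < ∑ i, f i g := fun hg hg' => by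
      refine lt_of_le_of_ne (Finset.sum_nonneg fun i _ => hg' i) fun h1 => hg (hker _ fun i => ?_)
      exact (Finset.sum_eq_zero_iff_of_nonneg fun i _ => hg' i).1 h1.symm i (Finset.mem_univ i)
    set e := v - ((∑ i, f i v) / ∑ i, f i h) • h with he
    have he0 : e ≠ 0 := sub_ne_zero.2 (hvc _)
    have hef : ∀ i, f i h = 0 → f i e = 0 := fun i hi => by
      rw [he, map_sub, map_smul, hi, hv i hi]; simp
    have hesum : ∑ i, f i e = 0 := by
      simp only [he, map_sub, map_smul, smul_eq_mul, Finset.sum_sub_distrib, ← Finset.mul_sum]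
      rw [div_mul_cancel₀ _ (hθ h0 hh).ne', sub_self]
    have hneg : ∃ i, f i e < 0 := by
      by_contra! hcon
      exact (hθ he0 hcon).ne' hesum
    have hneg' : ∃ i, f i (-e) < 0 := by
      by_contra! hcon
      have := hθ (neg_ne_zero.2 he0) hcon
      simp [hesum] at this
    obtain ⟨t, ht, ht1, ht2⟩ := exists_face_hit f hh hef hneg
    obtain ⟨t', ht', ht1', ht2'⟩ := exists_face_hit f hh
      (fun i hi => by rw [map_neg, hef i hi, neg_zero]) hneg'
    have hne : ∀ s : ℝ, h + s • e ≠ 0 := fun s hs => by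
      have : ∑ i, f i (h + s • e) = ∑ i, f i h := by
        simp only [map_add, map_smul, smul_eq_mul, Finset.sum_add_distrib, ← Finset.mul_sum,
          hesum, mul_zero, add_zero]
      rw [hs] at this
      simp at this
      exact (hθ h0 hh).ne this
    have m1 := ih _ (hn ▸ ht2) (hne t) ht1 rfl
    have m2 := ih _ (hn ▸ ht2') (by simpa using hne (-t')) ht1' rfl
    have := convex_convexHull ℝ {w | IsRay f w} m1 m2 (a := t' / (t + t')) (b := t / (t + t'))
      (by positivity) (by positivity) (by field_simp; ring)
    convert this using 1
    have hs : t + t' ≠ 0 := by positivity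
    have e1 : t' / (t + t') + t / (t + t') = 1 := by field_simp; ring
    have e2 : t' / (t + t') * t = t / (t + t') * t' := by ring
    calc h = (t' / (t + t') + t / (t + t')) • h +
          (t' / (t + t') * t - t / (t + t') * t') • e := by rw [e1, e2]; simp
      _ = _ := by module

lemma exists_range_convexHull [FiniteDimensional ℝ V] {n : ℕ}
    (hn : Module.finrank ℝ V + 1 ≤ n) {s : Set V} {x : V} (hx : x ∈ convexHull ℝ s) :
    ∃ w : Fin n → V, (∀ j, w j ∈ s) ∧ x ∈ convexHull ℝ (Set.range w) := by
  obtain ⟨κ, hκ, z, c, hz, hind, hc, hc1, hcx⟩ := eq_pos_convex_span_of_mem_convexHull hx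
  have hcard : Fintype.card κ ≤ n :=
    (hind.card_le_finrank_succ.trans (Nat.succ_le_succ (Submodule.finrank_le _))).trans hn
  have hne : Nonempty κ := by
    by_contra hcon
    rw [not_nonempty_iff] at hcon
    simp at hc1
  obtain ⟨g⟩ : Nonempty (κ ↪ Fin n) :=
    Function.Embedding.nonempty_of_card_le (by simpa using hcard)
  refine ⟨fun j => z (Function.invFun g j), fun j => hz ⟨_, rfl⟩, ?_⟩
  rw [← hcx]
  refine (convex_convexHull ℝ _).sum_mem (fun i _ => (hc i).le) hc1 fun i _ =>
    subset_convexHull _ _ ⟨g i, ?_⟩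
  simp only [Function.leftInverse_invFun g.injective i]

lemma exists_tuple_of_isRay [FiniteDimensional ℝ V] {d : ℕ} (hV : Module.finrank ℝ V = d + 1)
    (f : I → Module.Dual ℝ V) {w : V} (hw0 : w ≠ 0)
    (hw : ∀ v, (∀ i, f i w = 0 → f i v = 0) → ∃ c : ℝ, v = c • w) :
    ∃ t : Fin d → I, ∀ v, (∀ j, f (t j) v = 0) → ∃ c : ℝ, v = c • w := by
  set s : Set (Module.Dual ℝ V) := f '' {i | f i w = 0} with hs
  have hco : (Submodule.span ℝ s).dualCoannihilator = Submodule.span ℝ {w} := by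
    ext v
    rw [Submodule.mem_dualCoannihilator, Submodule.mem_span_singleton]
    constructor
    · intro h
      obtain ⟨c, hc⟩ := hw v fun i hi => h _ (Submodule.subset_span ⟨i, hi, rfl⟩)
      exact ⟨c, hc.symm⟩
    · rintro ⟨c, rfl⟩ φ hφ
      have : φ w = 0 := by
        induction hφ using Submodule.span_induction with
        | mem x hx => obtain ⟨i, hi, rfl⟩ := hx; exact hi
        | zero => simp
        | add x y _ _ hx hy => simp [hx, hy]
        | smul a x _ hx => simp [hx]
      simp [this]
  have hfr : Module.finrank ℝ (Submodule.span ℝ s) = d := by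
    have h1 := Subspace.finrank_add_finrank_dualCoannihilator_eq (Submodule.span ℝ s)
    rw [hco, finrank_span_singleton hw0, hV] at h1
    omega
  obtain ⟨g, hgs, hg, -⟩ := Submodule.exists_fun_fin_finrank_span_eq ℝ s
  choose ix hix hfix using hgs
  refine ⟨fun j => ix (finCongr hfr.symm j), fun v hv => ?_⟩
  have hmem : v ∈ (Submodule.span ℝ s).dualCoannihilator := by
    rw [Submodule.mem_dualCoannihilator, ← hg]
    intro φ hφ
    induction hφ using Submodule.span_induction with
    | mem x hx =>
      obtain ⟨i, rfl⟩ := hx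
      have := hv (finCongr hfr i)
      rw [← hfix i]
      simpa using this
    | zero => simp
    | add x y _ _ hx hy => simp [hx, hy]
    | smul a x _ hx => simp [hx]
  rw [hco, Submodule.mem_span_singleton] at hmem
  obtain ⟨c, hc⟩ := hmem
  exact ⟨c, hc.symm⟩

end Cone

section Cell

variable {d : ℕ} {I : Type*}

/-- Evaluation at a point, as a linear form on the space of affine functionals. -/
def evDual (x : EuclideanSpace ℝ (Fin d)) : Module.Dual ℝ (EuclideanSpace ℝ (Fin d) × ℝ) :=
  LinearMap.coprod (innerₛₗ ℝ x) LinearMap.id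

lemma evDual_apply (x : EuclideanSpace ℝ (Fin d)) (u : EuclideanSpace ℝ (Fin d) × ℝ) :
    evDual x u = ev u x := by simp [evDual, ev, real_inner_comm]

lemma ev_smul (c : ℝ) (u : EuclideanSpace ℝ (Fin d) × ℝ) (x : EuclideanSpace ℝ (Fin d)) :
    ev (c • u) x = c * ev u x := by
  rw [← evDual_apply, map_smul, evDual_apply, smul_eq_mul]

/-- An affine functional is a convex combination of multiples of functionals that vanish on
`d`-tuples of the given points, and that lie in the same closed cell. -/
lemma exists_cell_decomp [Fintype I] (p : I → EuclideanSpace ℝ (Fin d))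
    (hsep : ∀ u : EuclideanSpace ℝ (Fin d) × ℝ, (∀ i, ev u (p i) = 0) → u = 0)
    (u : (Fin d → I) → EuclideanSpace ℝ (Fin d) × ℝ) (hu0 : ∀ t, u t ≠ 0)
    (hu : ∀ t j, ev (u t) (p (t j)) = 0) {h : EuclideanSpace ℝ (Fin d) × ℝ} (h0 : h ≠ 0) :
    ∃ (t : Fin (d + 2) → Fin d → I) (c : Fin (d + 2) → ℝ), (∀ j, c j ≠ 0) ∧
      h ∈ convexHull ℝ (Set.range fun j => c j • u (t j)) ∧
      ∀ i, (∀ j, 0 ≤ ev (c j • u (t j)) (p i)) ∨ ∀ j, ev (c j • u (t j)) (p i) ≤ 0 := by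
  let σ : I → ℝ := fun i => if 0 ≤ ev h (p i) then 1 else -1
  have hσ0 : ∀ i, σ i ≠ 0 := fun i => by simp only [σ]; split_ifs <;> norm_num
  let f : I → Module.Dual ℝ (EuclideanSpace ℝ (Fin d) × ℝ) := fun i => σ i • evDual (p i)
  have hf : ∀ i v, f i v = σ i * ev v (p i) := fun i v => by
    simp [f, evDual_apply]
  have hdim : Module.finrank ℝ (EuclideanSpace ℝ (Fin d) × ℝ) = d + 1 := by simp
  have hmem := mem_convexHull_isRay f (fun v hv => hsep v fun i => by
    have := hv i
    rw [hf] at this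
    exact (mul_eq_zero.1 this).resolve_left (hσ0 i)) h0 fun i => by
      rw [hf]; simp only [σ]; split_ifs with hi
      · linarith
      · linarith
  obtain ⟨w, hw, hhw⟩ := exists_range_convexHull (n := d + 2) (by rw [hdim]) hmem
  choose t ht using fun j => exists_tuple_of_isRay hdim f (hw j).1 (hw j).2.2
  choose c hc using fun j => ht j (u (t j)) fun k => by rw [hf, hu, mul_zero]
  have hc0 : ∀ j, c j ≠ 0 := fun j h => hu0 (t j) (by rw [hc j, h, zero_smul])
  have hcw : (fun j => (c j)⁻¹ • u (t j)) = w := by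
    funext j
    rw [hc j, inv_smul_smul₀ (hc0 j)]
  refine ⟨t, fun j => (c j)⁻¹, fun j => inv_ne_zero (hc0 j), by rwa [hcw], fun i => ?_⟩
  have hj : ∀ j, (c j)⁻¹ • u (t j) = w j := fun j => congrFun hcw j
  have hfw : ∀ j, 0 ≤ σ i * ev (w j) (p i) := fun j => by
    rw [← hf]; exact (hw j).2.1 i
  simp only [hj]
  by_cases hi : 0 ≤ ev h (p i)
  · left; intro j
    simpa [σ, hi] using hfw j
  · right; intro j
    have := hfw j
    simp only [σ, if_neg hi] at this
    linarith

end Cell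

section Crossing

variable {d : ℕ}

lemma exists_vanishing (hd : 1 ≤ d) (t : Fin d → EuclideanSpace ℝ (Fin d)) :
    ∃ u : EuclideanSpace ℝ (Fin d) × ℝ, u.1 ≠ 0 ∧ ∀ j, ev u (t j) = 0 := by
  let L : EuclideanSpace ℝ (Fin d) × ℝ →ₗ[ℝ] (Fin d → ℝ) := LinearMap.pi fun j => evDual (t j)
  have hL := LinearMap.ker_ne_bot_of_finrank_lt (f := L) (by simp)
  obtain ⟨u, hu, hu0⟩ := (Submodule.ne_bot_iff _).1 hL
  have hev : ∀ j, ev u (t j) = 0 := fun j => by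
    rw [← evDual_apply]
    exact congrFun (LinearMap.mem_ker.1 hu) j
  refine ⟨u, fun h1 => hu0 ?_, hev⟩
  have := hev ⟨0, hd⟩
  rw [ev, h1, inner_zero_left, zero_add] at this
  exact Prod.ext h1 this

lemma card_zeros_le {P : Finset (EuclideanSpace ℝ (Fin d))} (hP : GenPos P)
    {u : EuclideanSpace ℝ (Fin d) × ℝ} (hu : u.1 ≠ 0) :
    (P.filter fun q => ev u q = 0).card ≤ d := by
  refine le_trans (le_of_eq ?_) (hP u.1 (-u.2) hu)
  rw [← Set.ncard_coe_finset]
  congr 1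
  ext q
  simp only [Finset.coe_filter, Set.mem_ofPred_eq, Set.mem_inter_iff, Finset.mem_coe, hyperplane,
    ev, real_inner_comm]
  refine and_congr_right fun _ => ⟨fun h => by linarith, fun h => by linarith⟩

lemma eq_zero_of_vanish {P : Finset (EuclideanSpace ℝ (Fin d))} (hP : GenPos P)
    {F : Fin (d + 1) → EuclideanSpace ℝ (Fin d)} (hF : Function.Injective F) (hFP : ∀ i, F i ∈ P)
    {u : EuclideanSpace ℝ (Fin d) × ℝ} (h : ∀ i, ev u (F i) = 0) : u = 0 := by
  by_cases hu : u.1 = 0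
  · have := h 0
    rw [ev, hu, inner_zero_left, zero_add] at this
    exact Prod.ext hu this
  · have h1 := card_zeros_le hP hu
    have h2 : Finset.univ.image F ⊆ P.filter fun q => ev u q = 0 := by
      intro q hq
      obtain ⟨i, -, rfl⟩ := Finset.mem_image.1 hq
      exact Finset.mem_filter.2 ⟨hFP i, h i⟩
    have h3 := Finset.card_le_card h2
    rw [Finset.card_image_of_injective _ hF, Finset.card_univ, Fintype.card_fin] at h3
    omega

/-- The sign encoded by a Boolean. -/
def bsign (b : Bool) : ℝ := if b then 1 else -1

/-- Perturbations of `u` in a prescribed open orthant, that preserve the strict signs on `P`. -/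
def perturb (P : Finset (EuclideanSpace ℝ (Fin d))) (u : EuclideanSpace ℝ (Fin d) × ℝ)
    (η : (Fin d → Bool) × Bool) : Set (EuclideanSpace ℝ (Fin d) × ℝ) :=
  {v | (∀ j, 0 < bsign (η.1 j) * (v.1 j - u.1 j)) ∧ 0 < bsign η.2 * (v.2 - u.2) ∧
    ∀ q ∈ P, ev u q ≠ 0 → 0 < ev u q * ev v q}

lemma isOpen_perturb (P : Finset (EuclideanSpace ℝ (Fin d)))
    (u : EuclideanSpace ℝ (Fin d) × ℝ) (η : (Fin d → Bool) × Bool) : IsOpen (perturb P u η) := by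
  simp only [perturb, Set.ofPred_and, Set.ofPred_forall]
  refine (isOpen_iInter_of_finite fun j => isOpen_lt continuous_const (by fun_prop)).inter
    ((isOpen_lt continuous_const (by fun_prop)).inter ?_)
  refine P.finite_toSet.isOpen_biInter fun q _ => ?_
  by_cases h : ev u q = 0
  · simp [h]
  · simp only [ne_eq, h, not_false_eq_true, Set.iInter_true]
    exact isOpen_lt continuous_const (continuous_const.mul (continuous_ev_left q))

lemma bsign_mul_self (b : Bool) : bsign b * bsign b = 1 := by
  unfold bsign; split_ifs <;> norm_num

lemma perturb_nonempty (P : Finset (EuclideanSpace ℝ (Fin d)))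
    (u : EuclideanSpace ℝ (Fin d) × ℝ) (η : (Fin d → Bool) × Bool) : (perturb P u η).Nonempty := by
  let s : EuclideanSpace ℝ (Fin d) × ℝ := (WithLp.toLp 2 fun j => bsign (η.1 j), bsign η.2)
  have h1 : ∀ᶠ ε in nhdsWithin (0 : ℝ) (Set.Ioi 0), ∀ q ∈ P, ev u q ≠ 0 →
      0 < ev u q * ev (u + ε • s) q := by
    refine Filter.Eventually.filter_mono nhdsWithin_le_nhds ?_
    rw [Finset.eventually_all]
    intro q _
    by_cases h : ev u q = 0
    · simp [h]
    have hc : Continuous fun ε : ℝ => ev u q * ev (u + ε • s) q :=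
      continuous_const.mul ((continuous_ev_left q).comp (by fun_prop))
    have h0 : 0 < ev u q * ev (u + (0 : ℝ) • s) q := by
      rw [zero_smul, add_zero]; exact mul_self_pos.2 h
    filter_upwards [(hc.tendsto 0).eventually (lt_mem_nhds h0)] with ε hε _ using hε
  obtain ⟨ε, hε, hε0⟩ := (h1.and self_mem_nhdsWithin).exists
  have hε0' : (0 : ℝ) < ε := hε0
  refine ⟨u + ε • s, fun j => ?_, ?_, hε⟩
  · have : (u + ε • s).1 j - u.1 j = ε * bsign (η.1 j) := by simp [s]
    rw [this]
    calc 0 < ε := hε0'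
      _ = bsign (η.1 j) * (ε * bsign (η.1 j)) := by linear_combination (-ε) * bsign_mul_self (η.1 j)
  · have : (u + ε • s).2 - u.2 = ε * bsign η.2 := by simp [s]
    rw [this]
    calc 0 < ε := hε0'
      _ = bsign η.2 * (ε * bsign η.2) := by linear_combination (-ε) * bsign_mul_self η.2

lemma exists_perturb_le (P : Finset (EuclideanSpace ℝ (Fin d)))
    (u : EuclideanSpace ℝ (Fin d) × ℝ) (c : ℝ) (x : EuclideanSpace ℝ (Fin d)) :
    ∃ η, ∀ v ∈ perturb P u η, c * ev v x ≤ c * ev u x := by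
  have key : ∀ e δ : ℝ, 0 < bsign (decide (e < 0)) * δ → e * δ ≤ 0 := fun e δ h => by
    unfold bsign at h
    by_cases he : e < 0
    · simp [he] at h; nlinarith
    · simp [he] at h; nlinarith
  refine ⟨(fun j => decide (c * x j < 0), decide (c < 0)), fun v hv => ?_⟩
  obtain ⟨h1, h2, -⟩ := hv
  have h3 : c * ev v x - c * ev u x = ∑ j, c * x j * (v.1 j - u.1 j) + c * (v.2 - u.2) := by
    have : ∑ j, c * x j * (v.1 j - u.1 j) = c * ∑ j, v.1 j * x j - c * ∑ j, u.1 j * x j := by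
      rw [Finset.mul_sum, Finset.mul_sum, ← Finset.sum_sub_distrib]
      exact Finset.sum_congr rfl fun j _ => by ring
    rw [ev_eq_sum, ev_eq_sum, this]; ring
  have h4 : ∑ j, c * x j * (v.1 j - u.1 j) ≤ 0 := Finset.sum_nonpos fun j _ => key _ _ (h1 j)
  have h5 := key _ _ h2
  linarith

lemma neg_of_convex_of_ne {Δ : Set (EuclideanSpace ℝ (Fin d))} (hΔ : Convex ℝ Δ)
    {v : EuclideanSpace ℝ (Fin d) × ℝ} (hv : ∀ x ∈ Δ, ev v x ≠ 0) {c : ℝ}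
    {x x' : EuclideanSpace ℝ (Fin d)} (hx : x ∈ Δ) (hx' : x' ∈ Δ) (h : c * ev v x ≤ 0)
    (hc : c ≠ 0) : c * ev v x' < 0 := by
  have hlt : c * ev v x < 0 := lt_of_le_of_ne h (mul_ne_zero hc (hv x hx))
  by_contra! hcon
  have hpos : 0 < c * ev v x' - c * ev v x := by linarith
  set a := c * ev v x' / (c * ev v x' - c * ev v x) with ha
  set b := -(c * ev v x) / (c * ev v x' - c * ev v x) with hb
  have hab : a + b = 1 := by rw [ha, hb, ← add_div, div_eq_one_iff_eq hpos.ne']; ring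
  refine mul_ne_zero hc (hv _ (hΔ hx hx' (a := a) (b := b) (div_nonneg hcon hpos.le)
    (div_nonneg (by linarith) hpos.le) hab)) ?_
  rw [ev_combo v x x' hab, ha, hb]
  field_simp
  ring

lemma IsOpenSimplex.convex {Δ : Set (EuclideanSpace ℝ (Fin d))} (h : IsOpenSimplex Δ) :
    Convex ℝ Δ := by
  obtain ⟨v, -, rfl⟩ := h
  exact (convex_convexHull ℝ _).interior

/-- If few simplices are crossed by the members of a test family, then few are crossed by any
hyperplane. -/
lemma ncard_crossing_le {I : Type*} [Fintype I]
    {P : Finset (EuclideanSpace ℝ (Fin d))} (hP : GenPos P)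
    (p : I → EuclideanSpace ℝ (Fin d))
    (hsep : ∀ u : EuclideanSpace ℝ (Fin d) × ℝ, (∀ i, ev u (p i) = 0) → u = 0)
    (u : (Fin d → I) → EuclideanSpace ℝ (Fin d) × ℝ) (hu0 : ∀ t, (u t).1 ≠ 0)
    (hu : ∀ t j, ev (u t) (p (t j)) = 0) {k : ℕ} (hk : 1 ≤ k)
    (hconf : ∀ (t : Fin (d + 2) → Fin d → I) (c : Fin (d + 2) → ℝ), (∀ j, c j ≠ 0) →
      (∀ i, (∀ j, 0 ≤ ev (c j • u (t j)) (p i)) ∨ ∀ j, ev (c j • u (t j)) (p i) ≤ 0) →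
      (P.filter fun q => (∃ j, c j * ev (u (t j)) q < 0) ∧
        ∃ j, 0 < c j * ev (u (t j)) q).card ≤ k)
    (z : (Fin d → I) × ((Fin d → Bool) × Bool) → EuclideanSpace ℝ (Fin d) × ℝ)
    (hz : ∀ i, z i ∈ perturb P (u i.1) i.2)
    {m : ℕ} {parts : Fin m → Finset (EuclideanSpace ℝ (Fin d))}
    {Δ : Fin m → Set (EuclideanSpace ℝ (Fin d))}
    (hdisj : ∀ i j, i ≠ j → Disjoint (parts i) (parts j)) (hsub : ∀ i, parts i ⊆ P)
    (hcard : ∀ i, k ≤ (parts i).card) (hΔ : ∀ i, IsOpenSimplex (Δ i))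
    (hpΔ : ∀ i, (parts i : Set (EuclideanSpace ℝ (Fin d))) ⊆ Δ i) {X : ℝ}
    (hX : ∀ h, ((Finset.univ.filter fun i => ∃ x ∈ Δ i, ev (z h) x = 0).card : ℝ) ≤ X)
    {a : EuclideanSpace ℝ (Fin d)} {b : ℝ} (ha : a ≠ 0) :
    ({i | (hyperplane a b ∩ Δ i).Nonempty}.ncard : ℝ) ≤
      (d + 2) * 2 ^ (d + 1) * X + ((d + 2) * d + 1) := by
  obtain ⟨t, c, hc0, hmem, hcell⟩ := exists_cell_decomp p hsep u
    (fun t h => hu0 t (by rw [h]; rfl)) hu (h := (a, -b)) (fun h => ha (congrArg Prod.fst h))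
  set Cr : Finset (Fin m) := Finset.univ.filter fun i => (hyperplane a b ∩ Δ i).Nonempty with hCr
  let Bd : Fin (d + 2) × ((Fin d → Bool) × Bool) → Finset (Fin m) := fun e =>
    Finset.univ.filter fun i => ∃ x ∈ Δ i, ev (z (t e.1, e.2)) x = 0
  set G := Cr \ Finset.univ.biUnion Bd with hG
  set Zr := Finset.univ.biUnion fun j => P.filter fun q => ev (u (t j)) q = 0 with hZr
  set Cf := P.filter fun q => (∃ j, c j * ev (u (t j)) q < 0) ∧
        ∃ j, 0 < c j * ev (u (t j)) q with hCf
  have hBd : ((Finset.univ.biUnion Bd).card : ℝ) ≤ (d + 2) * 2 ^ (d + 1) * X := by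
    calc ((Finset.univ.biUnion Bd).card : ℝ) ≤ ((∑ e, (Bd e).card : ℕ) : ℝ) := by
          exact_mod_cast Finset.card_biUnion_le
      _ = ∑ e, ((Bd e).card : ℝ) := by push_cast; rfl
      _ ≤ ∑ _e : Fin (d + 2) × ((Fin d → Bool) × Bool), X :=
          Finset.sum_le_sum fun e _ => hX (t e.1, e.2)
      _ = _ := by
          simp only [Finset.sum_const, Finset.card_univ, Fintype.card_prod, Fintype.card_fin,
            Fintype.card_fun, Fintype.card_bool, nsmul_eq_mul]
          push_cast; ring
  have hZrc : Zr.card ≤ (d + 2) * d := by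
    refine Finset.card_biUnion_le.trans ?_
    calc _ ≤ ∑ _j : Fin (d + 2), d := Finset.sum_le_sum fun j _ => card_zeros_le hP (hu0 (t j))
      _ = _ := by simp
  have hGsub : ∀ i ∈ G, parts i ⊆ Zr ∪ Cf := by
    intro i hi q hq
    rw [hG, Finset.mem_sdiff, hCr, Finset.mem_filter] at hi
    obtain ⟨⟨-, x, hxh, hxΔ⟩, hiB⟩ := hi
    have hne : ∀ j η, ∀ x ∈ Δ i, ev (z (t j, η)) x ≠ 0 := fun j η x hx h0 =>
      hiB (Finset.mem_biUnion.2 ⟨(j, η), Finset.mem_univ _, Finset.mem_filter.2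
        ⟨Finset.mem_univ _, x, hx, h0⟩⟩)
    have hx0 : ev (a, -b) x = 0 := by
      have : ⟪x, a⟫ = b := hxh
      rw [ev, real_inner_comm]; linarith
    have hqΔ := hpΔ i hq
    have hqP := hsub i hq
    have hΔc := IsOpenSimplex.convex (hΔ i)
    have claim : ∀ ε : ℝ, ε ≠ 0 → ∃ j, ε * (c j * ev (u (t j)) x) ≤ 0 := by
      intro ε _
      by_contra! hcon
      have hconv : Convex ℝ {v : EuclideanSpace ℝ (Fin d) × ℝ | 0 < ε * evDual x v} := by
        have := convex_halfSpace_gt (ε • evDual x).isLinear 0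
        simpa using this
      have := convexHull_min (by
        rintro _ ⟨j, rfl⟩
        simp only [Set.mem_ofPred_eq, evDual_apply, ev_smul]
        exact hcon j) hconv hmem
      simp only [Set.mem_ofPred_eq, evDual_apply, hx0, mul_zero, lt_irrefl] at this
    have claim2 : ∀ ε : ℝ, ε ≠ 0 → ∃ j, ev (u (t j)) q = 0 ∨ ε * (c j * ev (u (t j)) q) < 0 := by
      intro ε hε
      obtain ⟨j, hj⟩ := claim ε hε
      obtain ⟨η, hη⟩ := exists_perturb_le P (u (t j)) (ε * c j) x
      have h1 := hη _ (hz (t j, η))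
      have hεc : ε * c j ≠ 0 := mul_ne_zero hε (hc0 j)
      have h2 := neg_of_convex_of_ne hΔc (hne j η) hxΔ hqΔ
        (h1.trans (by rw [mul_assoc]; exact hj)) hεc
      refine ⟨j, or_iff_not_imp_left.2 fun h0 => ?_⟩
      have h3 := (hz (t j, η)).2.2 q hqP h0
      rw [← mul_assoc]
      by_contra! hcon
      have h4 := mul_nonpos_of_nonneg_of_nonpos hcon h2.le
      have h5 : 0 < (ε * c j) * (ε * c j) := mul_self_pos.2 hεc
      nlinarith
    obtain ⟨j, hj⟩ := claim2 1 one_ne_zero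
    obtain ⟨j', hj'⟩ := claim2 (-1) (by norm_num)
    rw [Finset.mem_union]
    rcases hj with hj | hj
    · exact Or.inl (Finset.mem_biUnion.2 ⟨j, Finset.mem_univ _, Finset.mem_filter.2 ⟨hqP, hj⟩⟩)
    rcases hj' with hj' | hj'
    · exact Or.inl (Finset.mem_biUnion.2 ⟨j', Finset.mem_univ _, Finset.mem_filter.2 ⟨hqP, hj'⟩⟩)
    · exact Or.inr (Finset.mem_filter.2 ⟨hqP, ⟨j, by linarith⟩, ⟨j', by linarith⟩⟩)
  have hGc : G.card ≤ (d + 2) * d + 1 := by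
    have h1 : k * G.card ≤ (d + 2) * d + k := by
      calc k * G.card = ∑ _i ∈ G, k := by simp [mul_comm]
        _ ≤ ∑ i ∈ G, (parts i).card := Finset.sum_le_sum fun i _ => hcard i
        _ = (G.biUnion parts).card :=
            (Finset.card_biUnion fun i _ j _ hij => hdisj i j hij).symm
        _ ≤ (Zr ∪ Cf).card := Finset.card_le_card (Finset.biUnion_subset.2 hGsub)
        _ ≤ Zr.card + Cf.card := Finset.card_union_le _ _
        _ ≤ _ := Nat.add_le_add hZrc (hconf t c hc0 hcell)
    by_contra! hcon
    have h2 : k * ((d + 2) * d + 2) ≤ k * G.card := Nat.mul_le_mul_left k hcon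
    nlinarith
  have hle : Cr.card ≤ (Finset.univ.biUnion Bd).card + G.card := by
    rw [hG]
    have := Finset.card_le_card_sdiff_add_card (s := Cr) (t := Finset.univ.biUnion Bd)
    omega
  have hset : {i | (hyperplane a b ∩ Δ i).Nonempty}.ncard = Cr.card := by
    rw [← Set.ncard_coe_finset]; simp [hCr]
  rw [hset]
  have h1 : (Cr.card : ℝ) ≤ ((Finset.univ.biUnion Bd).card : ℝ) + G.card := by exact_mod_cast hle
  have h2 : (G.card : ℝ) ≤ (d + 2) * d + 1 := by exact_mod_cast hGc
  linarith

end Crossing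

section Main

/-- The bound on the logarithm of the size of the test family and on the zone terms is absorbed
into the main term. -/
lemma exists_const_bound {d : ℕ} (hd : 3 ≤ d) (K Z : ℝ) (hK : 0 ≤ K) (hZ : 0 ≤ Z) :
    ∃ C : ℝ, 0 < C ∧ ∀ (r L N : ℝ), 2 ≤ r → 0 ≤ N → N ≤ K * r ^ 2 → 1 ≤ L → L ≤ r →
      (d + 2) * 2 ^ (d + 1) * ((Real.log (2 ^ d + (N + (d + 1)) ^ d * 2 ^ (d + 1)) + Real.log 2 +
          8 * ((d + 1) * d) * ((20 * Z + 1) * (1 + Real.log L) ^ 2) ^ (1 / ((d : ℝ) - 1)) *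
            L ^ (1 - 1 / ((d : ℝ) - 1))) / Real.log 2) + ((d + 2) * d + 1) ≤
      C * r ^ (1 - 1 / ((d : ℝ) - 1)) * Real.logb 2 r ^ (2 / ((d : ℝ) - 1)) := by
  set α := 1 / ((d : ℝ) - 1) with hα
  have hd3 : (3 : ℝ) ≤ d := by exact_mod_cast hd
  have hα0 : 0 < α := by rw [hα]; exact one_div_pos.2 (by linarith)
  have hα1 : α ≤ 1 / 2 := by
    rw [hα]; exact one_div_le_one_div_of_le (by norm_num) (by linarith)
  have h2α : 2 / ((d : ℝ) - 1) = 2 * α := by rw [hα]; ring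
  rw [h2α]
  set C₁ : ℝ := 2 ^ d + (K + (d + 1)) ^ d * 2 ^ (d + 1) with hC₁
  have hC₁1 : 1 ≤ C₁ := by
    have h1 : (1 : ℝ) ≤ 2 ^ d := one_le_pow₀ (by norm_num)
    have : 0 ≤ (K + (d + 1)) ^ d * (2 : ℝ) ^ (d + 1) := by positivity
    linarith
  have hlog2 : 0 < Real.log 2 := Real.log_pos (by norm_num)
  have hlog2' : Real.log 2 ≤ 1 := by have := Real.log_two_lt_d9; linarith
  have hlogC : 0 ≤ Real.log C₁ := Real.log_nonneg hC₁1
  set X : ℝ := (Real.log C₁ + 4 * d + 1 + 8 * ((d + 1) * d) * (80 * Z + 4)) / Real.log 2 with hX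
  have hX0 : 0 ≤ X := by positivity
  refine ⟨(d + 2) * 2 ^ (d + 1) * X + ((d + 2) * d + 1), by positivity, ?_⟩
  intro r L N hr hN hNr hL hLr
  have hr0 : 0 < r := by linarith
  set ℓ := Real.logb 2 r with hℓ
  have hℓ1 : 1 ≤ ℓ := by
    rw [hℓ, Real.le_logb_iff_rpow_le (by norm_num) hr0, Real.rpow_one]; exact hr
  have hlogr : Real.log r = ℓ * Real.log 2 := by
    rw [hℓ, Real.logb]; field_simp
  set M := r ^ (1 - α) * ℓ ^ (2 * α) with hM
  have hrα : 1 ≤ r ^ (1 - α) := Real.one_le_rpow (by linarith) (by linarith)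
  have hℓα : 1 ≤ ℓ ^ (2 * α) := Real.one_le_rpow hℓ1 (by linarith)
  have hrM : r ^ (1 - α) ≤ M := le_mul_of_one_le_right (by linarith) hℓα
  have hM1 : 1 ≤ M := hrα.trans hrM
  have e1 : Real.log (2 ^ d + (N + (d + 1)) ^ d * 2 ^ (d + 1)) ≤ (Real.log C₁ + 4 * d) * M := by
    have hr21 : 1 ≤ r ^ 2 := by nlinarith
    have h1 : N + (d + 1) ≤ (K + (d + 1)) * r ^ 2 := by nlinarith
    have h2 : 2 ^ d + (N + (d + 1)) ^ d * (2 : ℝ) ^ (d + 1) ≤ C₁ * (r ^ 2) ^ d := by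
      have h3 : (1 : ℝ) ≤ (r ^ 2) ^ d := one_le_pow₀ hr21
      calc 2 ^ d + (N + (d + 1)) ^ d * (2 : ℝ) ^ (d + 1)
          ≤ 2 ^ d * (r ^ 2) ^ d + ((K + (d + 1)) * r ^ 2) ^ d * 2 ^ (d + 1) := by
            gcongr
            exact le_mul_of_one_le_right (by positivity) h3
        _ = _ := by rw [hC₁, mul_pow]; ring
    have h4 : Real.log r ≤ 2 * r ^ (1 - α) := by
      have h5 := Real.log_le_rpow_div hr0.le (show (0 : ℝ) < 1 / 2 by norm_num)
      have h6 : r ^ (1 / 2 : ℝ) ≤ r ^ (1 - α) :=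
        Real.rpow_le_rpow_of_exponent_le (by linarith) (by linarith)
      linarith
    calc _ ≤ Real.log (C₁ * (r ^ 2) ^ d) := Real.log_le_log (by positivity) h2
      _ = Real.log C₁ + 2 * d * Real.log r := by
          rw [Real.log_mul (by positivity) (by positivity), Real.log_pow, Real.log_pow]
          push_cast; ring
      _ ≤ Real.log C₁ * M + 2 * d * (2 * M) := by
          gcongr
          · exact le_mul_of_one_le_right hlogC hM1
          · linarith
      _ = _ := by ring
  have e2 : ((20 * Z + 1) * (1 + Real.log L) ^ 2) ^ α * L ^ (1 - α) ≤ (80 * Z + 4) * M := by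
    have h1 : 1 + Real.log L ≤ 2 * ℓ := by
      have := Real.log_le_log (by linarith) hLr
      nlinarith
    have h0 : 0 ≤ 1 + Real.log L := by have := Real.log_nonneg hL; linarith
    have h2 : ((20 * Z + 1) * (1 + Real.log L) ^ 2) ^ α ≤ (80 * Z + 4) * ℓ ^ (2 * α) := by
      calc _ ≤ ((80 * Z + 4) * ℓ ^ 2) ^ α := by
            refine Real.rpow_le_rpow (by positivity) ?_ hα0.le
            calc _ ≤ (20 * Z + 1) * (2 * ℓ) ^ 2 := by gcongr
              _ = _ := by ring
        _ = (80 * Z + 4) ^ α * ℓ ^ (2 * α) := by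
            rw [Real.mul_rpow (by positivity) (by positivity), Real.rpow_mul (by linarith)]
            norm_num
        _ ≤ _ := by
            gcongr
            calc (80 * Z + 4) ^ α ≤ (80 * Z + 4) ^ (1 : ℝ) :=
                  Real.rpow_le_rpow_of_exponent_le (by linarith) (by linarith)
              _ = _ := Real.rpow_one _
    calc _ ≤ (80 * Z + 4) * ℓ ^ (2 * α) * r ^ (1 - α) := by
          refine mul_le_mul h2 (Real.rpow_le_rpow (by linarith) hLr (by linarith))
            (by positivity) (by positivity)
      _ = _ := by rw [hM]; ring
  have e3 : (Real.log (2 ^ d + (N + (d + 1)) ^ d * 2 ^ (d + 1)) + Real.log 2 +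
          8 * ((d + 1) * d) * ((20 * Z + 1) * (1 + Real.log L) ^ 2) ^ α * L ^ (1 - α)) /
            Real.log 2 ≤ X * M := by
    rw [hX, div_mul_eq_mul_div]
    gcongr
    have h3 : (8 * (((d : ℝ) + 1) * d)) * (((20 * Z + 1) * (1 + Real.log L) ^ 2) ^ α *
        L ^ (1 - α)) ≤ (8 * (((d : ℝ) + 1) * d)) * ((80 * Z + 4) * M) := by gcongr
    nlinarith
  calc _ ≤ (d + 2) * 2 ^ (d + 1) * (X * M) + ((d + 2) * d + 1) * M := by
        gcongr
        exact le_mul_of_one_le_right (by positivity) hM1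
    _ = _ := by rw [hM]; ring

variable {d : ℕ}

lemma card_parts_le {P : Finset (EuclideanSpace ℝ (Fin d))} {m k : ℕ}
    {parts : Fin m → Finset (EuclideanSpace ℝ (Fin d))} (hk : 1 ≤ k)
    (hdisj : ∀ i j, i ≠ j → Disjoint (parts i) (parts j)) (hsub : ∀ i, parts i ⊆ P)
    (hcard : ∀ i, k ≤ (parts i).card) : m ≤ P.card := by
  calc m = ∑ _i : Fin m, 1 := by simp
    _ ≤ ∑ i, (parts i).card := Finset.sum_le_sum fun i _ => hk.trans (hcard i)
    _ = (Finset.univ.biUnion parts).card :=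
        (Finset.card_biUnion fun i _ j _ hij => hdisj i j hij).symm
    _ ≤ P.card := Finset.card_le_card (Finset.biUnion_subset.2 fun i _ => hsub i)

/-- The partition for shallow points, with an unsimplified bound. -/
lemma exists_partition_of_shallow (hd : 3 ≤ d) : ∃ K : ℕ,
    ∀ (P : Finset (EuclideanSpace ℝ (Fin d))) (k : ℕ), 1 ≤ k → 2 * k ≤ P.card → GenPos P →
    (∀ q ∈ P, IsShallowPt P k q) →
    ∃ (N : ℕ) (m : ℕ) (parts : Fin m → Finset (EuclideanSpace ℝ (Fin d)))
      (Δ : Fin m → Set (EuclideanSpace ℝ (Fin d))),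
      (N : ℝ) ≤ K * ((P.card : ℝ) / k) ^ 2 ∧
      (∀ i j, i ≠ j → Disjoint (parts i) (parts j)) ∧
      (∀ p, p ∈ P ↔ ∃ i, p ∈ parts i) ∧
      (∀ i, k ≤ (parts i).card ∧ (parts i).card ≤ 2 * k) ∧
      (∀ i, IsOpenSimplex (Δ i)) ∧
      (∀ i, (parts i : Set (EuclideanSpace ℝ (Fin d))) ⊆ Δ i) ∧
      ∀ (a : EuclideanSpace ℝ (Fin d)) (b : ℝ), a ≠ 0 →
        ({i | (hyperplane a b ∩ Δ i).Nonempty}.ncard : ℝ) ≤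
        (d + 2) * 2 ^ (d + 1) * ((Real.log (2 ^ d + (N + (d + 1)) ^ d * 2 ^ (d + 1)) +
          Real.log 2 + 8 * ((d + 1) * d) * ((20 * zoneConst d (2 ^ d) + 1) *
            (1 + Real.log (P.card / k : ℕ)) ^ 2) ^ (1 / ((d : ℝ) - 1)) *
            ((P.card / k : ℕ) : ℝ) ^ (1 - 1 / ((d : ℝ) - 1))) / Real.log 2) +
          ((d + 2) * d + 1) := by
  obtain ⟨K, hK⟩ := exists_small_sample (2 ^ (d + 2)) ((d + 2) * d) (d + 1)
  refine ⟨K, fun P k hk hkP hP hsh => ?_⟩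
  have hlog2 : 0 < Real.log 2 := Real.log_pos (by norm_num)
  have hZ : 0 ≤ zoneConst d (2 ^ d) := zoneConst_nonneg (by omega) _
  rcases Nat.lt_or_ge P.card (d + 1) with hPd | hPd
  · obtain ⟨-, -, m, parts, Δ, h1, h2, h3, h4, h5, -⟩ := exists_partition_open (κ := Empty) hd
      (fun i => i.elim) (fun i => i.elim) (fun i => i.elim) hk (by omega) hsh
    refine ⟨0, m, parts, Δ, by rw [Nat.cast_zero]; positivity, h1, h2, h3, h4, h5, fun a b _ => ?_⟩
    have hm := card_parts_le hk h1 (fun i q hq => (h2 q).2 ⟨i, hq⟩) fun i => (h3 i).1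
    have hle : ({i | (hyperplane a b ∩ Δ i).Nonempty}.ncard : ℝ) ≤ d := by
      have := Set.ncard_le_ncard (Set.subset_univ {i | (hyperplane a b ∩ Δ i).Nonempty})
      rw [Set.ncard_univ, Nat.card_eq_fintype_card, Fintype.card_fin] at this
      exact_mod_cast this.trans (hm.trans (by omega))
    refine hle.trans ?_
    have hlog : 0 ≤ Real.log (2 ^ d + (((0 : ℕ) : ℝ) + (d + 1)) ^ d * 2 ^ (d + 1)) := by
      refine Real.log_nonneg ?_
      have h6 : (1 : ℝ) ≤ 2 ^ d := one_le_pow₀ (by norm_num)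
      have : 0 ≤ (((0 : ℕ) : ℝ) + (d + 1)) ^ d * (2 : ℝ) ^ (d + 1) := by positivity
      linarith
    have hd0 : (0 : ℝ) ≤ d := Nat.cast_nonneg d
    calc (d : ℝ) ≤ 0 + ((d + 2) * d + 1) := by nlinarith
      _ ≤ _ := by
          gcongr
          positivity
  · choose U hU1 hU2 using exists_vanishing (d := d) (by omega)
    obtain ⟨F⟩ : Nonempty (Fin (d + 1) ↪ {q // q ∈ P}) :=
      Function.Embedding.nonempty_of_card_le (by simpa using hPd)
    let R : (Fin (d + 2) → Bool) → (Fin (d + 2) × Fin d → {q // q ∈ P}) → Finset {q // q ∈ P} :=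
      fun s v => Finset.univ.filter fun q =>
        (∃ j, bsign (s j) * ev (U fun l => v (j, l)) q < 0) ∧
          ∃ j, 0 < bsign (s j) * ev (U fun l => v (j, l)) q
    obtain ⟨N, hN, A, hA⟩ := hK R F hk (by simpa using hkP) (by simp) (by simp) (by simp)
    set p : Fin N ⊕ Fin (d + 1) → {q // q ∈ P} := Sum.elim A F with hp
    let u : (Fin d → Fin N ⊕ Fin (d + 1)) → EuclideanSpace ℝ (Fin d) × ℝ :=
      fun t => U fun l => p (t l)
    obtain ⟨z, hz, m, parts, Δ, h1, h2, h3, h4, h5, h6⟩ := exists_partition_open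
      (κ := (Fin d → Fin N ⊕ Fin (d + 1)) × ((Fin d → Bool) × Bool)) hd
      (fun i => perturb P (u i.1) i.2) (fun i => isOpen_perturb _ _ _)
      (fun i => perturb_nonempty _ _ _) hk (by omega) hsh
    refine ⟨N, m, parts, Δ, by simpa using hN, h1, h2, h3, h4, h5, fun a b ha => ?_⟩
    refine ncard_crossing_le hP (fun i => (p i : EuclideanSpace ℝ (Fin d)))
      (fun v hv => eq_zero_of_vanish hP (Subtype.val_injective.comp F.injective)
        (fun i => (F i).2) fun i => hv (Sum.inr i)) u (fun t => hU1 _) (fun t j => hU2 _ j) hk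
      ?_ z hz h1 (fun i q hq => (h2 q).2 ⟨i, hq⟩) (fun i => (h3 i).1) h4 h5 ?_ ha
    · intro t c hc hcell
      have hsg : ∀ j e, (bsign (decide (0 < c j)) * e < 0 ↔ c j * e < 0) ∧
          (0 < bsign (decide (0 < c j)) * e ↔ 0 < c j * e) := fun j e => by
        unfold bsign
        rcases lt_or_gt_of_ne (hc j) with hj | hj
        · simp [not_lt.2 hj.le, mul_neg_iff, mul_pos_iff, hj]
        · simp [hj, mul_neg_iff, not_lt.2 hj.le]
      have hR := hA (fun j => decide (0 < c j)) (fun x => t x.1 x.2) fun i hi => by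
        simp only [R, Finset.mem_filter, Finset.mem_univ, true_and, hsg] at hi
        obtain ⟨⟨j, hj⟩, ⟨j', hj'⟩⟩ := hi
        rcases hcell (Sum.inl i) with h | h
        · have := h j
          rw [ev_smul] at this
          exact absurd hj (not_lt.2 this)
        · have := h j'
          rw [ev_smul] at this
          exact absurd hj' (not_lt.2 this)
      refine le_trans ?_ hR
      rw [← Finset.card_map (Function.Embedding.subtype _)]
      refine Finset.card_le_card fun q hq => ?_
      obtain ⟨hqP, hq⟩ := Finset.mem_filter.1 hq
      refine Finset.mem_map.2 ⟨⟨q, hqP⟩, ?_, rfl⟩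
      simp only [R, Finset.mem_filter, Finset.mem_univ, true_and, hsg]
      exact hq
    · intro h
      rw [le_div_iff₀ hlog2]
      refine (h6 h).trans (le_of_eq ?_)
      congr 4
      simp only [Fintype.card_prod, Fintype.card_fun, Fintype.card_sum, Fintype.card_fin,
        Fintype.card_bool]
      push_cast
      ring

end Main

end ShallowPartition

/-- Theorem 4.3, Partition Theorem for shallow points, `d ≥ 3`. -/
theorem partition_theorem_shallow_points (d : ℕ) (hd : 3 ≤ d) :
    ∃ C : ℝ, 0 < C ∧
      ∀ (P : Finset (EuclideanSpace ℝ (Fin d))) (n k : ℕ),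
        P.card = n → 2 ≤ k → (k : ℝ) ≤ (n : ℝ) / 2 →
        GenPos P → (∀ p ∈ P, IsShallowPt P k p) →
        ∃ (m : ℕ) (parts : Fin m → Finset (EuclideanSpace ℝ (Fin d)))
          (Δ : Fin m → Set (EuclideanSpace ℝ (Fin d))),
          (∀ i j, i ≠ j → Disjoint (parts i) (parts j)) ∧
          (∀ p, p ∈ P ↔ ∃ i, p ∈ parts i) ∧
          (∀ i, k ≤ (parts i).card ∧ (parts i).card ≤ 2 * k) ∧
          (∀ i, IsOpenSimplex (Δ i)) ∧
          (∀ i, ↑(parts i) ⊆ Δ i) ∧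
          (∀ (a : EuclideanSpace ℝ (Fin d)) (b : ℝ), a ≠ 0 →
            (({i : Fin m | (hyperplane a b ∩ Δ i).Nonempty}.ncard : ℝ)
              ≤ C * ((n : ℝ) / k) ^ (1 - 1 / ((d : ℝ) - 1)) *
                  Real.logb 2 ((n : ℝ) / k) ^ (2 / ((d : ℝ) - 1)))) := by
  obtain ⟨K, hK⟩ := ShallowPartition.exists_partition_of_shallow hd
  obtain ⟨C, hC, hbound⟩ := ShallowPartition.exists_const_bound hd K
    (ShallowPartition.zoneConst d (2 ^ d)) (Nat.cast_nonneg _)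
    (ShallowPartition.zoneConst_nonneg (by omega) _)
  refine ⟨C, hC, ?_⟩
  rintro P _ k rfl hk hkP hP hsh
  have hk0 : (0 : ℝ) < k := by exact_mod_cast (by omega : 0 < k)
  have hkP' : 2 * k ≤ P.card := by
    have : 2 * (k : ℝ) ≤ P.card := by linarith
    exact_mod_cast this
  obtain ⟨N, m, parts, Δ, hN, h1, h2, h3, h4, h5, h6⟩ := hK P k (by omega) hkP' hP hsh
  refine ⟨m, parts, Δ, h1, h2, h3, h4, h5, fun a b ha => (h6 a b ha).trans ?_⟩
  refine hbound _ _ _ ?_ (Nat.cast_nonneg N) hN ?_ Nat.cast_div_le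
  · rw [le_div_iff₀ hk0]
    linarith
  · exact_mod_cast (Nat.le_div_iff_mul_le (by omega)).2 (by omega : 1 * k ≤ P.card)
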